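/- Let p > 0 be a fixed real number. Then there exist constants C > 0 and δ₀ > 0 (possibly depending on p) such that for all 0 < δ < δ₀, | inf_{T ∈ ℝ} ( (1/δ) ∫_T^{T+δ} |ζ(1+it)|^{−p} dt )^{1/p} − (e^{−γ}/4)·δ | ≤ C δ³, where the infimum is taken over all real T. -/

import Mathlib

namespace ZetaLine

section Growth
open Complex Filter Topology

/-- The entire function `(s - 1) ζ(s)`. -/
noncomputable def zetaOne : ℂ → ℂ := Function.update (fun s ↦ (s - 1) * riemannZeta s) 1 1

lemma zetaOne_one : zetaOne 1 = 1 := by simp [zetaOne]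

lemma zetaOne_of_ne {s : ℂ} (hs : s ≠ 1) : zetaOne s = (s - 1) * riemannZeta s := by
  simp [zetaOne, hs]

lemma differentiable_zetaOne : Differentiable ℂ zetaOne := by
  intro s
  rcases eq_or_ne s 1 with rfl | hs
  · refine (analyticAt_of_differentiable_on_punctured_nhds_of_continuousAt ?_ ?_).differentiableAt
    · filter_upwards [self_mem_nhdsWithin] with t ht
      have : DifferentiableAt ℂ (fun s ↦ (s - 1) * riemannZeta s) t :=
        (by fun_prop : DifferentiableAt ℂ (fun s : ℂ ↦ s - 1) t).mul
          (differentiableAt_riemannZeta ht)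
      refine this.congr_of_eventuallyEq ?_
      filter_upwards [isOpen_ne.mem_nhds ht] with u hu using zetaOne_of_ne hu
    · simpa [zetaOne, continuousAt_update_same] using riemannZeta_residue_one
  · have : DifferentiableAt ℂ (fun s ↦ (s - 1) * riemannZeta s) s :=
      (by fun_prop : DifferentiableAt ℂ (fun s : ℂ ↦ s - 1) s).mul
        (differentiableAt_riemannZeta hs)
    refine this.congr_of_eventuallyEq ?_
    filter_upwards [isOpen_ne.mem_nhds hs] with u hu using zetaOne_of_ne hu

lemma zetaOne_ne_zero {s : ℂ} (hs : 1 ≤ s.re) : zetaOne s ≠ 0 := by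
  rcases eq_or_ne s 1 with rfl | h
  · simp [zetaOne_one]
  · rw [zetaOne_of_ne h]
    exact mul_ne_zero (sub_ne_zero.2 h) (riemannZeta_ne_zero_of_one_le_re hs)

/-- The `n`-th correction term in the comparison of `∑ n ^ (-s)` with `∫ x ^ (-s)`. -/
noncomputable def corr (n : ℕ) (s : ℂ) : ℂ :=
  (s - 1) * ((n + 1 : ℝ) : ℂ) ^ (-s) -
    (((n + 1 : ℝ) : ℂ) ^ (1 - s) - ((n + 1 + 1 : ℝ) : ℂ) ^ (1 - s))

lemma norm_cpow_sub_le {N x : ℝ} (hN : 0 < N) (hx : x ∈ Set.Icc N (N + 1)) {s : ℂ}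
    (hs : 0 < s.re) :
    ‖(N : ℂ) ^ (-s) - (x : ℂ) ^ (-s)‖ ≤ N ^ (-s.re) * min 2 (‖s‖ / N) := by
  have hx0 : 0 < x := hN.trans_le hx.1
  have h1 : ‖(N : ℂ) ^ (-s)‖ = N ^ (-s.re) := by
    rw [norm_cpow_eq_rpow_re_of_pos hN]; simp
  have h2 : ‖(x : ℂ) ^ (-s)‖ ≤ N ^ (-s.re) := by
    rw [norm_cpow_eq_rpow_re_of_pos hx0]
    simpa using Real.rpow_le_rpow_of_nonpos hN hx.1 (by simpa using hs.le)
  rw [mul_min_of_nonneg _ _ (by positivity)]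
  refine le_min ?_ ?_
  · calc _ ≤ ‖(N : ℂ) ^ (-s)‖ + ‖(x : ℂ) ^ (-s)‖ := norm_sub_le _ _
      _ ≤ _ := by linarith
  · have key : ∀ y ∈ Set.Icc N (N + 1), HasDerivWithinAt (fun y : ℝ ↦ (y : ℂ) ^ (-s))
        (-s * (y : ℂ) ^ (-s - 1)) (Set.Icc N (N + 1)) y := by
      intro y hy
      have hy0 : y ≠ 0 := (hN.trans_le hy.1).ne'
      have hs0 : -s ≠ 0 := by
        intro h; rw [neg_eq_zero] at h; simp [h] at hs
      have := hasDerivAt_ofReal_cpow_const' (x := y) (r := -s - 1) hy0 (by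
        intro h; apply hs0; linear_combination h)
      have h3 := this.const_mul (-s)
      refine HasDerivAt.hasDerivWithinAt ?_
      refine h3.congr_of_eventuallyEq (Eventually.of_forall fun z ↦ ?_)
      have e : -s - 1 + 1 = -s := by ring
      simp only [e]
      rw [mul_div_cancel₀ _ hs0]
    have hb : ∀ y ∈ Set.Icc N (N + 1), ‖-s * (y : ℂ) ^ (-s - 1)‖ ≤ N ^ (-s.re) * (‖s‖ / N) := by
      intro y hy
      have hy0 := hN.trans_le hy.1
      rw [norm_mul, norm_neg, norm_cpow_eq_rpow_re_of_pos hy0]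
      have : y ^ (-s - 1).re ≤ N ^ (-s.re - 1) := by
        simpa using Real.rpow_le_rpow_of_nonpos hN hy.1 (by simp; linarith)
      calc _ ≤ ‖s‖ * N ^ (-s.re - 1) := by gcongr
        _ = _ := by rw [Real.rpow_sub_one hN.ne']; ring
    have := (convex_Icc N (N + 1)).norm_image_sub_le_of_norm_hasDerivWithin_le key hb hx
      (Set.left_mem_Icc.2 (by linarith))
    refine this.trans ?_
    have h3 : ‖N - x‖ ≤ 1 := by
      rw [Real.norm_eq_abs, abs_le]; constructor <;> linarith [hx.1, hx.2]
    exact mul_le_of_le_one_right (by positivity) h3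

lemma norm_corr_le (n : ℕ) {s : ℂ} (hs : 0 < s.re) :
    ‖corr n s‖ ≤ ‖s - 1‖ * ((n + 1 : ℝ) ^ (-s.re) * min 2 (‖s‖ / (n + 1))) := by
  rcases eq_or_ne s 1 with rfl | hs1
  · simp [corr]
  set N : ℝ := n + 1 with hN
  have hN0 : 0 < N := by positivity
  have key : ∀ y ∈ Set.Icc N (N + 1), HasDerivWithinAt
      (fun y : ℝ ↦ (s - 1) * (N : ℂ) ^ (-s) * y + (y : ℂ) ^ (1 - s))
      ((s - 1) * ((N : ℂ) ^ (-s) - (y : ℂ) ^ (-s))) (Set.Icc N (N + 1)) y := by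
    intro y hy
    have hy0 : y ≠ 0 := (hN0.trans_le hy.1).ne'
    have h1 : 1 - s ≠ 0 := sub_ne_zero.2 hs1.symm
    have := hasDerivAt_ofReal_cpow_const' (x := y) (r := -s) hy0 (by
        intro h; apply hs1; linear_combination -h)
    have h3 := this.const_mul (1 - s)
    have h4 : HasDerivAt (fun y : ℝ ↦ (s - 1) * (N : ℂ) ^ (-s) * y) ((s - 1) * (N : ℂ) ^ (-s)) y := by
      simpa using (ofRealCLM.hasDerivAt (x := y)).const_mul ((s - 1) * (N : ℂ) ^ (-s))
    refine HasDerivAt.hasDerivWithinAt ?_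
    convert h4.add h3 using 1
    · ext z
      have : -s + 1 = 1 - s := by ring
      simp only [this, Pi.add_apply]
      field_simp
    · ring
  have := (convex_Icc N (N + 1)).norm_image_sub_le_of_norm_hasDerivWithin_le key
    (C := ‖s - 1‖ * (N ^ (-s.re) * min 2 (‖s‖ / N))) (by
      intro y hy
      rw [norm_mul]
      gcongr
      exact norm_cpow_sub_le hN0 hy hs) (Set.left_mem_Icc.2 (by linarith))
      (Set.right_mem_Icc.2 (by linarith))
  simp only [add_sub_cancel_left, norm_one, mul_one] at this
  refine le_trans (le_of_eq ?_) this
  congr 1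
  simp only [corr, hN]
  push_cast
  ring

lemma min_two_le {y θ : ℝ} (hy : 0 ≤ y) (h0 : 0 ≤ θ) (h1 : θ ≤ 1) : min 2 y ≤ 2 * y ^ θ := by
  rcases le_total y 1 with h | h
  · have : y ^ (1 : ℝ) ≤ y ^ θ := Real.rpow_le_rpow_of_exponent_ge_of_imp hy h h1 (by
      intro h2 h3; simp_all)
    rw [Real.rpow_one] at this
    have := min_le_right 2 y
    have h5 : 0 ≤ y ^ θ := by positivity
    linarith
  · have : 1 ≤ y ^ θ := Real.one_le_rpow h h0
    have := min_le_left 2 y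
    linarith

lemma norm_corr_le_rpow (n : ℕ) {s : ℂ} {θ : ℝ} (hs : 0 < s.re) (h0 : 0 ≤ θ) (h1 : θ ≤ 1) :
    ‖corr n s‖ ≤ 2 * ‖s - 1‖ * ‖s‖ ^ θ * (n + 1 : ℝ) ^ (-(s.re + θ)) := by
  refine (norm_corr_le n hs).trans ?_
  have hn : (0 : ℝ) < n + 1 := by positivity
  calc _ ≤ ‖s - 1‖ * ((n + 1 : ℝ) ^ (-s.re) * (2 * (‖s‖ / (n + 1)) ^ θ)) := by
        gcongr
        exact min_two_le (by positivity) h0 h1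
    _ = _ := by
        rw [Real.div_rpow (norm_nonneg _) hn.le, neg_add, Real.rpow_add hn, Real.rpow_neg hn.le θ]
        field_simp

lemma summable_add_one_rpow {a : ℝ} (ha : 1 < a) : Summable fun n : ℕ ↦ (n + 1 : ℝ) ^ (-a) := by
  have := (summable_nat_add_iff 1).2 (Real.summable_nat_rpow.2 (by linarith : -a < -1))
  simpa using this

lemma differentiable_corr (n : ℕ) : Differentiable ℂ (corr n) := by
  have h1 : ((n + 1 : ℝ) : ℂ) ≠ 0 := by exact_mod_cast (by positivity : (n + 1 : ℝ) ≠ 0)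
  have h2 : ((n + 1 + 1 : ℝ) : ℂ) ≠ 0 := by exact_mod_cast (by positivity : (n + 1 + 1 : ℝ) ≠ 0)
  unfold corr
  intro s
  refine DifferentiableAt.sub (DifferentiableAt.mul (by fun_prop) ?_) (DifferentiableAt.sub ?_ ?_)
  · exact DifferentiableAt.const_cpow (by fun_prop) (Or.inl h1)
  · exact DifferentiableAt.const_cpow (by fun_prop) (Or.inl h1)
  · exact DifferentiableAt.const_cpow (by fun_prop) (Or.inl h2)

lemma differentiableOn_tsum_corr :
    DifferentiableOn ℂ (fun s ↦ ∑' n, corr n s) {s | 0 < s.re} := by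
  intro s hs
  have hs : 0 < s.re := hs
  set U : Set ℂ := {z | s.re / 2 < z.re} ∩ Metric.ball 0 (‖s‖ + 1) with hU
  have hUo : IsOpen U := (isOpen_lt continuous_const continuous_re).inter Metric.isOpen_ball
  have hsU : s ∈ U := ⟨by simp; linarith, by simp⟩
  have := differentiableOn_tsum_of_summable_norm (F := corr) (U := U)
    (u := fun n ↦ 2 * (‖s‖ + 2) * (‖s‖ + 1) ^ (1 : ℝ) * (n + 1 : ℝ) ^ (-(s.re / 2 + 1)))
    ((summable_add_one_rpow (by linarith)).mul_left _)
    (fun n ↦ (differentiable_corr n).differentiableOn) hUo (by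
      intro n w hw
      have hw1 : s.re / 2 < w.re := hw.1
      have hw2 : ‖w‖ < ‖s‖ + 1 := by simpa using hw.2
      refine (norm_corr_le_rpow n (θ := 1) (by linarith) (by norm_num) le_rfl).trans ?_
      have : ‖w - 1‖ ≤ ‖s‖ + 2 := by
        calc _ ≤ ‖w‖ + ‖(1 : ℂ)‖ := norm_sub_le _ _
          _ ≤ _ := by simp; linarith
      gcongr
      simp)
  exact (this.differentiableAt (hUo.mem_nhds hsU)).differentiableWithinAt

lemma zetaOne_eq_of_one_lt {s : ℂ} (hs : 1 < s.re) : zetaOne s = 1 + ∑' n, corr n s := by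
  have hs1 : s ≠ 1 := by rintro rfl; simp at hs
  have hA : Summable fun n : ℕ ↦ ((n + 1 : ℝ) : ℂ) ^ (-s) := by
    refine Summable.of_norm ?_
    refine (summable_add_one_rpow hs).congr ?_
    intro n
    rw [norm_cpow_eq_rpow_re_of_pos (by positivity)]; simp
  have hc : Summable fun n ↦ corr n s := by
    refine Summable.of_norm_bounded
      (g := fun n ↦ 2 * ‖s - 1‖ * ‖s‖ ^ (0 : ℝ) * (n + 1 : ℝ) ^ (-(s.re + 0)))
      ((summable_add_one_rpow (by linarith)).mul_left _) ?_
    intro n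
    exact norm_corr_le_rpow n (by linarith) le_rfl zero_le_one
  have hz : riemannZeta s = ∑' n : ℕ, ((n + 1 : ℝ) : ℂ) ^ (-s) := by
    rw [zeta_eq_tsum_one_div_nat_add_one_cpow hs]
    refine tsum_congr fun n ↦ ?_
    rw [cpow_neg]; push_cast; simp
  have htel : Tendsto (fun N : ℕ ↦ ∑ n ∈ Finset.range N, (((n + 1 : ℝ) : ℂ) ^ (1 - s) -
      ((n + 1 + 1 : ℝ) : ℂ) ^ (1 - s))) atTop (𝓝 1) := by
    have : ∀ N : ℕ, ∑ n ∈ Finset.range N, (((n + 1 : ℝ) : ℂ) ^ (1 - s) -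
      ((n + 1 + 1 : ℝ) : ℂ) ^ (1 - s)) = 1 - ((N + 1 : ℝ) : ℂ) ^ (1 - s) := by
      intro N
      have := Finset.sum_range_sub' (fun n : ℕ ↦ ((n + 1 : ℝ) : ℂ) ^ (1 - s)) N
      simpa using this
    simp_rw [this]
    have h0 : Tendsto (fun N : ℕ ↦ ((N + 1 : ℝ) : ℂ) ^ (1 - s)) atTop (𝓝 0) := by
      rw [tendsto_zero_iff_norm_tendsto_zero]
      have h1 : ∀ N : ℕ, ‖((N + 1 : ℝ) : ℂ) ^ (1 - s)‖ = (N + 1 : ℝ) ^ (-(s.re - 1)) := by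
        intro N
        rw [norm_cpow_eq_rpow_re_of_pos (by positivity)]; simp
      simp_rw [h1]
      exact (tendsto_rpow_neg_atTop (by linarith)).comp
        (tendsto_atTop_add_const_right _ _ tendsto_natCast_atTop_atTop)
    simpa using tendsto_const_nhds.sub h0
  have h2 : Tendsto (fun N : ℕ ↦ ∑ n ∈ Finset.range N, corr n s) atTop
      (𝓝 ((s - 1) * riemannZeta s - 1)) := by
    simp only [corr, Finset.sum_sub_distrib, ← Finset.mul_sum]
    simp only [Finset.sum_sub_distrib] at htel
    refine Tendsto.sub ?_ htel
    rw [hz]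
    exact hA.hasSum.tendsto_sum_nat.const_mul _
  rw [tendsto_nhds_unique hc.hasSum.tendsto_sum_nat h2, zetaOne_of_ne hs1]
  ring

lemma zetaOne_eq {s : ℂ} (hs : 0 < s.re) : zetaOne s = 1 + ∑' n, corr n s := by
  have hU : IsOpen {s : ℂ | 0 < s.re} := isOpen_lt continuous_const continuous_re
  have h1 : AnalyticOnNhd ℂ zetaOne {s | 0 < s.re} :=
    differentiable_zetaOne.differentiableOn.analyticOnNhd hU
  have h2 : AnalyticOnNhd ℂ (fun s ↦ 1 + ∑' n, corr n s) {s | 0 < s.re} :=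
    (differentiableOn_tsum_corr.const_add 1).analyticOnNhd hU
  have hpc : IsPreconnected {s : ℂ | 0 < s.re} := (convex_halfSpace_re_gt 0).isPreconnected
  refine h1.eqOn_of_preconnected_of_eventuallyEq h2 hpc (z₀ := 2) (by simp) ?_ hs
  have : {s : ℂ | 1 < s.re} ∈ 𝓝 (2 : ℂ) :=
    (isOpen_lt continuous_const continuous_re).mem_nhds (by simp)
  filter_upwards [this] with z hz using zetaOne_eq_of_one_lt hz

lemma exists_norm_zetaOne_sub_one_le {ε : ℝ} (h0 : 0 < ε) (h1 : ε ≤ 1 / 2) :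
    ∃ C > 0, ∀ s : ℂ, 1 - ε ≤ s.re → ‖zetaOne s - 1‖ ≤ C * ‖s - 1‖ * ‖s‖ ^ (2 * ε) := by
  have hsum := summable_add_one_rpow (a := 1 + ε) (by linarith)
  refine ⟨2 * ∑' n : ℕ, (n + 1 : ℝ) ^ (-(1 + ε)), ?_, ?_⟩
  · have : 0 < ∑' n : ℕ, (n + 1 : ℝ) ^ (-(1 + ε)) :=
      hsum.tsum_pos (fun n ↦ by positivity) 0 (by simp)
    positivity
  · intro s hs
    have hs0 : 0 < s.re := by linarith
    rw [zetaOne_eq hs0, add_sub_cancel_left]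
    have hb : ∀ n : ℕ, ‖corr n s‖ ≤ 2 * ‖s - 1‖ * ‖s‖ ^ (2 * ε) * (n + 1 : ℝ) ^ (-(1 + ε)) := by
      intro n
      refine (norm_corr_le_rpow n hs0 (θ := 2 * ε) (by linarith) (by linarith)).trans ?_
      refine mul_le_mul_of_nonneg_left (Real.rpow_le_rpow_of_exponent_le ?_ ?_) (by positivity)
      · simp
      · linarith
    calc _ ≤ ∑' n : ℕ, 2 * ‖s - 1‖ * ‖s‖ ^ (2 * ε) * (n + 1 : ℝ) ^ (-(1 + ε)) :=
          tsum_of_norm_bounded (hsum.mul_left _).hasSum hb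
      _ = _ := by rw [tsum_mul_left]; ring

end Growth

section LowerBound
open Complex Filter Topology

lemma one_add_abs_rpow_le {a b B : ℝ} (hab : |a| ≤ |b| + 1) (hB : 0 ≤ B) (hB2 : B ≤ 2) :
    (1 + |a|) ^ B ≤ 4 * (1 + |b|) ^ B := by
  have hb := abs_nonneg b
  have ha := abs_nonneg a
  calc (1 + |a|) ^ B ≤ (2 * (1 + |b|)) ^ B := by
        apply Real.rpow_le_rpow (by positivity) (by linarith) hB
    _ = 2 ^ B * (1 + |b|) ^ B := by rw [Real.mul_rpow (by norm_num) (by positivity)]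
    _ ≤ 2 ^ (2 : ℝ) * (1 + |b|) ^ B := by
        gcongr
        norm_num
    _ = _ := by norm_num

/-- Growth of `(s - 1) ζ(s)` slightly to the left of the line `re s = 1`. -/
lemma exists_norm_zetaOne_le {ε : ℝ} (h0 : 0 < ε) (h1 : ε ≤ 1) :
    ∃ C > 0, ∀ s : ℂ, 1 - ε / 2 ≤ s.re → s.re ≤ 4 → ‖zetaOne s‖ ≤ C * (1 + |s.im|) ^ (1 + ε) := by
  obtain ⟨C, hC, h⟩ := exists_norm_zetaOne_sub_one_le (ε := ε / 2) (by linarith) (by linarith)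
  refine ⟨1 + C * 3 * 5, by positivity, fun s hs1 hs2 ↦ ?_⟩
  have hs := h s hs1
  set τ := 1 + |s.im| with hτ
  have hτ1 : 1 ≤ τ := by simp [hτ]
  have ha : ‖s - 1‖ ≤ 3 * τ := by
    calc _ ≤ |(s - 1).re| + |(s - 1).im| := norm_le_abs_re_add_abs_im _
      _ ≤ 3 + |s.im| := by
        have e1 : |(s - 1).re| ≤ 3 := by
          rw [sub_re, one_re, abs_le]; constructor <;> linarith
        have e2 : (s - 1).im = s.im := by simp
        rw [e2]; linarith
      _ ≤ _ := by linarith [abs_nonneg s.im]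
  have hb : ‖s‖ ≤ 5 * τ := by
    calc _ ≤ |s.re| + |s.im| := norm_le_abs_re_add_abs_im _
      _ ≤ 4 + |s.im| := by
        gcongr
        rw [abs_le]; constructor <;> linarith
      _ ≤ _ := by linarith [abs_nonneg s.im]
  have hc : ‖s‖ ^ (2 * (ε / 2)) ≤ 5 * τ ^ ε := by
    have e : 2 * (ε / 2) = ε := by ring
    rw [e]
    calc _ ≤ (5 * τ) ^ ε := Real.rpow_le_rpow (norm_nonneg _) hb h0.le
      _ = 5 ^ ε * τ ^ ε := Real.mul_rpow (by norm_num) (by positivity)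
      _ ≤ 5 ^ (1 : ℝ) * τ ^ ε := by gcongr; norm_num
      _ = _ := by norm_num
  have hd : 1 ≤ τ ^ (1 + ε) := Real.one_le_rpow hτ1 (by linarith)
  calc ‖zetaOne s‖ = ‖1 + (zetaOne s - 1)‖ := by ring_nf
    _ ≤ ‖(1 : ℂ)‖ + ‖zetaOne s - 1‖ := norm_add_le _ _
    _ ≤ 1 + C * (3 * τ) * (5 * τ ^ ε) := by
        rw [norm_one]
        have : C * ‖s - 1‖ * ‖s‖ ^ (2 * (ε / 2)) ≤ C * (3 * τ) * (5 * τ ^ ε) := by gcongr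
        linarith
    _ = 1 + C * 3 * 5 * τ ^ (1 + ε) := by
        rw [Real.rpow_add (by positivity), Real.rpow_one]; ring
    _ ≤ _ := by nlinarith

lemma exists_norm_deriv_zetaOne_le {ε : ℝ} (h0 : 0 < ε) (h1 : ε ≤ 1) :
    ∃ C > 0, ∀ s : ℂ, 1 - ε / 4 ≤ s.re → s.re ≤ 3 →
      ‖deriv zetaOne s‖ ≤ C * (1 + |s.im|) ^ (1 + ε) := by
  obtain ⟨C, hC, h⟩ := exists_norm_zetaOne_le h0 h1
  refine ⟨C * 4 / (ε / 4), by positivity, fun s hs1 hs2 ↦ ?_⟩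
  have := norm_deriv_le_of_forall_mem_sphere_norm_le (c := s) (R := ε / 4)
    (C := C * (4 * (1 + |s.im|) ^ (1 + ε))) (f := zetaOne) (by positivity)
    differentiable_zetaOne.diffContOnCl (by
      intro z hz
      have hz' : ‖z - s‖ = ε / 4 := by simpa [dist_eq_norm] using hz
      have hre := abs_le.1 ((abs_re_le_norm (z - s)).trans hz'.le)
      have him := (abs_im_le_norm (z - s)).trans hz'.le
      rw [sub_re] at hre
      rw [sub_im] at him
      refine (h z (by linarith) (by linarith)).trans ?_
      gcongr
      apply one_add_abs_rpow_le _ (by linarith) (by linarith)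
      have := abs_sub_abs_le_abs_sub z.im s.im
      linarith)
  refine this.trans (le_of_eq ?_)
  field_simp

lemma norm_zeta_product_ge_one {x : ℝ} (hx : 0 < x) (t : ℝ) :
    1 ≤ ‖riemannZeta (1 + x)‖ ^ 3 * ‖riemannZeta (1 + x + I * t)‖ ^ 4 *
      ‖riemannZeta (1 + x + 2 * I * t)‖ := by
  have := DirichletCharacter.norm_LFunction_product_ge_one (1 : DirichletCharacter ℂ 1) hx t
  simpa [DirichletCharacter.LFunctionTrivChar, DirichletCharacter.LFunction_modOne_eq] using this

lemma exists_le_norm_zetaOne_pow {η : ℝ} (h0 : 0 < η) (h1 : η ≤ 1) :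
    ∃ c > 0, ∀ x t : ℝ, 0 < x → x ≤ 1 → 1 ≤ |t| →
      c * x ^ 3 * (1 + |t|) ^ (4 - η) ≤ ‖zetaOne (1 + x + I * t)‖ ^ 4 := by
  obtain ⟨C, hC, h⟩ := exists_norm_zetaOne_le h0 h1
  refine ⟨1 / (64 * C ^ 4), by positivity, fun x t hx0 hx1 ht ↦ ?_⟩
  set τ := 1 + |t| with hτ
  have hτ1 : 1 ≤ τ := by simp [hτ]
  have hτt : τ ≤ 2 * |t| := by linarith
  have ht0 : t ≠ 0 := by rintro rfl; norm_num at ht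
  have key := norm_zeta_product_ge_one hx0 t
  have ne1 : (1 + x : ℂ) ≠ 1 := by simp [hx0.ne']
  have ne2 : (1 + x + I * t : ℂ) ≠ 1 := by
    intro hh; have := congrArg im hh; simp at this; exact ht0 this
  have ne3 : (1 + x + 2 * I * t : ℂ) ≠ 1 := by
    intro hh; have := congrArg im hh; simp at this; exact ht0 this
  have e1 : ‖riemannZeta (1 + x)‖ ≤ C / x := by
    have := h (1 + x) (by simp; linarith) (by simp; linarith)
    rw [zetaOne_of_ne ne1, norm_mul] at this
    rw [le_div_iff₀ hx0]
    simp only [add_sub_cancel_left, norm_real, Real.norm_eq_abs, abs_of_pos hx0] at this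
    simpa [mul_comm] using this
  have e2 : ‖riemannZeta (1 + x + I * t)‖ ≤ ‖zetaOne (1 + x + I * t)‖ / |t| := by
    rw [le_div_iff₀ (by positivity), zetaOne_of_ne ne2, norm_mul, mul_comm]
    gcongr
    have := abs_im_le_norm (1 + x + I * t - 1 : ℂ)
    simpa using this
  have e3 : ‖riemannZeta (1 + x + 2 * I * t)‖ ≤ 4 * C * τ ^ η := by
    have := h (1 + x + 2 * I * t) (by simp; linarith) (by simp; linarith)
    rw [zetaOne_of_ne ne3, norm_mul] at this
    have h3 : τ ≤ ‖(1 + x + 2 * I * t - 1 : ℂ)‖ := by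
      have := abs_im_le_norm (1 + x + 2 * I * t - 1 : ℂ)
      simp only [sub_im, add_im, one_im, ofReal_im, mul_im] at this
      simp [abs_mul] at this
      linarith
    have h4 : (1 + |(1 + x + 2 * I * t : ℂ).im|) ^ (1 + η) ≤ 4 * τ ^ (1 + η) := by
      have : (1 + x + 2 * I * t : ℂ).im = 2 * t := by simp
      rw [this, abs_mul, abs_two]
      calc _ ≤ (2 * τ) ^ (1 + η) := Real.rpow_le_rpow (by positivity) (by linarith) (by linarith)
        _ = 2 ^ (1 + η) * τ ^ (1 + η) := Real.mul_rpow (by norm_num) (by positivity)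
        _ ≤ 2 ^ (2 : ℝ) * τ ^ (1 + η) := by
          gcongr
          · norm_num
          · linarith
        _ = _ := by norm_num
    have h5 : τ * ‖riemannZeta (1 + x + 2 * I * t)‖ ≤ C * (4 * (τ * τ ^ η)) := by
      calc _ ≤ ‖(1 + x + 2 * I * t - 1 : ℂ)‖ * ‖riemannZeta (1 + x + 2 * I * t)‖ := by gcongr
        _ ≤ _ := this
        _ ≤ C * (4 * τ ^ (1 + η)) := by gcongr
        _ = _ := by rw [Real.rpow_add (by positivity), Real.rpow_one]
    have : 0 < τ := by positivity
    nlinarith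
  have e4 : 1 ≤ (C / x) ^ 3 * (‖zetaOne (1 + x + I * t)‖ / |t|) ^ 4 * (4 * C * τ ^ η) :=
    key.trans (by gcongr)
  set N := ‖zetaOne (1 + x + I * t)‖
  have hτη : 0 < τ ^ η := by positivity
  have e5 : x ^ 3 * |t| ^ 4 ≤ 4 * C ^ 4 * τ ^ η * N ^ 4 := by
    have : (C / x) ^ 3 * (N / |t|) ^ 4 * (4 * C * τ ^ η) =
      4 * C ^ 4 * τ ^ η * N ^ 4 / (x ^ 3 * |t| ^ 4) := by field_simp
    rw [this, le_div_iff₀ (by positivity)] at e4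
    linarith
  have e6 : τ ^ 4 ≤ 16 * |t| ^ 4 := by
    calc τ ^ 4 ≤ (2 * |t|) ^ 4 := by gcongr
      _ = _ := by ring
  have e7 : τ ^ (4 - η) = τ ^ 4 / τ ^ η := by
    rw [Real.rpow_sub (by positivity)]; norm_cast
  rw [e7]
  have : 1 / (64 * C ^ 4) * x ^ 3 * (τ ^ 4 / τ ^ η) = x ^ 3 * τ ^ 4 / (64 * C ^ 4 * τ ^ η) := by
    field_simp
  rw [this, div_le_iff₀ (by positivity)]
  have hx3 : 0 ≤ x ^ 3 := by positivity
  nlinarith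

lemma exists_le_norm_zetaOne_of_one_le_abs {η : ℝ} (h0 : 0 < η) (h1 : η ≤ 1) :
    ∃ c > 0, ∀ s : ℂ, 1 ≤ s.re → s.re ≤ 2 → 1 ≤ |s.im| →
      c * (1 + |s.im|) ^ (1 - 4 * η) ≤ ‖zetaOne s‖ := by
  obtain ⟨c, hc, hlow⟩ := exists_le_norm_zetaOne_pow h0 h1
  obtain ⟨C, hC, hder⟩ := exists_norm_deriv_zetaOne_le h0 h1
  set κ := min (c / (16 * C ^ 4)) 1 with hκ
  have hκ0 : 0 < κ := by positivity
  have hκ1 : κ ≤ 1 := min_le_right _ _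
  have hκc : 16 * C ^ 4 * κ ≤ c := by
    have := min_le_left (c / (16 * C ^ 4)) 1
    rw [le_div_iff₀ (by positivity)] at this
    linarith
  refine ⟨C * κ, by positivity, fun s hs1 hs2 hs3 ↦ ?_⟩
  set τ := 1 + |s.im| with hτ
  have hτ1 : 1 ≤ τ := by simp [hτ]
  have hτ0 : 0 < τ := by positivity
  set x₀ := κ * τ ^ (-(5 * η)) with hx₀
  have hx₀0 : 0 < x₀ := by positivity
  have hx₀1 : x₀ ≤ 1 := by
    have : τ ^ (-(5 * η)) ≤ 1 := Real.rpow_le_one_of_one_le_of_nonpos hτ1 (by linarith)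
    calc x₀ = κ * τ ^ (-(5 * η)) := hx₀
      _ ≤ 1 * 1 := by gcongr
      _ = 1 := by norm_num
  have hpow : ∀ x, x₀ ≤ x → x ≤ 1 → 2 * C * κ * τ ^ (1 - 4 * η) ≤ ‖zetaOne (1 + x + I * s.im)‖ := by
    intro x hx hx1
    have := hlow x s.im (by linarith) hx1 hs3
    refine le_of_pow_le_pow_left₀ (n := 4) (by norm_num) (norm_nonneg _) (le_trans ?_ this)
    have e1 : x₀ ^ 3 ≤ x ^ 3 := by gcongr
    have e2 : x₀ ^ 3 * τ ^ (4 - η) = κ ^ 3 * τ ^ (4 - 16 * η) := by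
      rw [hx₀, mul_pow, ← Real.rpow_mul_natCast hτ0.le, mul_assoc, ← Real.rpow_add hτ0]
      congr 2; push_cast; ring
    calc (2 * C * κ * τ ^ (1 - 4 * η)) ^ 4 = (16 * C ^ 4 * κ) * (κ ^ 3 * τ ^ (4 - 16 * η)) := by
          rw [mul_pow, ← Real.rpow_mul_natCast hτ0.le]
          have : (1 - 4 * η) * ((4 : ℕ) : ℝ) = 4 - 16 * η := by push_cast; ring
          rw [this]; ring
      _ ≤ c * (κ ^ 3 * τ ^ (4 - 16 * η)) := by gcongr
      _ = c * x₀ ^ 3 * τ ^ (4 - η) := by rw [← e2]; ring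
      _ ≤ _ := by gcongr
  have hs : s = 1 + (s.re - 1 : ℝ) + I * s.im := by
    apply Complex.ext <;> simp
  rcases le_total x₀ (s.re - 1) with hx | hx
  · have := hpow _ hx (by linarith)
    rw [← hs] at this
    have h6 : 0 < C * κ * τ ^ (1 - 4 * η) := by positivity
    linarith
  · have h5 := hpow x₀ le_rfl hx₀1
    set z : ℂ := 1 + x₀ + I * s.im with hz
    have hseg : ‖zetaOne s - zetaOne z‖ ≤ C * τ ^ (1 + η) * ‖s - z‖ := by
      refine (convex_segment z s).norm_image_sub_le_of_norm_deriv_le (f := zetaOne)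
        (fun w _ ↦ differentiable_zetaOne w) ?_ (left_mem_segment ℝ z s) (right_mem_segment ℝ z s)
      intro w hw
      obtain ⟨a, b, ha, hb, hab, rfl⟩ := hw
      have him : (a • z + b • s).im = s.im := by
        simp [hz]; rw [← add_mul, hab, one_mul]
      have hre : (a • z + b • s).re = 1 + a * x₀ + b * (s.re - 1) := by
        simp [hz]; linear_combination hab
      have := hder (a • z + b • s) (by rw [hre]; nlinarith) (by rw [hre]; nlinarith)
      rwa [him] at this
    have hd : ‖s - z‖ ≤ x₀ := by
      have : s - z = ((s.re - 1 - x₀ : ℝ) : ℂ) := by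
        rw [hz]; apply Complex.ext <;> simp; ring
      rw [this, norm_real, Real.norm_eq_abs, abs_le]; constructor <;> linarith
    have h7 : C * τ ^ (1 + η) * ‖s - z‖ ≤ C * κ * τ ^ (1 - 4 * η) := by
      calc _ ≤ C * τ ^ (1 + η) * x₀ := by gcongr
        _ = C * κ * (τ ^ (1 + η) * τ ^ (-(5 * η))) := by rw [hx₀]; ring
        _ = _ := by rw [← Real.rpow_add hτ0]; ring_nf
    have h8 : ‖zetaOne z‖ ≤ ‖zetaOne s‖ + ‖zetaOne s - zetaOne z‖ := by
      have := norm_sub_norm_le (zetaOne z) (zetaOne s)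
      rw [norm_sub_rev] at this
      linarith
    linarith

/-- Quantitative nonvanishing of `(s - 1) ζ(s)` on `1 ≤ re s ≤ 2`. -/
lemma exists_le_norm_zetaOne {ε : ℝ} (h0 : 0 < ε) (h1 : ε ≤ 1) :
    ∃ c > 0, ∀ s : ℂ, 1 ≤ s.re → s.re ≤ 2 → c * (1 + |s.im|) ^ (1 - ε) ≤ ‖zetaOne s‖ := by
  obtain ⟨c, hc, h⟩ := exists_le_norm_zetaOne_of_one_le_abs (η := ε / 4) (by linarith) (by linarith)
  have hK : IsCompact (Set.Icc (1 : ℝ) 2 ×ℂ Set.Icc (-1 : ℝ) 1) := isCompact_Icc.reProdIm isCompact_Icc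
  obtain ⟨z, hz, hmin⟩ := hK.exists_isMinOn (f := fun s ↦ ‖zetaOne s‖)
    ⟨1, by simp [Complex.mem_reProdIm]⟩ differentiable_zetaOne.continuous.norm.continuousOn
  have hz0 : 0 < ‖zetaOne z‖ := norm_pos_iff.2 (zetaOne_ne_zero hz.1.1)
  refine ⟨min c (‖zetaOne z‖ / 2), by positivity, fun s hs1 hs2 ↦ ?_⟩
  rcases le_total 1 |s.im| with hs | hs
  · have := h s hs1 hs2 hs
    have e : 1 - 4 * (ε / 4) = 1 - ε := by ring
    rw [e] at this
    refine le_trans ?_ this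
    gcongr
    exact min_le_left _ _
  · have hm : ‖zetaOne z‖ ≤ ‖zetaOne s‖ := hmin ⟨⟨hs1, hs2⟩, abs_le.1 hs⟩
    have h2 : (1 + |s.im|) ^ (1 - ε) ≤ 2 := by
      calc _ ≤ (1 + |s.im|) ^ (1 : ℝ) :=
            Real.rpow_le_rpow_of_exponent_le (by simp) (by linarith)
        _ ≤ 2 := by rw [Real.rpow_one]; linarith
    calc _ ≤ (‖zetaOne z‖ / 2) * 2 := by
          gcongr
          exact min_le_right _ _
      _ ≤ _ := by linarith

/-- A zero-free region, with a bound for the logarithmic derivative of `(s - 1) ζ(s)` there. -/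
lemma exists_zeroFree {ε : ℝ} (h0 : 0 < ε) (h1 : ε ≤ 1) :
    ∃ r > 0, r ≤ 1 ∧ ∃ C > 0, ∀ s w : ℂ, 1 ≤ s.re → s.re ≤ 2 →
      ‖w - s‖ ≤ r * (1 + |s.im|) ^ (-ε) →
      zetaOne w ≠ 0 ∧ ‖deriv zetaOne w / zetaOne w‖ ≤ C * (1 + |s.im|) ^ ε := by
  obtain ⟨c, hc, hlow⟩ := exists_le_norm_zetaOne (ε := ε / 2) (by linarith) (by linarith)
  obtain ⟨C, hC, hder⟩ := exists_norm_deriv_zetaOne_le (ε := ε / 2) (by linarith) (by linarith)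
  set r := min (c / (8 * C)) (ε / 8) with hr
  have hr0 : 0 < r := by positivity
  have hr1 : r ≤ ε / 8 := min_le_right _ _
  have hrc : 4 * C * r ≤ c / 2 := by
    have := min_le_left (c / (8 * C)) (ε / 8)
    rw [le_div_iff₀ (by positivity)] at this
    linarith
  refine ⟨r, hr0, by linarith, 4 * C / (c / 2), by positivity, fun s w hs1 hs2 hw ↦ ?_⟩
  set τ := 1 + |s.im| with hτ
  have hτ1 : 1 ≤ τ := by simp [hτ]
  have hτ0 : 0 < τ := by positivity
  have hle : r * τ ^ (-ε) ≤ r := by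
    have : τ ^ (-ε) ≤ 1 := Real.rpow_le_one_of_one_le_of_nonpos hτ1 (by linarith)
    exact mul_le_of_le_one_right hr0.le this
  have hdb : ∀ z ∈ Metric.closedBall s r,
      ‖deriv zetaOne z‖ ≤ 4 * C * τ ^ (1 + ε / 2) := by
    intro z hz
    have hz' : ‖z - s‖ ≤ r := by simpa [dist_eq_norm] using hz
    have hre := abs_le.1 ((abs_re_le_norm (z - s)).trans hz')
    have him := (abs_im_le_norm (z - s)).trans hz'
    rw [sub_re] at hre
    rw [sub_im] at him
    refine (hder z (by linarith) (by linarith)).trans ?_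
    rw [mul_comm 4 C, mul_assoc]
    gcongr
    apply one_add_abs_rpow_le _ (by linarith) (by linarith)
    have := abs_sub_abs_le_abs_sub z.im s.im
    linarith
  have hwr : w ∈ Metric.closedBall s r := by
    simpa [dist_eq_norm] using hw.trans hle
  have hdiff : ‖zetaOne w - zetaOne s‖ ≤ 4 * C * τ ^ (1 + ε / 2) * ‖w - s‖ :=
    (convex_closedBall s r).norm_image_sub_le_of_norm_deriv_le
      (fun w _ ↦ differentiable_zetaOne w) hdb (Metric.mem_closedBall_self hr0.le) hwr
  have hl := hlow s hs1 hs2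
  rw [← hτ] at hl
  have h4 : 4 * C * τ ^ (1 + ε / 2) * ‖w - s‖ ≤ c / 2 * τ ^ (1 - ε / 2) := by
    calc _ ≤ 4 * C * τ ^ (1 + ε / 2) * (r * τ ^ (-ε)) := by gcongr
      _ = 4 * C * r * (τ ^ (1 + ε / 2) * τ ^ (-ε)) := by ring
      _ = 4 * C * r * τ ^ (1 - ε / 2) := by rw [← Real.rpow_add hτ0]; ring_nf
      _ ≤ _ := by gcongr
  have h5 : c / 2 * τ ^ (1 - ε / 2) ≤ ‖zetaOne w‖ := by
    have := norm_sub_norm_le (zetaOne s) (zetaOne w)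
    rw [norm_sub_rev] at this
    linarith
  have h6 : 0 < c / 2 * τ ^ (1 - ε / 2) := by positivity
  refine ⟨norm_pos_iff.1 (h6.trans_le h5), ?_⟩
  rw [norm_div]
  calc _ ≤ 4 * C * τ ^ (1 + ε / 2) / (c / 2 * τ ^ (1 - ε / 2)) := by
        gcongr
        exact hdb w hwr
    _ = 4 * C / (c / 2) * (τ ^ (1 + ε / 2) / τ ^ (1 - ε / 2)) := by field_simp
    _ = _ := by rw [← Real.rpow_sub hτ0]; ring_nf

end LowerBound

section Tent
open Complex Filter Topology MeasureTheory FourierTransform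

lemma integrableOn_pow_mul_exp_neg (k : ℕ) {η : ℝ} (hη : 0 < η) :
    IntegrableOn (fun v : ℝ ↦ v ^ k * Real.exp (-(η * v))) (Set.Ioi 0) := by
  have := integrableOn_rpow_mul_exp_neg_mul_rpow (s := k) (p := 1) (b := η)
    (by have : (0 : ℝ) ≤ k := by positivity
        linarith) one_pos hη
  simpa using this

lemma integrableOn_pow_mul_cexp (k : ℕ) {w : ℂ} (hw : 0 < w.re) :
    IntegrableOn (fun v : ℝ ↦ (v : ℂ) ^ k * cexp (-(w * v))) (Set.Ioi 0) := by
  refine Integrable.mono' (integrableOn_pow_mul_exp_neg k hw)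
    (by fun_prop : Continuous _).aestronglyMeasurable ?_
  filter_upwards [ae_restrict_mem measurableSet_Ioi] with v hv
  rw [norm_mul, norm_pow, norm_exp, norm_real, Real.norm_of_nonneg (le_of_lt hv)]
  simp

lemma integral_pow_mul_cexp (k : ℕ) {w : ℂ} (hw : 0 < w.re) :
    ∫ v in Set.Ioi (0 : ℝ), (v : ℂ) ^ k * cexp (-(w * v)) = k.factorial / w ^ (k + 1) := by
  have hw0 : w ≠ 0 := by rintro rfl; simp at hw
  induction k with
  | zero =>
    have := integral_exp_mul_complex_Ioi (a := -w) (by simpa using hw) 0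
    simpa using this
  | succ k ih =>
    have hder : ∀ v ∈ Set.Ici (0 : ℝ), HasDerivAt (fun v : ℝ ↦ (v : ℂ) ^ (k + 1) * cexp (-(w * v)))
        ((k + 1 : ℂ) * ((v : ℂ) ^ k * cexp (-(w * v))) -
          w * ((v : ℂ) ^ (k + 1) * cexp (-(w * v)))) v := by
      intro v _
      have h1 : HasDerivAt (fun z : ℂ ↦ z ^ (k + 1) * cexp (-(w * z)))
        (((k + 1 : ℕ) : ℂ) * (v : ℂ) ^ k * cexp (-(w * v)) +
          (v : ℂ) ^ (k + 1) * (cexp (-(w * v)) * (-(w * 1)))) (v : ℂ) := by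
        refine HasDerivAt.mul ?_ ?_
        · simpa using hasDerivAt_pow (k + 1) (v : ℂ)
        · exact (((hasDerivAt_id (v : ℂ)).const_mul w).neg).cexp
      convert! h1.comp_ofReal using 1
      push_cast
      ring
    have hintg : IntegrableOn (fun v : ℝ ↦ (k + 1 : ℂ) * ((v : ℂ) ^ k * cexp (-(w * v))) -
          w * ((v : ℂ) ^ (k + 1) * cexp (-(w * v)))) (Set.Ioi 0) :=
      ((integrableOn_pow_mul_cexp k hw).const_mul _).sub
        ((integrableOn_pow_mul_cexp (k + 1) hw).const_mul _)
    have hlim : Tendsto (fun v : ℝ ↦ (v : ℂ) ^ (k + 1) * cexp (-(w * v))) atTop (𝓝 0) := by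
      rw [tendsto_zero_iff_norm_tendsto_zero]
      have := Real.tendsto_pow_mul_exp_neg_atTop_nhds_zero (k + 1)
      have h2 := (this.comp (tendsto_id.const_mul_atTop hw)).const_mul ((1 / w.re) ^ (k + 1))
      simp only [mul_zero] at h2
      refine h2.congr' ?_
      filter_upwards [eventually_gt_atTop 0] with v hv
      rw [norm_mul, norm_pow, norm_exp, norm_real, Real.norm_of_nonneg hv.le]
      simp only [Function.comp, id]
      rw [mul_pow, ← mul_assoc, ← mul_assoc, ← mul_pow, one_div_mul_cancel hw.ne']
      simp
    have key := integral_Ioi_of_hasDerivAt_of_tendsto' hder hintg hlim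
    rw [integral_sub ((integrableOn_pow_mul_cexp k hw).const_mul _)
      ((integrableOn_pow_mul_cexp (k + 1) hw).const_mul _), integral_const_mul,
      integral_const_mul, ih] at key
    simp only [ofReal_zero, ne_eq, Nat.add_eq_zero_iff, one_ne_zero, and_false, not_false_eq_true,
      zero_pow, zero_mul, sub_zero] at key
    have h3 := sub_eq_zero.1 key
    rw [eq_div_iff (pow_ne_zero _ hw0), pow_succ w (k + 1), ← mul_assoc, mul_right_comm,
      mul_comm _ w, ← h3, Nat.factorial_succ]
    push_cast
    field_simp

/-- The tent function `max 0 (1 - |x|)`. -/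
noncomputable def tent (x : ℝ) : ℝ := max 0 (1 - |x|)

lemma continuous_tent : Continuous tent := by unfold tent; fun_prop

lemma tent_nonneg (x : ℝ) : 0 ≤ tent x := le_max_left _ _

lemma tent_le_one (x : ℝ) : tent x ≤ 1 := max_le zero_le_one (by linarith [abs_nonneg x])

lemma tent_of_one_le_abs {x : ℝ} (hx : 1 ≤ |x|) : tent x = 0 := max_eq_left (by linarith)

lemma tent_of_abs_le_one {x : ℝ} (hx : |x| ≤ 1) : tent x = 1 - |x| := max_eq_right (by linarith)

lemma hasCompactSupport_tent : HasCompactSupport tent :=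
  HasCompactSupport.of_support_subset_isCompact (isCompact_Icc (a := -1) (b := 1)) fun x hx ↦ by
    by_contra h
    refine hx (tent_of_one_le_abs ?_)
    by_contra! h'
    exact h (abs_le.1 h'.le)

lemma integrable_tent : Integrable tent :=
  continuous_tent.integrable_of_hasCompactSupport hasCompactSupport_tent

lemma integral_exp_mul_tent {a : ℂ} (ha : a ≠ 0) :
    ∫ x : ℝ, cexp (a * x) * tent x = (cexp a + cexp (-a) - 2) / a ^ 2 := by
  have hcont : Continuous fun x : ℝ ↦ cexp (a * x) * tent x := by
    have := continuous_tent
    fun_prop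
  have h1 : ∫ x : ℝ, cexp (a * x) * tent x = ∫ x in (-1 : ℝ)..1, cexp (a * x) * tent x := by
    rw [intervalIntegral.integral_of_le (by norm_num), setIntegral_eq_integral_of_forall_compl_eq_zero]
    intro x hx
    rw [tent_of_one_le_abs, ofReal_zero, mul_zero]
    by_contra! h'
    exact hx ⟨(abs_lt.1 h').1, (abs_lt.1 h').2.le⟩
  have hd : ∀ (σ : ℂ) (x : ℝ), HasDerivAt (fun x : ℝ ↦ (1 - σ * x) * cexp (a * x) / a +
      σ * cexp (a * x) / a ^ 2) (cexp (a * x) * (1 - σ * x)) x := by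
    intro σ x
    have he : HasDerivAt (fun z : ℂ ↦ cexp (a * z)) (cexp (a * x) * (a * 1)) (x : ℂ) :=
      ((hasDerivAt_id (x : ℂ)).const_mul a).cexp
    have hl : HasDerivAt (fun z : ℂ ↦ 1 - σ * z) (-(σ * 1)) (x : ℂ) :=
      ((hasDerivAt_id (x : ℂ)).const_mul σ).const_sub 1
    have := (((hl.mul he).div_const a).add ((he.const_mul σ).div_const (a ^ 2))).comp_ofReal
    convert! this using 1
    field_simp
    ring
  have h2 : ∫ x in (-1 : ℝ)..0, cexp (a * x) * tent x =
      ∫ x in (-1 : ℝ)..0, cexp (a * x) * (1 - (-1 : ℂ) * x) := by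
    refine intervalIntegral.integral_congr fun x hx ↦ ?_
    rw [Set.uIcc_of_le (by norm_num)] at hx
    have : |x| = -x := abs_of_nonpos hx.2
    rw [tent_of_abs_le_one (by linarith [hx.1]), this]
    push_cast; ring
  have h3 : ∫ x in (0 : ℝ)..1, cexp (a * x) * tent x =
      ∫ x in (0 : ℝ)..1, cexp (a * x) * (1 - (1 : ℂ) * x) := by
    refine intervalIntegral.integral_congr fun x hx ↦ ?_
    rw [Set.uIcc_of_le (by norm_num)] at hx
    have : |x| = x := abs_of_nonneg hx.1
    rw [tent_of_abs_le_one (by linarith [hx.2]), this]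
    push_cast; ring
  rw [h1, ← intervalIntegral.integral_add_adjacent_intervals (b := 0)
    (hcont.intervalIntegrable _ _) (hcont.intervalIntegrable _ _), h2, h3,
    intervalIntegral.integral_eq_sub_of_hasDerivAt (fun x _ ↦ hd (-1) x)
      ((by fun_prop : Continuous _).intervalIntegrable _ _),
    intervalIntegral.integral_eq_sub_of_hasDerivAt (fun x _ ↦ hd 1 x)
      ((by fun_prop : Continuous _).intervalIntegrable _ _)]
  simp
  field_simp
  ring

/-- The Fourier transform of the tent function. -/
noncomputable def tentHat (ξ : ℝ) : ℂ := 𝓕 (fun x ↦ (tent x : ℂ)) ξ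

lemma tentHat_eq (ξ : ℝ) : tentHat ξ = ∫ x : ℝ, cexp (-2 * Real.pi * ξ * I * x) * tent x := by
  rw [tentHat, Real.fourier_eq']
  congr 1 with x
  simp
  left
  congr 1
  ring

lemma continuous_tentHat : Continuous tentHat :=
  VectorFourier.fourierIntegral_continuous Real.continuous_fourierChar (by fun_prop)
    integrable_tent.ofReal

lemma norm_tentHat_le (ξ : ℝ) : ‖tentHat ξ‖ ≤ 4 * (1 + ξ ^ 2)⁻¹ := by
  have h1 : ‖tentHat ξ‖ ≤ 2 := by
    rw [tentHat_eq]
    calc _ ≤ ∫ x : ℝ, ‖cexp (-2 * Real.pi * ξ * I * x) * tent x‖ := norm_integral_le_integral_norm _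
      _ = ∫ x : ℝ, tent x := by
        congr 1 with x
        rw [norm_mul, norm_exp, norm_real, Real.norm_of_nonneg (tent_nonneg x)]
        simp
      _ = ∫ x in (-1 : ℝ)..1, tent x := by
        rw [intervalIntegral.integral_of_le (by norm_num),
          setIntegral_eq_integral_of_forall_compl_eq_zero]
        intro x hx
        refine tent_of_one_le_abs ?_
        by_contra! h'
        exact hx ⟨(abs_lt.1 h').1, (abs_lt.1 h').2.le⟩
      _ ≤ ∫ x in (-1 : ℝ)..1, (1 : ℝ) := intervalIntegral.integral_mono_on (by norm_num)
          (continuous_tent.intervalIntegrable _ _) (by simp) fun x _ ↦ tent_le_one x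
      _ = 2 := by norm_num
  have h2 : ‖tentHat ξ‖ * ξ ^ 2 ≤ 1 := by
    rcases eq_or_ne ξ 0 with rfl | h0
    · simp
    have hpi := Real.pi_gt_three
    have ha : (-2 * Real.pi * ξ * I : ℂ) ≠ 0 := by
      simp [h0, Real.pi_ne_zero]
    rw [tentHat_eq, integral_exp_mul_tent ha, norm_div, norm_pow]
    have e1 : ‖(-2 * Real.pi * ξ * I : ℂ)‖ ^ 2 = 4 * Real.pi ^ 2 * ξ ^ 2 := by
      simp [abs_of_pos Real.pi_pos, mul_pow]; norm_num
    have e2 : ‖cexp (-2 * Real.pi * ξ * I) + cexp (-(-2 * Real.pi * ξ * I)) - 2‖ ≤ 4 := by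
      have r1 : ‖cexp (-2 * Real.pi * ξ * I)‖ = 1 := by rw [norm_exp]; simp
      have r2 : ‖cexp (-(-2 * Real.pi * ξ * I))‖ = 1 := by rw [norm_exp]; simp
      calc _ ≤ ‖cexp (-2 * Real.pi * ξ * I)‖ + ‖cexp (-(-2 * Real.pi * ξ * I))‖ + ‖(2 : ℂ)‖ :=
            (norm_sub_le _ _).trans (by gcongr; exact norm_add_le _ _)
        _ = 4 := by rw [r1, r2]; norm_num
    rw [e1]
    have : 0 < ξ ^ 2 := by positivity
    rw [div_mul_eq_mul_div, div_le_one (by positivity)]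
    have : (1 : ℝ) ≤ Real.pi ^ 2 := by nlinarith
    nlinarith
  rw [← div_eq_mul_inv, le_div_iff₀ (by positivity)]
  linarith

lemma integrable_tentHat : Integrable tentHat :=
  (integrable_inv_one_add_sq.const_mul 4).mono' continuous_tentHat.aestronglyMeasurable
    (.of_forall norm_tentHat_le)

lemma tent_eq_integral (v : ℝ) : (tent v : ℂ) = ∫ ξ : ℝ, tentHat ξ * cexp (2 * Real.pi * v * ξ * I) := by
  have hc : Continuous fun x ↦ (tent x : ℂ) := continuous_ofReal.comp continuous_tent
  have := congrFun (hc.fourierInv_fourier_eq integrable_tent.ofReal integrable_tentHat) v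
  rw [Real.fourierInv_eq'] at this
  rw [← this]
  congr 1 with x
  simp only [smul_eq_mul]
  rw [mul_comm]
  congr 2
  simp
  ring

/-- The weight whose Fourier transform is the tent function of width `h` centred at `c`. -/
noncomputable def tentWeight (c h ξ : ℝ) : ℂ :=
  h * tentHat (h * ξ) * cexp (-(2 * Real.pi * c * ξ * I))

lemma continuous_tentWeight (c h : ℝ) : Continuous (tentWeight c h) := by
  have := continuous_tentHat
  unfold tentWeight
  fun_prop

lemma tent_div_eq_integral (c v : ℝ) {h : ℝ} (hh : 0 < h) :
    (tent ((v - c) / h) : ℂ) = ∫ ξ : ℝ, tentWeight c h ξ * cexp (2 * Real.pi * v * ξ * I) := by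
  rw [tent_eq_integral]
  have := Measure.integral_comp_mul_left
    (fun ξ : ℝ ↦ tentHat ξ * cexp (2 * Real.pi * ((v - c) / h : ℝ) * ξ * I)) h
  rw [abs_of_pos (inv_pos.2 hh), eq_inv_smul_iff₀ hh.ne'] at this
  rw [← this, ← integral_smul]
  congr 1 with ξ
  have hne : (h : ℂ) ≠ 0 := by exact_mod_cast hh.ne'
  have key : (2 * Real.pi * ((v - c) / h : ℝ) * (h * ξ : ℝ) * I : ℂ) =
      -(2 * Real.pi * c * ξ * I) + 2 * Real.pi * v * ξ * I := by
    push_cast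
    field_simp
    ring
  rw [tentWeight, real_smul, key, Complex.exp_add]
  ring

lemma norm_tentWeight_le (c ξ : ℝ) {h : ℝ} (hh : 0 < h) (h1 : h ≤ 1) :
    ‖tentWeight c h ξ‖ ≤ 4 / h * (1 + ξ ^ 2)⁻¹ := by
  have e : ‖cexp (-(2 * Real.pi * c * ξ * I))‖ = 1 := by rw [norm_exp]; simp
  rw [tentWeight, norm_mul, norm_mul, e, mul_one, norm_real, Real.norm_of_nonneg hh.le]
  calc h * ‖tentHat (h * ξ)‖ ≤ h * (4 * (1 + (h * ξ) ^ 2)⁻¹) := by gcongr; exact norm_tentHat_le _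
    _ ≤ 4 / h * (1 + ξ ^ 2)⁻¹ := by
      rw [← div_eq_mul_inv, ← div_eq_mul_inv, div_div, mul_div_assoc', div_le_div_iff₀ (by positivity) (by positivity)]
      have : h ^ 2 ≤ 1 := by nlinarith
      nlinarith [sq_nonneg (h * ξ)]

lemma integrable_tentWeight (c : ℝ) {h : ℝ} (hh : 0 < h) (h1 : h ≤ 1) :
    Integrable (tentWeight c h) :=
  (integrable_inv_one_add_sq.const_mul (4 / h)).mono' (continuous_tentWeight c h).aestronglyMeasurable
    (.of_forall fun ξ ↦ norm_tentWeight_le c ξ hh h1)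

end Tent

section Explicit
open Complex Filter Topology MeasureTheory
open scoped ArithmeticFunction

/-- The function `-ζ'/ζ(s) - 1/(s-1)`. -/
noncomputable def negLogDeriv (s : ℂ) : ℂ := -(deriv zetaOne s / zetaOne s)

lemma differentiableAt_negLogDeriv {s : ℂ} (hs : zetaOne s ≠ 0) :
    DifferentiableAt ℂ negLogDeriv s := by
  unfold negLogDeriv
  have h1 : DifferentiableAt ℂ (deriv zetaOne) s :=
    ((differentiable_zetaOne.analyticAt s).deriv).differentiableAt
  exact (h1.div (differentiable_zetaOne s) hs).neg

lemma exists_norm_iteratedDeriv_negLogDeriv_le (k : ℕ) :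
    ∃ C > 0, ∀ s : ℂ, 1 ≤ s.re → s.re ≤ 2 →
      ‖iteratedDeriv k negLogDeriv s‖ ≤ C * (1 + |s.im|) ^ (1 / 2 : ℝ) := by
  set ε : ℝ := 1 / (2 * (k + 1)) with hε
  have hε0 : 0 < ε := by positivity
  have hε1 : ε ≤ 1 := by
    rw [hε, div_le_one (by positivity)]
    have : (0 : ℝ) ≤ k := by positivity
    linarith
  obtain ⟨r, hr0, hr1, C, hC, h⟩ := exists_zeroFree hε0 hε1
  refine ⟨k.factorial * C / r ^ k, by positivity, fun s hs1 hs2 ↦ ?_⟩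
  set τ := 1 + |s.im| with hτ
  have hτ0 : 0 < τ := by positivity
  have hb : ∀ w ∈ Metric.closedBall s (r * τ ^ (-ε)), ‖w - s‖ ≤ r * τ ^ (-ε) := by
    intro w hw; simpa [dist_eq_norm] using hw
  have hd : DiffContOnCl ℂ negLogDeriv (Metric.ball s (r * τ ^ (-ε))) := by
    refine DifferentiableOn.diffContOnCl_ball (U := Metric.closedBall s (r * τ ^ (-ε)))
      (fun w hw ↦ ?_) le_rfl
    exact (differentiableAt_negLogDeriv (h s w hs1 hs2 (hb w hw)).1).differentiableWithinAt
  refine (norm_iteratedDeriv_le_of_forall_mem_sphere_norm_le (C := C * τ ^ ε) k (by positivity)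
    hd fun w hw ↦ ?_).trans ?_
  · rw [negLogDeriv, norm_neg]
    exact (h s w hs1 hs2 (hb w (Metric.sphere_subset_closedBall hw))).2
  · rw [mul_pow, ← Real.rpow_mul_natCast hτ0.le]
    have e : (1 / 2 : ℝ) = ε - -ε * k := by rw [hε]; field_simp; ring
    rw [e, Real.rpow_sub hτ0]
    apply le_of_eq
    field_simp

lemma logMul_iterate (f : ℕ → ℂ) (k n : ℕ) :
    LSeries.logMul^[k] f n = (Real.log n : ℂ) ^ k * f n := by
  induction k generalizing f with
  | zero => simp
  | succ k ih =>
    rw [Function.iterate_succ_apply, ih, LSeries.logMul, ← natCast_log, pow_succ, mul_assoc]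

lemma abscissa_vonMangoldt_le : LSeries.abscissaOfAbsConv (fun n ↦ (Λ n : ℂ)) ≤ 1 := by
  have := LSeries.abscissaOfAbsConv_le_of_forall_lt_LSeriesSummable (x := 1)
    (f := fun n ↦ (Λ n : ℂ)) fun y hy ↦
      ArithmeticFunction.LSeriesSummable_vonMangoldt (by simpa using hy)
  simpa using this

lemma LSeriesSummable_logMul_vonMangoldt (k : ℕ) {s : ℂ} (hs : 1 < s.re) :
    LSeriesSummable (LSeries.logMul^[k] fun n ↦ (Λ n : ℂ)) s := by
  refine LSeriesSummable_of_abscissaOfAbsConv_lt_re ?_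
  rw [LSeries.absicssaOfAbsConv_logPowMul]
  exact abscissa_vonMangoldt_le.trans_lt (by exact_mod_cast hs)

lemma negLogDeriv_eq {s : ℂ} (hs : 1 < s.re) :
    negLogDeriv s = LSeries (fun n ↦ (Λ n : ℂ)) s - (s - 1)⁻¹ := by
  have hs1 : s ≠ 1 := by rintro rfl; simp at hs
  have h0 := riemannZeta_ne_zero_of_one_le_re hs.le
  have h1 : s - 1 ≠ 0 := sub_ne_zero.2 hs1
  have hd : deriv zetaOne s = riemannZeta s + (s - 1) * deriv riemannZeta s := by
    have : zetaOne =ᶠ[𝓝 s] fun s ↦ (s - 1) * riemannZeta s := by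
      filter_upwards [isOpen_ne.mem_nhds hs1] with u hu using zetaOne_of_ne hu
    rw [this.deriv_eq]
    have h2 := ((hasDerivAt_id s).sub_const 1).mul (differentiableAt_riemannZeta hs1).hasDerivAt
    have h3 := h2.deriv
    simp only [id, one_mul] at h3
    exact h3
  rw [ArithmeticFunction.LSeries_vonMangoldt_eq_deriv_riemannZeta_div hs, negLogDeriv, hd,
    zetaOne_of_ne hs1]
  field_simp
  ring

lemma iteratedDeriv_negLogDeriv_eq (k : ℕ) {s : ℂ} (hs : 1 < s.re) :
    iteratedDeriv k negLogDeriv s = (-1) ^ k *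
      (LSeries (LSeries.logMul^[k] fun n ↦ (Λ n : ℂ)) s - k.factorial / (s - 1) ^ (k + 1)) := by
  have hs1 : s - 1 ≠ 0 := by
    intro h; rw [sub_eq_zero.1 h] at hs; simp at hs
  have hab : LSeries.abscissaOfAbsConv (fun n ↦ (Λ n : ℂ)) < s.re :=
    abscissa_vonMangoldt_le.trans_lt (by exact_mod_cast hs)
  have hev : negLogDeriv =ᶠ[𝓝 s] fun s ↦ LSeries (fun n ↦ (Λ n : ℂ)) s - (s - 1)⁻¹ := by
    filter_upwards [(isOpen_lt continuous_const continuous_re).mem_nhds hs] with u hu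
      using negLogDeriv_eq hu
  have hc1 : ContDiffAt ℂ k (LSeries fun n ↦ (Λ n : ℂ)) s :=
    ((LSeries_analyticOnNhd _) s hab).contDiffAt
  have hc2 : ContDiffAt ℂ k (fun s : ℂ ↦ (s - 1)⁻¹) s :=
    (contDiffAt_id.sub contDiffAt_const).inv hs1
  rw [hev.iteratedDeriv_eq, iteratedDeriv_fun_sub hc1 hc2, LSeries_iteratedDeriv k hab,
    congrFun (iteratedDeriv_comp_sub_const k (fun z : ℂ ↦ z⁻¹) 1) s, mul_sub]
  congr 1
  have := iter_deriv_inv k (s - 1)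
  rw [← iteratedDeriv_eq_iterate] at this
  change iteratedDeriv k Inv.inv (s - 1) = _
  rw [this, mul_assoc, div_eq_mul_inv, ← zpow_natCast (s - 1), ← zpow_neg]
  congr 3
  push_cast
  ring

/-- The smoothed explicit formula on the line `re s = 1 + η`. -/
lemma exists_norm_smoothed_sub_le (k : ℕ) : ∃ C > 0, ∀ c h η : ℝ, 0 < h → h ≤ 1 → 0 < η → η ≤ 1 →
    ‖∑' n : ℕ, ((Λ n * Real.log n ^ k * (n : ℝ) ^ (-(1 + η)) * tent ((Real.log n - c) / h) : ℝ) : ℂ) -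
      ∫ v in Set.Ioi (0 : ℝ), ((v ^ k * Real.exp (-(η * v)) * tent ((v - c) / h) : ℝ) : ℂ)‖
      ≤ C / h := by
  obtain ⟨C, hC, hD⟩ := exists_norm_iteratedDeriv_negLogDeriv_le k
  have hI : Integrable fun ξ : ℝ ↦ (1 + 2 * Real.pi * |ξ|) ^ (1 / 2 : ℝ) * (1 + ξ ^ 2)⁻¹ := by
    have h1 : Integrable fun ξ : ℝ ↦ 7 * 2 * (1 + ‖ξ‖) ^ (-(3 / 2) : ℝ) :=
      (integrable_one_add_norm (by simp; norm_num)).const_mul _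
    refine h1.mono' ?_ (.of_forall fun ξ ↦ ?_)
    · refine (Continuous.mul (Continuous.rpow_const (by fun_prop) fun x ↦ Or.inr (by norm_num))
        (Continuous.inv₀ (by fun_prop) fun x ↦ by positivity)).aestronglyMeasurable
    · have hpi := Real.pi_lt_d2
      have hpi0 := Real.pi_pos
      have hx := abs_nonneg ξ
      rw [Real.norm_of_nonneg (by positivity), Real.norm_eq_abs]
      have e1 : (1 + 2 * Real.pi * |ξ|) ^ (1 / 2 : ℝ) ≤ 7 * (1 + |ξ|) ^ (1 / 2 : ℝ) := by
        calc _ ≤ (7 * (1 + |ξ|)) ^ (1 / 2 : ℝ) := by gcongr; nlinarith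
          _ = 7 ^ (1 / 2 : ℝ) * (1 + |ξ|) ^ (1 / 2 : ℝ) := Real.mul_rpow (by norm_num) (by positivity)
          _ ≤ 7 ^ (1 : ℝ) * (1 + |ξ|) ^ (1 / 2 : ℝ) := by gcongr <;> norm_num
          _ = _ := by norm_num
      have e2 : (1 + ξ ^ 2)⁻¹ ≤ 2 * ((1 + |ξ|) ^ 2)⁻¹ := by
        rw [← div_eq_mul_inv, inv_eq_one_div, div_le_div_iff₀ (by positivity) (by positivity)]
        nlinarith [sq_nonneg (1 - |ξ|), sq_abs ξ]
      have e3 : (1 + |ξ|) ^ (-(3 / 2) : ℝ) = (1 + |ξ|) ^ (1 / 2 : ℝ) * ((1 + |ξ|) ^ 2)⁻¹ := by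
        rw [← Real.rpow_natCast, ← Real.rpow_neg (by positivity), ← Real.rpow_add (by positivity)]
        norm_num
      rw [e3]
      calc _ ≤ (7 * (1 + |ξ|) ^ (1 / 2 : ℝ)) * (2 * ((1 + |ξ|) ^ 2)⁻¹) := by gcongr
        _ = _ := by ring
  set J := ∫ ξ : ℝ, (1 + 2 * Real.pi * |ξ|) ^ (1 / 2 : ℝ) * (1 + ξ ^ 2)⁻¹ with hJ
  have hJ0 : 0 ≤ J := integral_nonneg fun ξ ↦ by positivity
  refine ⟨C * 4 * (J + 1), by positivity, fun c h η hh h1 hη hη1 ↦ ?_⟩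
  set W := tentWeight c h with hW
  have hWi : Integrable W := integrable_tentWeight c hh h1
  have hWc : Continuous W := continuous_tentWeight c h
  set s : ℝ → ℂ := fun ξ ↦ 1 + η - 2 * Real.pi * ξ * I with hs
  have hsre : ∀ ξ, (s ξ).re = 1 + η := by intro ξ; simp [hs]
  have hsim : ∀ ξ, |(s ξ).im| = 2 * Real.pi * |ξ| := by
    intro ξ; simp [hs, abs_mul, abs_of_pos Real.pi_pos]
  set f : ℕ → ℂ := LSeries.logMul^[k] fun n ↦ (Λ n : ℂ) with hf
  -- the arithmetic side
  have hA : ∑' n : ℕ, ((Λ n * Real.log n ^ k * (n : ℝ) ^ (-(1 + η)) *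
      tent ((Real.log n - c) / h) : ℝ) : ℂ) = ∫ ξ : ℝ, W ξ * LSeries f (s ξ) := by
    have hterm : ∀ (n : ℕ) (ξ : ℝ), LSeries.term f (s ξ) n =
        ((Λ n * Real.log n ^ k * (n : ℝ) ^ (-(1 + η)) : ℝ) : ℂ) *
          cexp (2 * Real.pi * Real.log n * ξ * I) := by
      intro n ξ
      rcases eq_or_ne n 0 with rfl | hn
      · simp
      have hn0 : (n : ℂ) ≠ 0 := by exact_mod_cast hn
      have hnp : (0 : ℝ) < n := by positivity
      rw [LSeries.term_of_ne_zero hn, hf, logMul_iterate, div_eq_mul_inv, ← cpow_neg, hs]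
      have : ((n : ℂ)) ^ (-(1 + η - 2 * Real.pi * ξ * I : ℂ)) =
          ((n : ℝ) ^ (-(1 + η)) : ℝ) * cexp (2 * Real.pi * Real.log n * ξ * I) := by
        rw [cpow_def_of_ne_zero hn0, ← natCast_log, Real.rpow_def_of_pos hnp, ofReal_exp,
          ← Complex.exp_add]
        congr 1
        push_cast
        ring
      rw [this]
      push_cast
      ring
    have hnorm : ∀ (n : ℕ) (ξ : ℝ), ‖W ξ * LSeries.term f (s ξ) n‖ =
        ‖W ξ‖ * ‖LSeries.term f (1 + η : ℝ) n‖ := by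
      intro n ξ
      rw [norm_mul, LSeries.norm_term_eq, LSeries.norm_term_eq, hsre]
      simp
    have hsum : Summable fun n : ℕ ↦ ∫ ξ : ℝ, ‖W ξ * LSeries.term f (s ξ) n‖ := by
      simp_rw [hnorm, integral_mul_const]
      exact ((LSeriesSummable_logMul_vonMangoldt k (s := (1 + η : ℝ))
        (by simpa using hη)).norm).mul_left _
    have hintg : ∀ n : ℕ, Integrable fun ξ : ℝ ↦ W ξ * LSeries.term f (s ξ) n := by
      intro n
      refine (hWi.norm.mul_const ‖LSeries.term f (1 + η : ℝ) n‖).mono' ?_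
        (.of_forall fun ξ ↦ (hnorm n ξ).le)
      simp_rw [hterm]
      exact (by fun_prop : Continuous _).aestronglyMeasurable
    have := (hasSum_integral_of_summable_integral_norm hintg hsum).tsum_eq
    simp_rw [tsum_mul_left] at this
    change _ = ∫ ξ : ℝ, W ξ * ∑' n, LSeries.term f (s ξ) n
    rw [← this]
    congr 1 with n
    simp_rw [hterm]
    rw [ofReal_mul, tent_div_eq_integral c _ hh, ← integral_const_mul]
    congr 1 with ξ
    ring
  -- the continuous side
  have hB : ∫ v in Set.Ioi (0 : ℝ), ((v ^ k * Real.exp (-(η * v)) * tent ((v - c) / h) : ℝ) : ℂ) =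
      ∫ ξ : ℝ, W ξ * (k.factorial / (s ξ - 1) ^ (k + 1)) := by
    have hR : ∀ ξ, W ξ * (k.factorial / (s ξ - 1) ^ (k + 1)) =
        ∫ v in Set.Ioi (0 : ℝ), W ξ * ((v : ℂ) ^ k * cexp (-((s ξ - 1) * v))) := by
      intro ξ
      rw [integral_const_mul, integral_pow_mul_cexp k (by simp [hsre, hη])]
    simp_rw [hR]
    rw [integral_integral_swap]
    · refine integral_congr_ae (.of_forall fun v ↦ ?_)
      simp only
      rw [ofReal_mul, tent_div_eq_integral c _ hh, ← integral_const_mul]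
      congr 1 with ξ
      have : cexp (-((s ξ - 1) * v)) = Real.exp (-(η * v)) * cexp (2 * Real.pi * v * ξ * I) := by
        rw [ofReal_exp, ← Complex.exp_add, hs]
        congr 1
        push_cast
        ring
      rw [this]
      push_cast
      ring
    · have h2 : Integrable (fun z : ℝ × ℝ ↦ ‖W z.1‖ * (z.2 ^ k * Real.exp (-(η * z.2))))
          (volume.prod (volume.restrict (Set.Ioi 0))) :=
        hWi.norm.mul_prod (integrableOn_pow_mul_exp_neg k hη)
      refine h2.mono' ?_ ?_
      · have : Continuous s := by rw [hs]; fun_prop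
        simp only [Function.uncurry_def]
        exact (by fun_prop : Continuous _).aestronglyMeasurable
      · have : ∀ᵐ z : ℝ × ℝ ∂(volume.prod (volume.restrict (Set.Ioi (0 : ℝ)))), 0 < z.2 := by
          have h3 := (Measure.quasiMeasurePreserving_snd (μ := (volume : Measure ℝ))
            (ν := volume.restrict (Set.Ioi (0 : ℝ)))).ae (ae_restrict_mem measurableSet_Ioi)
          exact h3
        filter_upwards [this] with z hz
        simp only [Function.uncurry_def]
        rw [norm_mul, norm_mul, norm_pow, norm_exp, norm_real, Real.norm_of_nonneg hz.le]
        simp [hsre]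
  rw [hA, hB, ← integral_sub]
  · calc _ ≤ ∫ ξ : ℝ, C * (4 / h) * ((1 + 2 * Real.pi * |ξ|) ^ (1 / 2 : ℝ) * (1 + ξ ^ 2)⁻¹) := by
          refine norm_integral_le_of_norm_le (hI.const_mul _) (.of_forall fun ξ ↦ ?_)
          have h3 := iteratedDeriv_negLogDeriv_eq k (s := s ξ) (by rw [hsre]; linarith)
          have h4 := hD (s ξ) (by rw [hsre]; linarith) (by rw [hsre]; linarith)
          rw [h3, norm_mul, norm_pow, norm_neg, norm_one, one_pow, one_mul, hsim] at h4
          rw [← mul_sub, norm_mul]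
          calc _ ≤ (4 / h * (1 + ξ ^ 2)⁻¹) * (C * (1 + 2 * Real.pi * |ξ|) ^ (1 / 2 : ℝ)) := by
                gcongr
                exact norm_tentWeight_le c ξ hh h1
            _ = _ := by ring
      _ = C * 4 * J / h := by rw [integral_const_mul]; ring
      _ ≤ _ := by gcongr; linarith
  · have hcont : Continuous fun ξ ↦ LSeries f (s ξ) := by
      have hsc : Continuous s := by rw [hs]; fun_prop
      refine continuous_iff_continuousAt.2 fun ξ ↦ ?_
      have hab : LSeries.abscissaOfAbsConv f < (s ξ).re := by
        rw [hf, LSeries.absicssaOfAbsConv_logPowMul, hsre]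
        refine abscissa_vonMangoldt_le.trans_lt ?_
        have : (1 : ℝ) < 1 + η := by linarith
        exact_mod_cast this
      exact (((LSeries_analyticOnNhd f) _ hab).continuousAt).comp hsc.continuousAt
    refine (hWi.norm.mul_const (∑' n, ‖LSeries.term f (1 + η : ℝ) n‖)).mono'
      (hWc.mul hcont).aestronglyMeasurable (.of_forall fun ξ ↦ ?_)
    rw [norm_mul]
    gcongr
    have hn : ∀ n, ‖LSeries.term f (s ξ) n‖ = ‖LSeries.term f (1 + η : ℝ) n‖ := by
      intro n
      rw [LSeries.norm_term_eq, LSeries.norm_term_eq, hsre]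
      simp
    have hsm := (LSeriesSummable_logMul_vonMangoldt k (s := (1 + η : ℝ)) (by simpa using hη)).norm
    calc _ ≤ ∑' n, ‖LSeries.term f (s ξ) n‖ := norm_tsum_le_tsum_norm (by simp_rw [hn]; exact hsm)
      _ = _ := by simp_rw [hn]
  · have hne : ∀ ξ, η ≤ ‖s ξ - 1‖ := by
      intro ξ
      have := abs_re_le_norm (s ξ - 1)
      rw [sub_re, hsre, one_re, add_sub_cancel_left, abs_of_pos hη] at this
      exact this
    have hsc : Continuous s := by rw [hs]; fun_prop
    refine (hWi.norm.mul_const (k.factorial / η ^ (k + 1))).mono'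
      (hWc.mul (Continuous.div (by fun_prop) (by fun_prop) fun ξ ↦ ?_)).aestronglyMeasurable
      (.of_forall fun ξ ↦ ?_)
    · exact pow_ne_zero _ (norm_pos_iff.1 (hη.trans_le (hne ξ)))
    · rw [norm_mul, norm_div, norm_pow]
      simp only [RCLike.norm_natCast]
      gcongr
      exact hne ξ

end Explicit

section Chebyshev
open Complex Filter Topology MeasureTheory
open scoped ArithmeticFunction

lemma exists_abs_smoothed_sub_le (k : ℕ) : ∃ C > 0, ∀ (c h U : ℝ) (N : ℕ), 0 < h → h ≤ 1 → h ≤ c →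
    c + h ≤ U → Real.exp U ≤ N →
    |∑ n ∈ Finset.range N, Λ n * Real.log n ^ k / n * tent ((Real.log n - c) / h) -
      ∫ v in (0 : ℝ)..U, v ^ k * tent ((v - c) / h)| ≤ C / h := by
  obtain ⟨C, hC, hmain⟩ := exists_norm_smoothed_sub_le k
  refine ⟨C, hC, fun c h U N hh h1 hc hU hN ↦ ?_⟩
  have htz : ∀ v, U ≤ v → tent ((v - c) / h) = 0 := by
    intro v hv
    refine tent_of_one_le_abs ((le_abs_self _).trans' ?_)
    rw [le_div_iff₀ hh]; linarith
  set Φ : ℝ → ℝ := fun η ↦ ∑ n ∈ Finset.range N, Λ n * Real.log n ^ k * (n : ℝ) ^ (-(1 + η)) *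
    tent ((Real.log n - c) / h) - ∫ v in (0 : ℝ)..U, v ^ k * Real.exp (-(η * v)) * tent ((v - c) / h)
    with hΦ
  have h0 : Φ 0 = ∑ n ∈ Finset.range N, Λ n * Real.log n ^ k / n * tent ((Real.log n - c) / h) -
      ∫ v in (0 : ℝ)..U, v ^ k * tent ((v - c) / h) := by
    simp [hΦ, Real.rpow_neg_one, div_eq_mul_inv]
  have hcont : Continuous Φ := by
    refine Continuous.sub ?_ ?_
    · refine continuous_finsetSum _ fun n _ ↦ ?_
      rcases eq_or_ne n 0 with rfl | hn
      · simp [continuous_const]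
      have : (n : ℝ) ≠ 0 := by exact_mod_cast hn
      refine ((continuous_const.mul ?_).mul continuous_const)
      exact Continuous.rpow continuous_const (by fun_prop) fun x ↦ Or.inl this
    · refine intervalIntegral.continuous_parametric_intervalIntegral_of_continuous' ?_ _ _
      have := continuous_tent
      fun_prop
  rw [← h0]
  have hlim : Tendsto (fun η ↦ |Φ η|) (𝓝[>] 0) (𝓝 |Φ 0|) :=
    (hcont.abs.tendsto 0).mono_left nhdsWithin_le_nhds
  refine le_of_tendsto hlim ?_
  filter_upwards [Ioc_mem_nhdsGT (zero_lt_one' ℝ)] with η hη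
  have := hmain c h η hh h1 hη.1 hη.2
  refine le_of_eq_of_le ?_ this
  rw [tsum_eq_sum (s := Finset.range N), integral_complex_ofReal, ← ofReal_sum, ← ofReal_sub, norm_real,
    Real.norm_eq_abs, hΦ]
  · have hU0 : 0 ≤ U := by linarith
    have : ∫ v in (0 : ℝ)..U, v ^ k * Real.exp (-(η * v)) * tent ((v - c) / h) =
        ∫ v in Set.Ioi (0 : ℝ), v ^ k * Real.exp (-(η * v)) * tent ((v - c) / h) := by
      rw [intervalIntegral.integral_of_le hU0]
      refine (setIntegral_eq_of_subset_of_forall_sdiff_eq_zero measurableSet_Ioi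
        Set.Ioc_subset_Ioi_self fun v hv ↦ ?_).symm
      rw [htz, mul_zero]
      by_contra! h'
      exact hv.2 ⟨hv.1, h'.le⟩
    simp only
    rw [this]
  · intro n hn
    rw [Finset.mem_range, not_lt] at hn
    rw [htz, mul_zero, ofReal_zero]
    rw [Real.le_log_iff_exp_le]
    · exact hN.trans (by exact_mod_cast hn)
    · exact (Real.exp_pos U).trans_le (hN.trans (by exact_mod_cast hn))

lemma sum_tent_eq (N : ℕ) (y : ℝ) : ∑ j ∈ Finset.range N, tent (y - (j + 1)) =
    max 0 (min 1 y) - max 0 (min 1 (y - N)) := by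
  have key : ∀ x : ℝ, tent (x - 1) = max 0 (min 1 x) - max 0 (min 1 (x - 1)) := by
    intro x
    unfold tent
    rcases le_total x 0 with h | h
    · rw [abs_of_nonpos (by linarith), max_eq_left, max_eq_left, max_eq_left] <;> simp <;>
        first | linarith | (right; linarith)
    rcases le_total x 1 with h1 | h1
    · rw [abs_of_nonpos (by linarith), min_eq_right h1, max_eq_right h, min_eq_right (by linarith),
        max_eq_left (by linarith : x - 1 ≤ 0), max_eq_right (by linarith)]
      ring
    rw [abs_of_nonneg (by linarith), min_eq_left h1, max_eq_right zero_le_one]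
    rcases le_total x 2 with h2 | h2
    · rw [min_eq_right (by linarith), max_eq_right (by linarith : 0 ≤ x - 1),
        max_eq_right (by linarith)]
    · rw [min_eq_left (by linarith), max_eq_right zero_le_one, max_eq_left (by linarith)]
      ring
  induction N with
  | zero => simp
  | succ N ih =>
    rw [Finset.sum_range_succ, ih]
    have := key (y - N)
    have e : y - (N + 1) = y - N - 1 := by ring
    push_cast
    rw [e, this]
    ring

lemma sum_tent_nonneg (N : ℕ) (y : ℝ) : 0 ≤ ∑ j ∈ Finset.range N, tent (y - (j + 1)) :=
  Finset.sum_nonneg fun _ _ ↦ tent_nonneg _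

lemma sum_tent_le_one (N : ℕ) (y : ℝ) : ∑ j ∈ Finset.range N, tent (y - (j + 1)) ≤ 1 := by
  rw [sum_tent_eq]
  have : max 0 (min 1 y) ≤ 1 := max_le zero_le_one (min_le_left _ _)
  linarith [le_max_left 0 (min 1 (y - N))]

lemma sum_tent_eq_one {N : ℕ} {y : ℝ} (h1 : 1 ≤ y) (h2 : y ≤ N) :
    ∑ j ∈ Finset.range N, tent (y - (j + 1)) = 1 := by
  rw [sum_tent_eq, min_eq_left h1, max_eq_right zero_le_one, max_eq_left, sub_zero]
  exact (min_le_right _ _).trans (by linarith)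

lemma sum_tent_eq_zero {N : ℕ} {y : ℝ} (h : N + 1 ≤ y) :
    ∑ j ∈ Finset.range N, tent (y - (j + 1)) = 0 := by
  have hN : (0 : ℝ) ≤ N := by positivity
  rw [sum_tent_eq, min_eq_left (by linarith), min_eq_left (by linarith), sub_self]

/-- The sum of `a n` over `1 ≤ n ≤ exp u`. -/
noncomputable def logSum (a : ℕ → ℝ) (u : ℝ) : ℝ := ∑ n ∈ Finset.Icc 1 ⌊Real.exp u⌋₊, a n

lemma mem_Icc_floor_exp {n : ℕ} {u : ℝ} :
    n ∈ Finset.Icc 1 ⌊Real.exp u⌋₊ ↔ 1 ≤ n ∧ Real.log n ≤ u := by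
  rw [Finset.mem_Icc]
  refine and_congr_right fun h ↦ ?_
  have : (0 : ℝ) < n := by exact_mod_cast h
  rw [Nat.le_floor_iff (Real.exp_pos u).le, Real.log_le_iff_le_exp this]

lemma exists_abs_sum_tent_sub_le (k : ℕ) : ∃ C > 0, ∀ (h U : ℝ) (N M : ℕ), 0 < h → h ≤ 1 →
    h * (N + 1) ≤ U → Real.exp U ≤ M →
    |∑ n ∈ Finset.range M, Λ n * Real.log n ^ k / n *
        ∑ j ∈ Finset.range N, tent (Real.log n / h - (j + 1)) -
      ∫ v in (0 : ℝ)..U, v ^ k * ∑ j ∈ Finset.range N, tent (v / h - (j + 1))| ≤ N * (C / h) := by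
  obtain ⟨C, hC, hmain⟩ := exists_abs_smoothed_sub_le k
  refine ⟨C, hC, fun h U N M hh h1 hU hM ↦ ?_⟩
  have hct := continuous_tent
  simp_rw [Finset.mul_sum]
  rw [Finset.sum_comm, intervalIntegral.integral_finsetSum, ← Finset.sum_sub_distrib]
  · calc _ ≤ ∑ j ∈ Finset.range N, C / h := by
          refine (Finset.abs_sum_le_sum_abs _ _).trans (Finset.sum_le_sum fun j hj ↦ ?_)
          have hj' : (j : ℝ) + 1 ≤ N := by exact_mod_cast Finset.mem_range.1 hj
          have hj0 : (0 : ℝ) ≤ j := by positivity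
          have := hmain (h * (j + 1)) h U M hh h1 (by nlinarith) (by nlinarith) hM
          have e : ∀ v : ℝ, (v - h * (j + 1)) / h = v / h - (j + 1) := by
            intro v; field_simp
          simp_rw [e] at this
          exact this
      _ = _ := by simp
  · intro j _
    exact (by fun_prop : Continuous _).intervalIntegrable _ _

lemma pow_add_sub_le {u h : ℝ} (hu : 1 ≤ u) (hh : 0 ≤ h) (h1 : h * u ^ 2 ≤ 1) :
    (u + h) ^ 8 ≤ u ^ 8 + 255 * u ^ 5 := by
  have hu2 : 1 ≤ u ^ 2 := one_le_pow₀ hu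
  have hx : h ≤ 1 := by nlinarith [mul_le_mul_of_nonneg_left hu2 hh]
  have hhu : h ≤ u := by linarith
  have key : (u + h) ^ 8 - u ^ 8 ≤ 255 * (h * u ^ 7) := by
    have e : (u + h) ^ 8 - u ^ 8 = h * (8 * u ^ 7 + 28 * u ^ 6 * h + 56 * u ^ 5 * h ^ 2 +
      70 * u ^ 4 * h ^ 3 + 56 * u ^ 3 * h ^ 4 + 28 * u ^ 2 * h ^ 5 + 8 * u * h ^ 6 + h ^ 7) := by ring
    have : 8 * u ^ 7 + 28 * u ^ 6 * h + 56 * u ^ 5 * h ^ 2 +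
      70 * u ^ 4 * h ^ 3 + 56 * u ^ 3 * h ^ 4 + 28 * u ^ 2 * h ^ 5 + 8 * u * h ^ 6 + h ^ 7 ≤
      8 * u ^ 7 + 28 * u ^ 6 * u + 56 * u ^ 5 * u ^ 2 +
      70 * u ^ 4 * u ^ 3 + 56 * u ^ 3 * u ^ 4 + 28 * u ^ 2 * u ^ 5 + 8 * u * u ^ 6 + u ^ 7 := by
      gcongr
    rw [e]
    nlinarith
  have : h * u ^ 7 = (h * u ^ 2) * u ^ 5 := by ring
  have h5 : 0 ≤ u ^ 5 := by positivity
  nlinarith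

lemma le_pow_sub {u h : ℝ} (hu : 1 ≤ u) (hh : 0 ≤ h) (h1 : h * u ^ 2 ≤ 1) :
    u ^ 8 - 8 * u ^ 5 ≤ (u - h) ^ 8 := by
  have hu2 : 1 ≤ u ^ 2 := one_le_pow₀ hu
  have hx : h ≤ 1 := by nlinarith [mul_le_mul_of_nonneg_left hu2 hh]
  have hb := one_add_mul_le_pow (a := -(h / u)) (by
    have : h / u ≤ 1 := by rw [div_le_one (by linarith)]; linarith
    linarith) 8
  have e : (u - h) ^ 8 = u ^ 8 * (1 + -(h / u)) ^ 8 := by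
    rw [← mul_pow]; congr 1; field_simp; ring
  rw [e]
  have e2 : u ^ 8 * (1 + (8 : ℕ) * -(h / u)) = u ^ 8 - 8 * ((h * u ^ 2) * u ^ 5) := by
    field_simp
    push_cast
    ring
  have h8 : 0 ≤ u ^ 8 := by positivity
  have h5 : 0 ≤ u ^ 5 := by positivity
  nlinarith

/-- A weighted prime number theorem with a logarithmic saving. -/
lemma exists_abs_logSum_sub_le : ∃ C > 0, ∀ u : ℝ, 2 ≤ u →
    |logSum (fun n ↦ Λ n * Real.log n ^ 7 / n) u - u ^ 8 / 8| ≤ C * u ^ 5 := by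
  obtain ⟨C, hC, hmain⟩ := exists_abs_sum_tent_sub_le 7
  refine ⟨32 + 4 * C, by positivity, fun u hu ↦ ?_⟩
  have hct := continuous_tent
  have hu0 : 0 < u := by linarith
  set N := ⌈u ^ 3⌉₊ with hN
  have hN1 : u ^ 3 ≤ N := Nat.le_ceil _
  have hN2 : (N : ℝ) ≤ 2 * u ^ 3 := by
    have := (Nat.ceil_lt_add_one (a := u ^ 3) (by positivity)).le
    have h8 : 1 ≤ u ^ 3 := one_le_pow₀ (by linarith)
    linarith
  have hN0 : (0 : ℝ) < N := (by positivity : 0 < u ^ 3).trans_le hN1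
  have hNne : N ≠ 0 := by rintro h; simp [h] at hN0
  set h := u / N with hh
  have hh0 : 0 < h := by positivity
  have hhN : h * N = u := by rw [hh]; field_simp
  have hhu : h * u ^ 2 ≤ 1 := by
    rw [hh, div_mul_eq_mul_div, div_le_one hN0]
    calc u * u ^ 2 = u ^ 3 := by ring
      _ ≤ _ := hN1
  have hh4 : h ≤ 1 / 4 := by nlinarith
  set M := ⌈Real.exp (u + h)⌉₊ with hM
  have hM1 : Real.exp (u + h) ≤ M := Nat.le_ceil _
  set b : ℕ → ℝ := fun n ↦ Λ n * Real.log n ^ 7 / n with hb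
  have hb0 : ∀ n, 0 ≤ b n := fun n ↦ by
    have := ArithmeticFunction.vonMangoldt_nonneg (n := n)
    have := Real.log_natCast_nonneg n
    positivity
  have herr : N * (C / h) ≤ 4 * C * u ^ 5 := by
    have : N * (C / h) = C * N ^ 2 / u := by rw [hh]; field_simp
    rw [this, div_le_iff₀ hu0]
    calc C * (N : ℝ) ^ 2 ≤ C * (2 * u ^ 3) ^ 2 := by gcongr
      _ = _ := by ring
  have hIcc : ∀ n ∈ Finset.Icc 1 ⌊Real.exp u⌋₊, n ∈ Finset.range M := by
    intro n hn
    rw [Finset.mem_range, hM, Nat.lt_ceil]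
    have h1 := (Nat.le_floor_iff (Real.exp_pos u).le).1 (Finset.mem_Icc.1 hn).2
    exact h1.trans_lt (Real.exp_lt_exp.2 (by linarith))
  have hintg : ∀ (f : ℝ → ℝ), Continuous f → ∀ a b, IntervalIntegrable f volume a b :=
    fun f hf a b ↦ hf.intervalIntegrable _ _
  have hpI : ∀ a b : ℝ, ∫ v in a..b, v ^ 7 = (b ^ 8 - a ^ 8) / 8 := by
    intro a b; rw [integral_pow]; norm_num
  have hupper : logSum b u ≤ u ^ 8 / 8 + (32 + 4 * C) * u ^ 5 := by
    have hm := (abs_le.1 (hmain h (u + h) N M hh0 (by linarith) (by linarith) hM1)).2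
    have h1 : logSum b u ≤ ∑ n ∈ Finset.range M, b n *
        ∑ j ∈ Finset.range N, tent (Real.log n / h - (j + 1)) := by
      refine (Finset.sum_le_sum fun n hn ↦ ?_).trans (Finset.sum_le_sum_of_subset_of_nonneg hIcc
        fun n _ _ ↦ mul_nonneg (hb0 n) (sum_tent_nonneg _ _))
      rw [mem_Icc_floor_exp] at hn
      rcases eq_or_lt_of_le hn.1 with h1 | h1
      · simp [hb, ← h1]
      · rw [sum_tent_eq_one, mul_one]
        · rw [le_div_iff₀ hh0]
          have : Real.log 2 ≤ Real.log n := Real.log_le_log (by norm_num) (by exact_mod_cast h1)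
          linarith [Real.log_two_gt_d9]
        · rw [div_le_iff₀ hh0]; linarith [hn.2]
    have h2 : ∫ v in (0 : ℝ)..(u + h), v ^ 7 * ∑ j ∈ Finset.range N, tent (v / h - (j + 1)) ≤
        ∫ v in (0 : ℝ)..(u + h), v ^ 7 := by
      refine intervalIntegral.integral_mono_on (by linarith) (hintg _ (by fun_prop) _ _)
        (hintg _ (by fun_prop) _ _) fun v hv ↦ ?_
      have : 0 ≤ v ^ 7 := pow_nonneg hv.1 _
      exact mul_le_of_le_one_right this (sum_tent_le_one _ _)
    rw [hpI] at h2
    have h3 := pow_add_sub_le (by linarith : 1 ≤ u) hh0.le hhu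
    have h5 : 0 ≤ u ^ 5 := by positivity
    linarith
  have hlower : u ^ 8 / 8 - (32 + 4 * C) * u ^ 5 ≤ logSum b u := by
    obtain ⟨N', hN'⟩ := Nat.exists_eq_succ_of_ne_zero hNne
    have hN'c : (N : ℝ) = N' + 1 := by rw [hN']; push_cast; ring
    have hm := (abs_le.1 (hmain h (u + h) N' M hh0 (by linarith)
      (by rw [← hN'c]; linarith) hM1)).1
    have herr' : N' * (C / h) ≤ 4 * C * u ^ 5 := by
      refine le_trans ?_ herr
      gcongr
      linarith
    have h1 : ∑ n ∈ Finset.range M, b n *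
        ∑ j ∈ Finset.range N', tent (Real.log n / h - (j + 1)) ≤ logSum b u := by
      rw [logSum, ← Finset.sum_subset hIcc]
      · refine Finset.sum_le_sum fun n _ ↦ ?_
        exact mul_le_of_le_one_right (hb0 n) (sum_tent_le_one _ _)
      · intro n _ hn
        rw [mem_Icc_floor_exp, not_and, not_le] at hn
        rcases Nat.eq_zero_or_pos n with rfl | hn0
        · simp [hb]
        · rw [sum_tent_eq_zero, mul_zero]
          rw [← hN'c, le_div_iff₀ hh0]
          linarith [hn hn0]
    have h2 : ∫ v in h..(u - h), v ^ 7 ≤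
        ∫ v in (0 : ℝ)..(u + h), v ^ 7 * ∑ j ∈ Finset.range N', tent (v / h - (j + 1)) := by
      have h3 : ∫ v in h..(u - h), v ^ 7 =
          ∫ v in h..(u - h), v ^ 7 * ∑ j ∈ Finset.range N', tent (v / h - (j + 1)) := by
        refine intervalIntegral.integral_congr fun v hv ↦ ?_
        rw [Set.uIcc_of_le (by linarith)] at hv
        rw [sum_tent_eq_one, mul_one]
        · rw [le_div_iff₀ hh0]; linarith [hv.1]
        · rw [div_le_iff₀ hh0]; nlinarith [hv.2]
      rw [h3]
      refine intervalIntegral.integral_mono_interval hh0.le (by linarith) (by linarith) ?_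
        (hintg _ (by fun_prop) _ _)
      filter_upwards [ae_restrict_mem measurableSet_Ioc] with v hv
      exact mul_nonneg (pow_nonneg hv.1.le _) (sum_tent_nonneg _ _)
    rw [hpI] at h2
    have h3 := le_pow_sub (by linarith : 1 ≤ u) hh0.le hhu
    have h5 : 1 ≤ u ^ 5 := one_le_pow₀ (by linarith)
    have h8 : h ^ 8 ≤ 1 := pow_le_one₀ hh0.le (by linarith)
    linarith
  rw [abs_le]
  constructor <;> linarith

end Chebyshev

section Mertens
open Filter Topology MeasureTheory
open scoped ArithmeticFunction

lemma logSum_eq_sum_ite (a : ℕ → ℝ) {v u : ℝ} (hvu : v ≤ u) :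
    logSum a v = ∑ n ∈ Finset.Icc 1 ⌊Real.exp u⌋₊, if Real.log n ≤ v then a n else 0 := by
  rw [logSum, ← Finset.sum_filter]
  refine Finset.sum_congr ?_ fun _ _ ↦ rfl
  ext n
  rw [Finset.mem_filter, mem_Icc_floor_exp, mem_Icc_floor_exp]
  constructor
  · exact fun h ↦ ⟨⟨h.1, h.2.trans hvu⟩, h.2⟩
  · exact fun h ↦ ⟨h.1.1, h.2⟩

lemma logSum_mono {a : ℕ → ℝ} (ha : ∀ n, 0 ≤ a n) : Monotone (logSum a) := by
  intro v u h
  refine Finset.sum_le_sum_of_subset_of_nonneg (fun n hn ↦ ?_) fun n _ _ ↦ ha n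
  rw [mem_Icc_floor_exp] at hn ⊢
  exact ⟨hn.1, hn.2.trans h⟩

lemma integral_mul_ite {f : ℝ → ℝ} {a b x : ℝ} (c : ℝ) (hf : IntervalIntegrable f volume a b)
    (hab : a ≤ b) (hx : x ≤ b) :
    IntervalIntegrable (fun v ↦ f v * if x ≤ v then c else 0) volume a b ∧
      ∫ v in a..b, f v * (if x ≤ v then c else 0) = (∫ v in (max a x)..b, f v) * c := by
  have e : (fun v ↦ f v * if x ≤ v then c else 0) = (Set.Ici x).indicator fun v ↦ f v * c := by
    ext v
    by_cases h : x ≤ v <;> simp [Set.indicator, h]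
  rw [intervalIntegrable_iff_integrableOn_Ioc_of_le hab] at hf ⊢
  constructor
  · rw [e]
    exact (hf.mul_const c).indicator measurableSet_Ici
  · rw [e, intervalIntegral.integral_of_le hab, setIntegral_indicator measurableSet_Ici,
      intervalIntegral.integral_of_le (max_le hab hx), integral_mul_const, ← Set.Ioc_inter_Ioi]
    congr 1
    exact setIntegral_congr_set (EventuallyEq.inter (ae_eq_refl _) Ioi_ae_eq_Ici.symm)

/-- Partial summation for sums indexed by `log n ≤ u`. -/
lemma logSum_mul_sub (a : ℕ → ℝ) {φ φ' : ℝ → ℝ} {u₀ u : ℝ} (hu : u₀ ≤ u)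
    (hd : ∀ v ∈ Set.Icc u₀ u, HasDerivAt φ (φ' v) v) (hc : ContinuousOn φ' (Set.Icc u₀ u)) :
    logSum (fun n ↦ a n * φ (Real.log n)) u - logSum (fun n ↦ a n * φ (Real.log n)) u₀ =
      logSum a u * φ u - logSum a u₀ * φ u₀ - ∫ v in u₀..u, φ' v * logSum a v := by
  have hi : IntervalIntegrable φ' volume u₀ u := by
    refine ContinuousOn.intervalIntegrable ?_
    rwa [Set.uIcc_of_le hu]
  have hintg : ∫ v in u₀..u, φ' v * logSum a v =
      ∑ n ∈ Finset.Icc 1 ⌊Real.exp u⌋₊, (φ u - φ (max u₀ (Real.log n))) * a n := by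
    have h1 : ∫ v in u₀..u, φ' v * logSum a v = ∫ v in u₀..u,
        ∑ n ∈ Finset.Icc 1 ⌊Real.exp u⌋₊, φ' v * if Real.log n ≤ v then a n else 0 := by
      refine intervalIntegral.integral_congr fun v hv ↦ ?_
      rw [Set.uIcc_of_le hu] at hv
      rw [logSum_eq_sum_ite a hv.2, Finset.mul_sum]
    rw [h1, intervalIntegral.integral_finsetSum]
    · refine Finset.sum_congr rfl fun n hn ↦ ?_
      rw [mem_Icc_floor_exp] at hn
      rw [(integral_mul_ite (a n) hi hu hn.2).2]
      have hm : max u₀ (Real.log n) ≤ u := max_le hu hn.2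
      rw [intervalIntegral.integral_eq_sub_of_hasDerivAt]
      · intro v hv
        rw [Set.uIcc_of_le hm] at hv
        exact hd v ⟨(le_max_left _ _).trans hv.1, hv.2⟩
      · refine hi.mono_set ?_
        rw [Set.uIcc_of_le hm, Set.uIcc_of_le hu]
        exact Set.Icc_subset_Icc_left (le_max_left _ _)
    · intro n hn
      rw [mem_Icc_floor_exp] at hn
      exact (integral_mul_ite (a n) hi hu hn.2).1
  rw [hintg, logSum_eq_sum_ite _ hu, logSum_eq_sum_ite _ hu, logSum, logSum, Finset.sum_mul,
    Finset.sum_mul, ← Finset.sum_sub_distrib, ← Finset.sum_sub_distrib, ← Finset.sum_sub_distrib]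
  refine Finset.sum_congr rfl fun n hn ↦ ?_
  split_ifs with h
  · rw [max_eq_left h]; ring
  · rw [max_eq_right (not_le.1 h).le]; ring

/-- The coefficients `Λ(n) / log n` of `log ζ`. -/
noncomputable def logCoeff (n : ℕ) : ℝ := Λ n / Real.log n

lemma logCoeff_nonneg (n : ℕ) : 0 ≤ logCoeff n :=
  div_nonneg ArithmeticFunction.vonMangoldt_nonneg (Real.log_natCast_nonneg n)

lemma logCoeff_le_one (n : ℕ) : logCoeff n ≤ 1 :=
  div_le_one_of_le₀ ArithmeticFunction.vonMangoldt_le_log (Real.log_natCast_nonneg n)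

lemma logCoeff_one : logCoeff 1 = 0 := by simp [logCoeff]

lemma abscissa_logCoeff_le : LSeries.abscissaOfAbsConv (fun n ↦ (logCoeff n : ℂ)) ≤ 1 :=
  LSeries.abscissaOfAbsConv_le_of_le_const ⟨1, fun n _ ↦ by
    rw [Complex.norm_real, Real.norm_of_nonneg (logCoeff_nonneg n)]; exact logCoeff_le_one n⟩

lemma exp_LSeries_logCoeff {s : ℂ} (hs : 1 < s.re) :
    Complex.exp (LSeries (fun n ↦ (logCoeff n : ℂ)) s) = riemannZeta s := by
  set f : ℕ → ℂ := fun n ↦ (logCoeff n : ℂ) with hf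
  have hab : ∀ z : ℂ, 1 < z.re → LSeries.abscissaOfAbsConv f < z.re := fun z hz ↦
    abscissa_logCoeff_le.trans_lt (by exact_mod_cast hz)
  have hlm : LSeries.logMul f = fun n ↦ (Λ n : ℂ) := by
    ext n
    rw [LSeries.logMul, hf, ← Complex.natCast_log, ← Complex.ofReal_mul, logCoeff]
    rcases Nat.lt_or_ge n 2 with h | h
    · interval_cases n <;> simp
    · have : 0 < Real.log n := Real.log_pos (by exact_mod_cast h)
      congr 1
      field_simp
  set G : ℂ → ℂ := fun z ↦ riemannZeta z * Complex.exp (-LSeries f z) with hG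
  have hGd : ∀ z : ℂ, 1 < z.re → HasDerivAt G 0 z := by
    intro z hz
    have hz1 : z ≠ 1 := by rintro rfl; simp at hz
    have h1 := (differentiableAt_riemannZeta hz1).hasDerivAt
    have h2 := (LSeries_hasDerivAt (hab z hz)).neg.cexp
    have h3 := h1.mul h2
    rw [hlm, ArithmeticFunction.LSeries_vonMangoldt_eq_deriv_riemannZeta_div hz] at h3
    refine h3.congr_deriv ?_
    have := riemannZeta_ne_zero_of_one_lt_re hz
    simp only [Pi.neg_apply]
    field_simp
    ring
  have hconst : ∀ z : ℂ, 1 < z.re → G z = G s := by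
    intro z hz
    have hconv : Convex ℝ {z : ℂ | 1 < z.re} := convex_halfSpace_re_gt 1
    have hopen : IsOpen {z : ℂ | 1 < z.re} := isOpen_lt continuous_const Complex.continuous_re
    refine hconv.is_const_of_fderivWithin_eq_zero (𝕜 := ℂ)
      (fun w hw ↦ (hGd w hw).differentiableAt.differentiableWithinAt) (fun w hw ↦ ?_) hz hs
    rw [fderivWithin_of_isOpen hopen hw]
    have := (hGd w hw).hasFDerivAt.fderiv
    rw [this]; ext; simp
  have hlim : Tendsto (fun x : ℝ ↦ G x) atTop (𝓝 1) := by
    have h1 : Tendsto (fun x : ℝ ↦ LSeries f x) atTop (𝓝 (f 1)) :=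
      LSeries.tendsto_atTop (abscissa_logCoeff_le.trans_lt (by exact_mod_cast EReal.coe_lt_top 1))
    have h2 : Tendsto (fun x : ℝ ↦ LSeries 1 x) atTop (𝓝 1) :=
      LSeries.tendsto_atTop (f := 1) (by
        rw [LSeries.abscissaOfAbsConv_one]; exact_mod_cast EReal.coe_lt_top 1)
    have h3 : f 1 = 0 := by simp [hf, logCoeff_one]
    rw [h3] at h1
    have h4 := h2.mul (Complex.continuous_exp.continuousAt.tendsto.comp h1.neg)
    simp only [neg_zero, Complex.exp_zero, mul_one] at h4
    refine h4.congr' ?_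
    filter_upwards [eventually_gt_atTop 1] with x hx
    rw [LSeries_one_eq_riemannZeta (by simpa using hx)]
    rfl
  have hone : G s = 1 := by
    refine tendsto_nhds_unique (tendsto_const_nhds.congr' ?_) hlim
    filter_upwards [eventually_gt_atTop 1] with x hx
    exact (hconst x (by simpa using hx)).symm
  rw [hG] at hone
  simp only [Complex.exp_neg] at hone
  rw [mul_inv_eq_one₀ (Complex.exp_ne_zero _)] at hone
  exact hone.symm

/-- The weighted sum `∑ Λ(n) / (n log n)` over `log n ≤ u`. -/
noncomputable def mertensSum (u : ℝ) : ℝ := logSum (fun n ↦ logCoeff n / n) u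

lemma mertensSum_mono : Monotone mertensSum :=
  logSum_mono fun n ↦ div_nonneg (logCoeff_nonneg n) n.cast_nonneg

lemma mertensSum_eq_zero {u : ℝ} (hu : u < Real.log 2) : mertensSum u = 0 := by
  unfold mertensSum logSum
  refine Finset.sum_eq_zero fun n hn ↦ ?_
  rw [mem_Icc_floor_exp] at hn
  have : n < 2 := by
    by_contra! h
    have := Real.log_le_log (by norm_num) (by exact_mod_cast h : (2 : ℝ) ≤ n)
    linarith [hn.2]
  have : n = 1 := by omega
  simp [this, logCoeff_one]

lemma exists_abs_mertensSum_sub_sub_le : ∃ C > 0, ∀ u v : ℝ, 2 ≤ u → u ≤ v →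
    |(mertensSum v - Real.log v) - (mertensSum u - Real.log u)| ≤ C / u ^ 3 := by
  obtain ⟨C, hC, hB⟩ := exists_abs_logSum_sub_le
  set b : ℕ → ℝ := fun n ↦ Λ n * Real.log n ^ 7 / n with hb
  refine ⟨5 * C, by positivity, fun u v hu huv ↦ ?_⟩
  have hu0 : 0 < u := by linarith
  have hpos : ∀ w ∈ Set.Icc u v, 0 < w := fun w hw ↦ hu0.trans_le hw.1
  have hterm : ∀ n : ℕ, b n * (Real.log n ^ 8)⁻¹ = logCoeff n / n := by
    intro n
    rcases eq_or_ne (Real.log n) 0 with h | h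
    · simp [hb, h, logCoeff]
    · rw [hb, logCoeff]; field_simp
  have habel := logSum_mul_sub b (φ := fun w ↦ (w ^ 8)⁻¹) (φ' := fun w ↦ -8 * (w ^ 9)⁻¹) huv
    (fun w hw ↦ by
      have := (hpos w hw).ne'
      refine ((hasDerivAt_pow 8 w).inv (by positivity)).congr_deriv ?_
      field_simp
      norm_num [mul_comm])
    (by
      refine continuousOn_const.mul (ContinuousOn.inv₀ (by fun_prop) fun w hw ↦ ?_)
      have := hpos w hw
      positivity)
  simp only [hterm] at habel
  have hci : ∀ k : ℕ, IntervalIntegrable (fun w : ℝ ↦ (w ^ k)⁻¹) volume u v := fun k ↦ by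
    refine ContinuousOn.intervalIntegrable ?_
    rw [Set.uIcc_of_le huv]
    refine ContinuousOn.inv₀ (by fun_prop) fun w hw ↦ ?_
    have := hpos w hw
    positivity
  have hbm : Monotone (logSum b) := logSum_mono fun n ↦ by
    have := ArithmeticFunction.vonMangoldt_nonneg (n := n)
    have := Real.log_natCast_nonneg n
    positivity
  have hcb : IntervalIntegrable (fun w : ℝ ↦ -8 * (w ^ 9)⁻¹ * logSum b w) volume u v := by
    refine hbm.intervalIntegrable.continuousOn_mul ?_
    rw [Set.uIcc_of_le huv]
    refine continuousOn_const.mul (ContinuousOn.inv₀ (by fun_prop) fun w hw ↦ ?_)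
    have := hpos w hw
    positivity
  have hlog : ∫ w in u..v, (w ^ 1)⁻¹ = Real.log v - Real.log u := by
    simp only [pow_one]
    rw [integral_inv_of_pos hu0 (by linarith), Real.log_div (by linarith) hu0.ne']
  have h4 : ∫ w in u..v, 8 * C * (w ^ 4)⁻¹ ≤ 8 * C / 3 / u ^ 3 := by
    have : ∫ w in u..v, (w ^ 4)⁻¹ = -(1 / 3) * (v ^ 3)⁻¹ - -(1 / 3) * (u ^ 3)⁻¹ := by
      refine intervalIntegral.integral_eq_sub_of_hasDerivAt (f := fun w ↦ -(1 / 3) * (w ^ 3)⁻¹)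
        (fun w hw ↦ ?_) (hci 4)
      rw [Set.uIcc_of_le huv] at hw
      have := (hpos w hw).ne'
      refine (((hasDerivAt_pow 3 w).inv (by positivity)).const_mul _).congr_deriv ?_
      field_simp
      norm_num
    rw [intervalIntegral.integral_const_mul, this]
    have hv3 : 0 ≤ (v ^ 3)⁻¹ := by
      have : 0 < v := by linarith
      positivity
    have : 8 * C * (-(1 / 3) * (v ^ 3)⁻¹ - -(1 / 3) * (u ^ 3)⁻¹) =
      8 * C / 3 / u ^ 3 - 8 * C / 3 * (v ^ 3)⁻¹ := by ring
    rw [this]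
    have : 0 ≤ 8 * C / 3 * (v ^ 3)⁻¹ := by positivity
    linarith
  have hI : |(∫ w in u..v, -8 * (w ^ 9)⁻¹ * logSum b w) + (Real.log v - Real.log u)| ≤
      8 * C / 3 / u ^ 3 := by
    rw [← hlog, ← intervalIntegral.integral_add hcb (hci 1)]
    refine le_trans ?_ h4
    rw [← Real.norm_eq_abs]
    refine intervalIntegral.norm_integral_le_of_norm_le huv ?_ ((hci 4).const_mul _)
    refine .of_forall fun w hw ↦ ?_
    have hw0 : 0 < w := hu0.trans hw.1
    have := hB w (hu.trans hw.1.le)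
    have e : -8 * (w ^ 9)⁻¹ * logSum b w + (w ^ 1)⁻¹ = -8 * (w ^ 9)⁻¹ * (logSum b w - w ^ 8 / 8) := by
      field_simp
      ring
    have e' : |-8 * (w ^ 9)⁻¹| = 8 * (w ^ 9)⁻¹ := by
      rw [abs_mul, abs_of_pos (by positivity : 0 < (w ^ 9)⁻¹)]; norm_num
    rw [e, Real.norm_eq_abs, abs_mul, e']
    calc 8 * (w ^ 9)⁻¹ * |logSum b w - w ^ 8 / 8| ≤ 8 * (w ^ 9)⁻¹ * (C * w ^ 5) := by gcongr
      _ = _ := by field_simp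
  have hE : ∀ w, u ≤ w → |logSum b w * (w ^ 8)⁻¹ - 1 / 8| ≤ C / u ^ 3 := by
    intro w hw
    have hw0 : 0 < w := hu0.trans_le hw
    have e : logSum b w * (w ^ 8)⁻¹ - 1 / 8 = (logSum b w - w ^ 8 / 8) / w ^ 8 := by field_simp
    rw [e, abs_div, abs_of_pos (by positivity : 0 < w ^ 8), div_le_iff₀ (by positivity)]
    calc _ ≤ C * w ^ 5 := hB w (hu.trans hw)
      _ = C / w ^ 3 * w ^ 8 := by field_simp
      _ ≤ _ := by gcongr
  have e1 := abs_le.1 (hE v huv)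
  have e2 := abs_le.1 (hE u le_rfl)
  have e3 := abs_le.1 hI
  have e4 : 8 * C / 3 / u ^ 3 = 8 / 3 * (C / u ^ 3) := by ring
  have e5 : 5 * C / u ^ 3 = 5 * (C / u ^ 3) := by ring
  have e6 : 0 ≤ C / u ^ 3 := by positivity
  unfold mertensSum
  rw [e5, abs_le]
  constructor <;> linarith

lemma exists_abs_mertensSum_sub_le : ∃ c : ℝ, ∃ C > 0, ∀ u : ℝ, 2 ≤ u →
    |mertensSum u - Real.log u - c| ≤ C / u ^ 3 := by
  obtain ⟨C, hC, h⟩ := exists_abs_mertensSum_sub_sub_le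
  set D : ℝ → ℝ := fun u ↦ mertensSum u - Real.log u with hD
  have hcau : Cauchy (map D atTop) := by
    rw [Metric.cauchy_iff]
    refine ⟨map_neBot, fun ε hε ↦ ?_⟩
    have h3 : Tendsto (fun u : ℝ ↦ C / u ^ 3) atTop (𝓝 0) :=
      tendsto_const_nhds.div_atTop (tendsto_pow_atTop (by norm_num))
    obtain ⟨u, hu, hu2⟩ := ((h3.eventually_lt_const (by positivity : 0 < ε / 2)).and
      (eventually_ge_atTop 2)).exists
    refine ⟨D '' Set.Ici u, image_mem_map (Ici_mem_atTop u), ?_⟩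
    rintro _ ⟨x, hx, rfl⟩ _ ⟨y, hy, rfl⟩
    have h1 := h u x hu2 hx
    have h2 := h u y hu2 hy
    rw [Real.dist_eq]
    calc |D x - D y| = |(D x - D u) - (D y - D u)| := by ring_nf
      _ ≤ _ := abs_sub _ _
      _ < ε := by linarith
  obtain ⟨c, hc⟩ := CompleteSpace.complete hcau
  refine ⟨c, C, hC, fun u hu ↦ ?_⟩
  have : Tendsto (fun v ↦ |D v - D u|) atTop (𝓝 |c - D u|) :=
    (Tendsto.sub_const hc _).abs
  have := le_of_tendsto this (by
    filter_upwards [eventually_ge_atTop u] with v hv using h u v hu hv)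
  rwa [abs_sub_comm] at this

lemma integral_exp_neg_mul_log :
    IntegrableOn (fun v ↦ Real.exp (-v) * Real.log v) (Set.Ioi 0) ∧
      ∫ v in Set.Ioi (0 : ℝ), Real.exp (-v) * Real.log v = -Real.eulerMascheroniConstant := by
  have h2 : ∫ v in Set.Ioi (0 : ℝ), Real.exp (-v) * Real.log v = -Real.eulerMascheroniConstant := by
    have h := Complex.hasDerivAt_GammaIntegral (s := 1) (by simp)
    have hG : Complex.Gamma =ᶠ[𝓝 1] Complex.GammaIntegral := by
      filter_upwards [(isOpen_lt continuous_const Complex.continuous_re).mem_nhds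
        (show (0 : ℝ) < (1 : ℂ).re by simp)] with s hs using Complex.Gamma_eq_integral hs
    have h3 := (h.congr_of_eventuallyEq hG).unique Complex.hasDerivAt_Gamma_one
    simp only [sub_self, Complex.cpow_zero, one_mul] at h3
    have h4 : ∫ t : ℝ in Set.Ioi 0, ((Real.log t : ℂ) * (Real.exp (-t) : ℂ)) =
        ((∫ v in Set.Ioi (0 : ℝ), Real.exp (-v) * Real.log v : ℝ) : ℂ) := by
      rw [← integral_complex_ofReal]
      refine integral_congr_ae (.of_forall fun t ↦ ?_)
      push_cast
      ring
    rw [h4] at h3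
    exact_mod_cast h3
  refine ⟨?_, h2⟩
  by_contra hcon
  rw [integral_undef hcon] at h2
  have := Real.one_half_lt_eulerMascheroniConstant
  linarith

lemma integral_exp_neg_mul_mul_log {ε : ℝ} (hε : 0 < ε) :
    IntegrableOn (fun u ↦ Real.exp (-(ε * u)) * Real.log u) (Set.Ioi 0) ∧
      ε * ∫ u in Set.Ioi (0 : ℝ), Real.exp (-(ε * u)) * Real.log u =
        -Real.eulerMascheroniConstant - Real.log ε := by
  obtain ⟨h1, h2⟩ := integral_exp_neg_mul_log
  have he : IntegrableOn (fun v ↦ Real.exp (-v)) (Set.Ioi 0) := by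
    simpa using integrableOn_exp_mul_Ioi (neg_one_lt_zero) 0
  set g : ℝ → ℝ := fun v ↦ Real.exp (-v) * Real.log v - Real.exp (-v) * Real.log ε with hg
  have hgi : IntegrableOn g (Set.Ioi 0) := h1.sub (he.mul_const _)
  have hgc : Set.EqOn (fun u ↦ g (ε * u)) (fun u ↦ Real.exp (-(ε * u)) * Real.log u)
      (Set.Ioi 0) := by
    intro u hu
    simp only [hg]
    rw [Real.log_mul hε.ne' (ne_of_gt hu)]
    ring
  constructor
  · rw [← integrableOn_congr_fun hgc measurableSet_Ioi, integrableOn_Ioi_comp_mul_left_iff _ _ hε,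
      mul_zero]
    exact hgi
  · rw [← setIntegral_congr_fun measurableSet_Ioi hgc, integral_comp_mul_left_Ioi g 0 hε, mul_zero,
      smul_eq_mul, mul_inv_cancel_left₀ hε.ne', hg, integral_sub h1 (he.mul_const _), h2,
      integral_mul_const, integral_exp_neg_Ioi_zero, one_mul]

lemma tendsto_logSum {a : ℕ → ℝ} {S : ℝ} (h0 : a 0 = 0) (h : HasSum a S) :
    Tendsto (logSum a) atTop (𝓝 S) := by
  have h1 : Tendsto (fun u : ℝ ↦ ⌊Real.exp u⌋₊ + 1) atTop atTop :=
    (tendsto_add_atTop_nat 1).comp (tendsto_nat_floor_atTop.comp Real.tendsto_exp_atTop)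
  refine (h.tendsto_sum_nat.comp h1).congr fun u ↦ ?_
  refine (Finset.sum_subset (fun n hn ↦ ?_) fun n hn hn' ↦ ?_).symm
  · rw [Finset.mem_Icc] at hn
    simp only [Finset.mem_range]
    omega
  · rw [Finset.mem_Icc] at hn'
    simp only [Finset.mem_range] at hn
    have : n = 0 := by omega
    rw [this, h0]

lemma hasSum_log_norm_riemannZeta {η : ℝ} (hη : 0 < η) (t : ℝ) :
    HasSum (fun n : ℕ ↦ logCoeff n / n * (Real.exp (-(η * Real.log n)) * Real.cos (t * Real.log n)))
      (Real.log ‖riemannZeta (1 + η + t * Complex.I)‖) := by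
  set s : ℂ := 1 + η + t * Complex.I with hs
  have hre : s.re = 1 + η := by simp [hs]
  have him : s.im = t := by simp [hs]
  have h1 : 1 < s.re := by linarith
  have hab : LSeries.abscissaOfAbsConv (fun n ↦ (logCoeff n : ℂ)) < s.re :=
    abscissa_logCoeff_le.trans_lt (by exact_mod_cast h1)
  have hsum := (LSeriesSummable_of_abscissaOfAbsConv_lt_re hab).hasSum
  have hsum' := Complex.hasSum_re hsum
  rw [← exp_LSeries_logCoeff h1, Complex.norm_exp, Real.log_exp]
  refine hsum'.congr_fun fun n ↦ ?_
  rcases Nat.eq_zero_or_pos n with rfl | hn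
  · simp
  have hn0 : (n : ℂ) ≠ 0 := by exact_mod_cast hn.ne'
  have hnr : (0 : ℝ) < n := by exact_mod_cast hn
  rw [LSeries.term_of_ne_zero hn.ne', div_eq_mul_inv (logCoeff n : ℂ), ← Complex.cpow_neg, Complex.re_ofReal_mul,
    Complex.cpow_def_of_ne_zero hn0, Complex.exp_re, ← Complex.natCast_log]
  simp only [Complex.mul_re, Complex.mul_im, Complex.neg_re, Complex.neg_im, Complex.ofReal_re,
    Complex.ofReal_im, hre, him, zero_mul, sub_zero, add_zero]
  have : Real.log n * -(1 + η) = -(η * Real.log n) - Real.log n := by ring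
  rw [this, Real.exp_sub, Real.exp_log hnr, mul_neg, Real.cos_neg, mul_comm t]
  ring

lemma logSum_logCoeff_zero (φ : ℕ → ℝ) : logSum (fun n ↦ logCoeff n / n * φ n) 0 = 0 := by
  simp [logSum, logCoeff_one]

lemma exists_mertensSum_le : ∃ C > 0, ∀ u, 0 ≤ u → mertensSum u ≤ u + C := by
  obtain ⟨c, C, hC, h⟩ := exists_abs_mertensSum_sub_le
  have key : ∀ u, 2 ≤ u → mertensSum u ≤ u + (|c| + C) := by
    intro u hu
    have h1 := (abs_le.1 (h u hu)).2
    have h2 : C / u ^ 3 ≤ C := div_le_self hC.le (one_le_pow₀ (by linarith))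
    have h3 := Real.log_le_sub_one_of_pos (by linarith : 0 < u)
    linarith [le_abs_self c]
  refine ⟨2 + (|c| + C), by positivity, fun u hu ↦ ?_⟩
  rcases le_total 2 u with h2 | h2
  · linarith [key u h2]
  · linarith [key 2 le_rfl, mertensSum_mono h2]

lemma integrableOn_mertens_error {c C : ℝ} (h : ∀ u : ℝ, 2 ≤ u →
    |mertensSum u - Real.log u - c| ≤ C / u ^ 3) :
    IntegrableOn (fun u ↦ mertensSum u - Real.log u - c) (Set.Ioi 0) ∧
      IntegrableOn (fun u ↦ u * (mertensSum u - Real.log u - c)) (Set.Ioi 0) := by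
  have hmeas : Measurable fun u ↦ mertensSum u - Real.log u - c :=
    (mertensSum_mono.measurable.sub Real.measurable_log).sub_const c
  have hlow : IntervalIntegrable (fun u ↦ mertensSum u - Real.log u - c) volume 0 2 :=
    (mertensSum_mono.intervalIntegrable.sub intervalIntegral.intervalIntegrable_log').sub
      intervalIntegrable_const
  have hlow' : IntervalIntegrable (fun u ↦ u * (mertensSum u - Real.log u - c)) volume 0 2 :=
    hlow.continuousOn_mul continuousOn_id
  rw [intervalIntegrable_iff_integrableOn_Ioc_of_le (by norm_num)] at hlow hlow'
  have hC : 0 ≤ C := by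
    have := (abs_nonneg _).trans (h 2 le_rfl)
    by_contra! hc
    have : C / 2 ^ 3 < 0 := div_neg_of_neg_of_pos hc (by norm_num)
    linarith
  have h2 : IntegrableOn (fun u : ℝ ↦ C * u ^ (-2 : ℝ)) (Set.Ioi 2) :=
    (integrableOn_Ioi_rpow_of_lt (by norm_num) (by norm_num)).const_mul C
  have hb : ∀ u ∈ Set.Ioi (2 : ℝ), |u * (mertensSum u - Real.log u - c)| ≤ C * u ^ (-2 : ℝ) := by
    intro u hu
    have hu0 : 0 < u := by linarith [Set.mem_Ioi.1 hu]
    rw [abs_mul, abs_of_pos hu0, Real.rpow_neg hu0.le]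
    norm_cast
    calc _ ≤ u * (C / u ^ 3) := by gcongr; exact h u hu.le
      _ = _ := by field_simp
  rw [← Set.Ioc_union_Ioi_eq_Ioi (zero_le_two)]
  constructor
  · refine hlow.union (h2.mono' hmeas.aestronglyMeasurable ?_)
    filter_upwards [ae_restrict_mem measurableSet_Ioi] with u hu
    refine le_trans ?_ (hb u hu)
    rw [abs_mul, Real.norm_eq_abs]
    refine le_mul_of_one_le_left (abs_nonneg _) ?_
    exact (le_abs_self u).trans' (by linarith [Set.mem_Ioi.1 hu])
  · refine hlow'.union (h2.mono' (measurable_id.mul hmeas).aestronglyMeasurable ?_)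
    filter_upwards [ae_restrict_mem measurableSet_Ioi] with u hu using hb u hu

lemma mertens_const_eq {c C : ℝ} (h : ∀ u : ℝ, 2 ≤ u →
    |mertensSum u - Real.log u - c| ≤ C / u ^ 3) : c = Real.eulerMascheroniConstant := by
  obtain ⟨hR, -⟩ := integrableOn_mertens_error h
  obtain ⟨C', hC', hM⟩ := exists_mertensSum_le
  have hlim0 : Tendsto (fun ε : ℝ ↦ Real.log ‖zetaOne (1 + ε)‖) (𝓝[>] 0) (𝓝 0) := by
    have h1 : Continuous fun ε : ℝ ↦ ‖zetaOne (1 + ε)‖ :=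
      (differentiable_zetaOne.continuous.comp (by fun_prop)).norm
    have h2 := (Real.continuousAt_log (x := ‖zetaOne (1 + (0 : ℝ))‖) (by simp [zetaOne_one])).tendsto
    have h3 := h2.comp (h1.tendsto 0)
    simp only [Complex.ofReal_zero, add_zero, zetaOne_one, norm_one, Real.log_one] at h3
    exact h3.mono_left nhdsWithin_le_nhds
  have key : ∀ ε : ℝ, 0 < ε → Real.log ‖zetaOne (1 + ε)‖ = c - Real.eulerMascheroniConstant +
      ε * ∫ u in Set.Ioi (0 : ℝ), Real.exp (-(ε * u)) * (mertensSum u - Real.log u - c) := by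
    intro ε hε
    obtain ⟨hl1, hl2⟩ := integral_exp_neg_mul_mul_log hε
    have he : IntegrableOn (fun v ↦ Real.exp (-(ε * v))) (Set.Ioi 0) := by
      simpa using integrableOn_exp_mul_Ioi (neg_lt_zero.2 hε) 0
    have heI : ε * ∫ v in Set.Ioi (0 : ℝ), Real.exp (-(ε * v)) = 1 := by
      have := integral_exp_mul_Ioi (neg_lt_zero.2 hε) 0
      simp only [neg_mul, mul_zero, Real.exp_zero] at this
      rw [this]
      field_simp
    have hRe : IntegrableOn
        (fun u ↦ Real.exp (-(ε * u)) * (mertensSum u - Real.log u - c)) (Set.Ioi 0) := by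
      refine hR.norm.mono' ((by fun_prop : Continuous fun u : ℝ ↦
        Real.exp (-(ε * u))).aestronglyMeasurable.mul hR.aestronglyMeasurable) ?_
      filter_upwards [ae_restrict_mem measurableSet_Ioi] with u hu
      rw [norm_mul, Real.norm_of_nonneg (Real.exp_pos _).le]
      refine mul_le_of_le_one_left (norm_nonneg _) (Real.exp_le_one_iff.2 ?_)
      have := mul_pos hε hu
      linarith
    have hMeq : (fun u ↦ Real.exp (-(ε * u)) * mertensSum u) = fun u ↦
        Real.exp (-(ε * u)) * (mertensSum u - Real.log u - c) +
          Real.exp (-(ε * u)) * Real.log u + Real.exp (-(ε * u)) * c := by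
      ext u; ring
    have hMi : IntegrableOn (fun u ↦ Real.exp (-(ε * u)) * mertensSum u) (Set.Ioi 0) := by
      rw [hMeq]
      exact (hRe.add hl1).add (he.mul_const c)
    have hMint : ε * ∫ u in Set.Ioi (0 : ℝ), Real.exp (-(ε * u)) * mertensSum u =
        c - Real.eulerMascheroniConstant - Real.log ε +
      ε * ∫ u in Set.Ioi (0 : ℝ), Real.exp (-(ε * u)) * (mertensSum u - Real.log u - c) := by
      have e1 := integral_add (hRe.add hl1) (he.mul_const c)
      have e2 := integral_add hRe hl1
      simp only [Pi.add_apply] at e1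
      rw [hMeq, e1, e2, integral_mul_const, mul_add, mul_add, hl2, ← mul_assoc, heI]
      ring
    have hz : Real.log ‖zetaOne (1 + ε)‖ = Real.log ε + Real.log ‖riemannZeta (1 + ε)‖ := by
      have hne : (1 : ℂ) + ε ≠ 1 := by simpa using hε.ne'
      have hz0 : riemannZeta (1 + ε) ≠ 0 := riemannZeta_ne_zero_of_one_lt_re (by simpa using hε)
      rw [zetaOne_of_ne hne, add_sub_cancel_left, norm_mul, Complex.norm_real,
        Real.norm_of_nonneg hε.le, Real.log_mul hε.ne' (norm_ne_zero_iff.2 hz0)]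
    have hsum := hasSum_log_norm_riemannZeta hε 0
    simp only [zero_mul, Real.cos_zero, mul_one, Complex.ofReal_zero, add_zero] at hsum
    have ht1 := tendsto_logSum (by simp) hsum
    have ht2 : Tendsto (fun u ↦ mertensSum u * Real.exp (-(ε * u)) +
        ε * ∫ v in (0 : ℝ)..u, Real.exp (-(ε * v)) * mertensSum v) atTop
        (𝓝 (0 + ε * ∫ u in Set.Ioi (0 : ℝ), Real.exp (-(ε * u)) * mertensSum u)) := by
      refine Tendsto.add ?_
        ((intervalIntegral_tendsto_integral_Ioi 0 hMi tendsto_id).const_mul ε)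
      have hb : Tendsto (fun u : ℝ ↦ u * Real.exp (-(ε * u)) + C' * Real.exp (-(ε * u))) atTop
          (𝓝 (0 + C' * 0)) := by
        have h1 := Real.tendsto_pow_mul_exp_neg_atTop_nhds_zero 1
        have h2 : Tendsto (fun u : ℝ ↦ ε * u) atTop atTop := tendsto_id.const_mul_atTop hε
        have h3 := (h1.comp h2).const_mul ε⁻¹
        refine Tendsto.add ?_ ((Real.tendsto_exp_neg_atTop_nhds_zero.comp h2).const_mul C')
        rw [mul_zero] at h3
        refine h3.congr fun u ↦ ?_
        simp only [Function.comp_apply, pow_one]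
        field_simp
      rw [zero_add, mul_zero] at hb
      refine tendsto_of_tendsto_of_tendsto_of_le_of_le' tendsto_const_nhds hb ?_ ?_
      · filter_upwards [eventually_ge_atTop 0] with u hu
        have : 0 ≤ mertensSum u := by
          rw [← mertensSum_eq_zero (Real.log_pos one_lt_two)]
          exact mertensSum_mono hu
        positivity
      · filter_upwards [eventually_ge_atTop 0] with u hu
        rw [← add_mul]
        gcongr
        exact hM u hu
    have hlim := tendsto_nhds_unique ht1 (ht2.congr' ?_)
    · rw [hz, hlim, zero_add, hMint]
      ring
    · filter_upwards [eventually_ge_atTop 0] with u hu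
      have := logSum_mul_sub (fun n ↦ logCoeff n / n) (φ := fun v ↦ Real.exp (-(ε * v)))
        (φ' := fun v ↦ -ε * Real.exp (-(ε * v))) hu (fun v _ ↦ by
          have := ((hasDerivAt_id v).const_mul ε).neg.exp
          refine this.congr_deriv ?_
          simp
          ring) (by fun_prop)
      rw [logSum_logCoeff_zero, sub_zero] at this
      rw [this]
      have h0 : logSum (fun n ↦ logCoeff n / (n : ℝ)) 0 = 0 :=
        mertensSum_eq_zero (Real.log_pos one_lt_two)
      rw [h0, zero_mul, sub_zero]
      simp_rw [neg_mul, mul_assoc]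
      rw [intervalIntegral.integral_neg, intervalIntegral.integral_const_mul, sub_neg_eq_add]
      rfl
  have hlim1 : Tendsto (fun ε : ℝ ↦ c - Real.eulerMascheroniConstant +
      ε * ∫ u in Set.Ioi (0 : ℝ), Real.exp (-(ε * u)) * (mertensSum u - Real.log u - c))
      (𝓝[>] 0) (𝓝 (c - Real.eulerMascheroniConstant + 0)) := by
    refine tendsto_const_nhds.add ?_
    have hb : Tendsto (fun ε : ℝ ↦
        ε * ∫ u in Set.Ioi (0 : ℝ), ‖mertensSum u - Real.log u - c‖) (𝓝[>] 0) (𝓝 0) := by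
      have := (continuous_mul_const (∫ u in Set.Ioi (0 : ℝ),
        ‖mertensSum u - Real.log u - c‖)).tendsto (0 : ℝ)
      rw [zero_mul] at this
      exact this.mono_left nhdsWithin_le_nhds
    refine squeeze_zero_norm' ?_ hb
    filter_upwards [self_mem_nhdsWithin] with ε hε
    have hε : 0 < ε := hε
    rw [norm_mul, Real.norm_of_nonneg hε.le]
    gcongr
    refine norm_integral_le_of_norm_le hR.norm ?_
    filter_upwards [ae_restrict_mem measurableSet_Ioi] with u hu
    rw [norm_mul, Real.norm_of_nonneg (Real.exp_pos _).le]
    refine mul_le_of_le_one_left (norm_nonneg _) (Real.exp_le_one_iff.2 ?_)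
    have := mul_pos hε hu
    linarith
  have := tendsto_nhds_unique (hlim0.congr' (by
    filter_upwards [self_mem_nhdsWithin] with ε hε using key ε hε)) hlim1
  linarith

/-- The error term in Mertens' theorem. -/
noncomputable def mertensError (u : ℝ) : ℝ :=
  mertensSum u - Real.log u - Real.eulerMascheroniConstant

lemma exists_abs_mertensError_le : ∃ C > 0, ∀ u : ℝ, 2 ≤ u → |mertensError u| ≤ C / u ^ 3 := by
  obtain ⟨c, C, hC, h⟩ := exists_abs_mertensSum_sub_le
  rw [mertens_const_eq h] at h
  exact ⟨C, hC, h⟩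

lemma integrableOn_mertensError : IntegrableOn mertensError (Set.Ioi 0) ∧
    IntegrableOn (fun u ↦ u * mertensError u) (Set.Ioi 0) := by
  obtain ⟨C, -, h⟩ := exists_abs_mertensError_le
  exact integrableOn_mertens_error h

end Mertens

section Oscillation
open Filter Topology MeasureTheory Real

/-- A uniform Riemann-Lebesgue lemma. -/
lemma exists_abs_integral_sin_mul_le {G : ℝ → ℝ} {b : ℝ} (hb : 0 ≤ b)
    (hG : ContinuousOn G (Set.Icc 0 b)) {κ : ℝ} (hκ : 0 < κ) :
    ∃ A₀ > 0, ∀ A ≥ A₀, ∀ τ ∈ Set.Icc 0 b, |∫ σ in (0 : ℝ)..τ, sin (A * σ) * G σ| ≤ κ := by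
  obtain ⟨p, hp⟩ := exists_polynomial_near_of_continuousOn 0 b G hG (κ / (2 * (b + 1)))
    (by positivity)
  obtain ⟨B₀, hB₀⟩ := (isCompact_Icc (a := (0 : ℝ)) (b := b)).exists_bound_of_continuousOn
    (f := fun x ↦ p.eval x) p.continuous.continuousOn
  obtain ⟨B₁, hB₁⟩ := (isCompact_Icc (a := (0 : ℝ)) (b := b)).exists_bound_of_continuousOn
    (f := fun x ↦ p.derivative.eval x) p.derivative.continuous.continuousOn
  have hB0 : 0 ≤ B₀ := (norm_nonneg _).trans (hB₀ 0 ⟨le_rfl, hb⟩)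
  have hB1 : 0 ≤ B₁ := (norm_nonneg _).trans (hB₁ 0 ⟨le_rfl, hb⟩)
  set D := 2 * B₀ + 2 * (b * B₁) with hD
  have hD0 : 0 ≤ D := by positivity
  refine ⟨2 * (D + 1) / κ, by positivity, fun A hA τ hτ ↦ ?_⟩
  have hA0 : 0 < A := (by positivity : 0 < 2 * (D + 1) / κ).trans_le hA
  have hsub : Set.uIcc 0 τ ⊆ Set.Icc 0 b := by
    rw [Set.uIcc_of_le hτ.1]; exact Set.Icc_subset_Icc_right hτ.2
  have hpc : Continuous fun x : ℝ ↦ p.eval x := p.continuous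
  have hpc' : Continuous fun x : ℝ ↦ p.derivative.eval x := p.derivative.continuous
  have h1 : ∫ σ in (0 : ℝ)..τ, sin (A * σ) * G σ =
      (∫ σ in (0 : ℝ)..τ, sin (A * σ) * p.eval σ) -
        ∫ σ in (0 : ℝ)..τ, sin (A * σ) * (p.eval σ - G σ) := by
    rw [← intervalIntegral.integral_sub]
    · refine intervalIntegral.integral_congr fun σ _ ↦ ?_
      ring
    · exact (by fun_prop : Continuous _).intervalIntegrable _ _
    · refine ContinuousOn.intervalIntegrable ?_
      exact (by fun_prop : Continuous fun σ ↦ sin (A * σ)).continuousOn.mul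
        (hpc.continuousOn.sub (hG.mono hsub))
  have h2 : |∫ σ in (0 : ℝ)..τ, sin (A * σ) * (p.eval σ - G σ)| ≤ κ / 2 := by
    have := intervalIntegral.norm_integral_le_of_norm_le_const (a := 0) (b := τ)
      (f := fun σ ↦ sin (A * σ) * (p.eval σ - G σ)) (C := κ / (2 * (b + 1))) fun σ hσ ↦ by
        have hσ' := hsub (Set.uIoc_subset_uIcc hσ)
        rw [norm_mul, Real.norm_eq_abs, Real.norm_eq_abs]
        exact (mul_le_of_le_one_left (abs_nonneg _) (abs_sin_le_one _)).trans (hp σ hσ').le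
    refine this.trans ?_
    rw [sub_zero, abs_of_nonneg hτ.1, div_mul_eq_mul_div, div_le_div_iff₀ (by positivity) two_pos]
    nlinarith [hτ.2]
  have h3 : ∫ σ in (0 : ℝ)..τ, sin (A * σ) * p.eval σ =
      (1 - cos (A * τ)) / A * p.eval τ - ∫ σ in (0 : ℝ)..τ, (1 - cos (A * σ)) / A *
        p.derivative.eval σ := by
    have := intervalIntegral.integral_mul_deriv_eq_deriv_mul (a := 0) (b := τ)
      (u := fun σ ↦ p.eval σ) (u' := fun σ ↦ p.derivative.eval σ)
      (v := fun σ ↦ (1 - cos (A * σ)) / A) (v' := fun σ ↦ sin (A * σ))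
      (fun σ _ ↦ p.hasDerivAt σ) (fun σ _ ↦ by
        have h := ((((hasDerivAt_id σ).const_mul A).cos).const_sub 1).div_const A
        refine h.congr_deriv ?_
        simp
        field_simp) (hpc'.intervalIntegrable _ _)
        ((by fun_prop : Continuous fun σ ↦ sin (A * σ)).intervalIntegrable _ _)
    simp only [mul_zero, cos_zero, sub_self, zero_div, sub_zero] at this
    simp_rw [mul_comm (sin _), mul_comm (_ / A)]
    exact this
  have hc : ∀ σ, |(1 - cos (A * σ)) / A| ≤ 2 / A := by
    intro σ
    rw [abs_div, abs_of_pos hA0]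
    gcongr
    rw [abs_le]
    constructor <;> linarith [neg_one_le_cos (A * σ), cos_le_one (A * σ)]
  have h4 : |∫ σ in (0 : ℝ)..τ, sin (A * σ) * p.eval σ| ≤ κ / 2 := by
    rw [h3]
    have h5 : |(1 - cos (A * τ)) / A * p.eval τ| ≤ 2 / A * B₀ := by
      rw [abs_mul]
      gcongr
      · exact hc τ
      · exact hB₀ τ hτ
    have h6 : |∫ σ in (0 : ℝ)..τ, (1 - cos (A * σ)) / A * p.derivative.eval σ| ≤
        2 / A * B₁ * b := by
      have := intervalIntegral.norm_integral_le_of_norm_le_const (a := 0) (b := τ)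
        (f := fun σ ↦ (1 - cos (A * σ)) / A * p.derivative.eval σ) (C := 2 / A * B₁) fun σ hσ ↦ by
          rw [norm_mul]
          gcongr
          · exact hc σ
          · exact hB₁ σ (hsub (Set.uIoc_subset_uIcc hσ))
      refine this.trans ?_
      rw [sub_zero, abs_of_nonneg hτ.1]
      gcongr
      exact hτ.2
    refine (abs_sub _ _).trans ((add_le_add h5 h6).trans ?_)
    have h7 : 2 / A * B₀ + 2 / A * B₁ * b = (2 * B₀ + 2 * (b * B₁)) / A := by ring
    rw [h7, div_le_iff₀ hA0]
    rw [ge_iff_le, div_le_iff₀ hκ] at hA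
    nlinarith
  rw [h1]
  exact (abs_sub _ _).trans (by linarith)

/-- The alternating sums of `log (m + 1) - log m`. -/
noncomputable def wallisSum (K : ℕ) : ℝ :=
  ∑ m ∈ Finset.range K, (-1 : ℝ) ^ m * (log (m + 1) - log m)

lemma wallisSum_odd (j : ℕ) : wallisSum (2 * j + 1) = -log (Real.Wallis.W j) := by
  induction j with
  | zero => simp [wallisSum, Real.Wallis.W]
  | succ j ih =>
    have e : 2 * (j + 1) + 1 = 2 * j + 1 + 1 + 1 := by ring
    rw [e, wallisSum, Finset.sum_range_succ, Finset.sum_range_succ, ← wallisSum, ih,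
      Real.Wallis.W_succ, log_mul (Real.Wallis.W_pos j).ne' (by positivity), log_mul (by positivity)
      (by positivity), log_div (by positivity) (by positivity), log_div (by positivity)
      (by positivity)]
    have h1 : (-1 : ℝ) ^ (2 * j + 1) = -1 := by rw [pow_succ, pow_mul]; simp
    have h2 : (-1 : ℝ) ^ (2 * j + 1 + 1) = 1 := by rw [pow_succ, h1]; simp
    rw [h1, h2]
    push_cast
    ring_nf

lemma tendsto_wallisSum_odd : Tendsto (fun j ↦ wallisSum (2 * j + 1)) atTop (𝓝 (log (2 / π))) := by
  simp_rw [wallisSum_odd]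
  have h : log (2 / π) = -log (π / 2) := by rw [← log_inv, inv_div]
  rw [h]
  exact ((continuousAt_log (by positivity)).tendsto.comp Real.Wallis.tendsto_W_nhds_pi_div_two).neg

/-- The oscillating main term. -/
noncomputable def mainTerm (K : ℕ) (τ : ℝ) : ℝ := wallisSum K +
  ∑ m ∈ Finset.range K, (-1 : ℝ) ^ m * ∫ x in (π * m)..(π * (m + 1)), (cos (τ * x) - 1) / x

/-- The derivative of `mainTerm`. -/
noncomputable def mainTermDeriv (K : ℕ) (τ : ℝ) : ℝ :=
  ∑ m ∈ Finset.range K, (-1 : ℝ) ^ m * ∫ x in (π * m)..(π * (m + 1)), -sin (τ * x)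

lemma mainTerm_zero (K : ℕ) : mainTerm K 0 = wallisSum K := by simp [mainTerm]

lemma mainTerm_neg (K : ℕ) (τ : ℝ) : mainTerm K (-τ) = mainTerm K τ := by
  simp [mainTerm]

lemma continuous_cos_sub_one_div (τ : ℝ) : Continuous fun x : ℝ ↦ (cos (τ * x) - 1) / x := by
  have : (fun x : ℝ ↦ (cos (τ * x) - 1) / x) =
      fun x ↦ -(τ * sin (τ * x / 2) * sinc (τ * x / 2)) := by
    ext x
    rcases eq_or_ne x 0 with rfl | hx
    · simp
    rcases eq_or_ne τ 0 with rfl | hτ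
    · simp
    rw [sinc_of_ne_zero (by positivity)]
    have h1 : cos (τ * x) = 1 - 2 * sin (τ * x / 2) ^ 2 := by
      have := cos_two_mul (τ * x / 2)
      rw [mul_div_cancel₀ _ (two_ne_zero)] at this
      rw [this, cos_sq']; ring
    rw [h1]
    field_simp
    ring
  rw [this]
  have := continuous_sinc
  fun_prop

lemma hasDerivAt_mainTerm (K : ℕ) (τ : ℝ) : HasDerivAt (mainTerm K) (mainTermDeriv K τ) τ := by
  unfold mainTerm mainTermDeriv
  refine HasDerivAt.const_add _ (HasDerivAt.fun_sum fun m _ ↦ HasDerivAt.const_mul _ ?_)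
  refine (intervalIntegral.hasDerivAt_integral_of_dominated_loc_of_deriv_le (s := Set.univ)
    (F := fun τ x ↦ (cos (τ * x) - 1) / x) (F' := fun τ x ↦ -sin (τ * x)) (bound := fun _ ↦ 1)
    univ_mem
    (.of_forall fun τ ↦ (continuous_cos_sub_one_div τ).aestronglyMeasurable)
    ((continuous_cos_sub_one_div τ).intervalIntegrable _ _)
    (by fun_prop : Continuous fun x ↦ -sin (τ * x)).aestronglyMeasurable
    (.of_forall fun x _ τ _ ↦ ?_) (intervalIntegrable_const) (.of_forall fun x _ τ _ ↦ ?_)).2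
  · rw [norm_neg]; exact abs_sin_le_one _
  · have h := (((hasDerivAt_id τ).mul_const x).cos.sub_const 1).div_const x
    refine h.congr_deriv ?_
    rcases eq_or_ne x 0 with rfl | hx
    · simp
    · simp; field_simp

lemma continuous_mainTermDeriv (K : ℕ) : Continuous (mainTermDeriv K) := by
  unfold mainTermDeriv
  refine continuous_finsetSum _ fun m _ ↦ continuous_const.mul ?_
  exact intervalIntegral.continuous_parametric_intervalIntegral_of_continuous' (by fun_prop) _ _

lemma cos_mul_mainTermDeriv (K : ℕ) (τ : ℝ) : cos (π * τ / 2) * mainTermDeriv K τ =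
    (-1) ^ K * (sin (K * π * τ) * (π / 2 * sinc (π * τ / 2))) := by
  rcases eq_or_ne τ 0 with rfl | hτ
  · simp [mainTermDeriv]
  have h1 : ∀ m : ℕ, τ * ∫ x in (π * m)..(π * (m + 1)), -sin (τ * x) =
      cos (τ * (π * (m + 1))) - cos (τ * (π * m)) := by
    intro m
    rw [intervalIntegral.integral_neg, mul_neg, intervalIntegral.mul_integral_comp_mul_left,
      integral_sin]
    ring
  have h2 : ∀ K : ℕ, cos (π * τ / 2) * (τ * mainTermDeriv K τ) =
      (-1) ^ K * (sin (K * π * τ) * sin (π * τ / 2)) := by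
    intro K
    induction K with
    | zero => simp [mainTermDeriv]
    | succ K ih =>
      have e : mainTermDeriv (K + 1) τ = mainTermDeriv K τ +
          (-1 : ℝ) ^ K * ∫ x in (π * K)..(π * (K + 1)), -sin (τ * x) := by
        rw [mainTermDeriv, Finset.sum_range_succ, ← mainTermDeriv]
      have e2 : cos (π * τ / 2) * (τ * mainTermDeriv (K + 1) τ) =
          cos (π * τ / 2) * (τ * mainTermDeriv K τ) + (-1 : ℝ) ^ K * (cos (π * τ / 2) *
          (cos (τ * (π * (K + 1))) - cos (τ * (π * K)))) := by
        rw [e, ← h1]; ring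
      rw [e2, ih, pow_succ]
      have a1 : τ * (π * (K + 1)) = K * π * τ + 2 * (π * τ / 2) := by ring
      have a2 : τ * (π * K) = K * π * τ := by ring
      have a3 : ((K + 1 : ℕ) : ℝ) * π * τ = K * π * τ + 2 * (π * τ / 2) := by push_cast; ring
      rw [a1, a2, a3, cos_add, sin_add, sin_two_mul, cos_two_mul]
      have := sin_sq_add_cos_sq (π * τ / 2)
      set c := cos (π * τ / 2)
      set d := sin (π * τ / 2)
      set A := sin (K * π * τ)
      set B := cos (K * π * τ)
      have hd : d ^ 2 = 1 - c ^ 2 := by linarith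
      linear_combination (-1 : ℝ) ^ K * (2 * B * c) * hd
  have h3 := h2 K
  have h4 : sin (π * τ / 2) = τ * (π / 2 * sinc (π * τ / 2)) := by
    rw [sinc_of_ne_zero (by positivity)]
    field_simp
  rw [h4] at h3
  refine mul_left_cancel₀ hτ ?_
  linear_combination h3

lemma sinc_pos {x : ℝ} (h0 : 0 ≤ x) (h1 : x < π) : 0 < sinc x := by
  rcases eq_or_lt_of_le h0 with rfl | h
  · simp
  · rw [sinc_of_ne_zero h.ne']
    exact div_pos (sin_pos_of_pos_of_lt_pi h h1) h

lemma one_sub_mul_mainTermDeriv (K : ℕ) {τ : ℝ} (h0 : 0 ≤ τ) (h1 : τ ≤ 1) :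
    (1 - τ) * mainTermDeriv K τ =
    (-1) ^ K * (sin (K * π * τ) * (sinc (π * τ / 2) / sinc (π * (1 - τ) / 2))) := by
  have hpi := pi_pos
  have h2 : 0 < sinc (π * (1 - τ) / 2) := sinc_pos (by
    have : 0 ≤ 1 - τ := by linarith
    positivity) (by nlinarith)
  have h3 : cos (π * τ / 2) = (1 - τ) * (π / 2 * sinc (π * (1 - τ) / 2)) := by
    have : cos (π * τ / 2) = sin (π * (1 - τ) / 2) := by
      rw [← sin_pi_div_two_sub]; congr 1; ring
    rw [this]
    rcases eq_or_ne τ 1 with rfl | h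
    · simp
    · have : 1 - τ ≠ 0 := sub_ne_zero.2 h.symm
      rw [sinc_of_ne_zero (by positivity)]
      field_simp
  have h4 := cos_mul_mainTermDeriv K τ
  rw [h3] at h4
  have h5 : (π / 2 * sinc (π * (1 - τ) / 2)) ≠ 0 := by positivity
  refine mul_left_cancel₀ h5 ?_
  have : π / 2 * sinc (π * (1 - τ) / 2) * ((-1) ^ K * (sin (K * π * τ) *
      (sinc (π * τ / 2) / sinc (π * (1 - τ) / 2)))) =
      (-1) ^ K * (sin (K * π * τ) * (π / 2 * sinc (π * τ / 2))) := by field_simp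
  rw [this, ← h4]
  ring

lemma exists_abs_mainTerm_sub_le {τ₀ : ℝ} (h0 : 0 ≤ τ₀) (h1 : τ₀ < 1) {κ : ℝ} (hκ : 0 < κ) :
    ∃ j₀ : ℕ, ∀ j ≥ j₀, ∀ τ, |τ| ≤ τ₀ → |mainTerm (2 * j + 1) τ - log (2 / π)| ≤ κ := by
  have hpi := pi_pos
  set G : ℝ → ℝ := fun τ ↦ π / 2 * sinc (π * τ / 2) / cos (π * τ / 2) with hG
  have hcos : ∀ τ ∈ Set.Icc 0 τ₀, cos (π * τ / 2) ≠ 0 := by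
    intro τ hτ
    refine (cos_pos_of_mem_Ioo ⟨?_, ?_⟩).ne' <;> nlinarith [hτ.1, hτ.2]
  have hGc : ContinuousOn G (Set.Icc 0 τ₀) := by
    have := continuous_sinc
    exact ContinuousOn.div (by fun_prop) (by fun_prop) hcos
  obtain ⟨A₀, hA₀, hA⟩ := exists_abs_integral_sin_mul_le h0 hGc (half_pos hκ)
  have hw := (Metric.tendsto_atTop.1 tendsto_wallisSum_odd) (κ / 2) (half_pos hκ)
  obtain ⟨j₁, hj₁⟩ := hw
  refine ⟨max j₁ ⌈A₀⌉₊, fun j hj τ hτ ↦ ?_⟩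
  wlog hpos : 0 ≤ τ generalizing τ
  · rw [← mainTerm_neg]
    exact this (-τ) (by rwa [abs_neg]) (by linarith)
  rw [abs_of_nonneg hpos] at hτ
  set K := 2 * j + 1 with hK
  have h2 : mainTerm K τ - wallisSum K = (-1) ^ K * ∫ σ in (0 : ℝ)..τ, sin (K * π * σ) * G σ := by
    rw [← mainTerm_zero, ← intervalIntegral.integral_eq_sub_of_hasDerivAt
      (fun σ _ ↦ hasDerivAt_mainTerm K σ) ((continuous_mainTermDeriv K).intervalIntegrable _ _),
      ← intervalIntegral.integral_const_mul]
    refine intervalIntegral.integral_congr fun σ hσ ↦ ?_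
    rw [Set.uIcc_of_le hpos] at hσ
    have hc := hcos σ ⟨hσ.1, hσ.2.trans hτ⟩
    refine mul_left_cancel₀ hc ?_
    rw [cos_mul_mainTermDeriv]
    simp only [hG]
    field_simp
  have hKA : A₀ ≤ K * π := by
    have : (⌈A₀⌉₊ : ℝ) ≤ j := by exact_mod_cast (le_max_right _ _).trans hj
    have h3 := (Nat.le_ceil A₀).trans this
    rw [hK]
    push_cast
    nlinarith [pi_gt_three, (by positivity : (0 : ℝ) ≤ j)]
  have h3 : |mainTerm K τ - wallisSum K| ≤ κ / 2 := by
    rw [h2, abs_mul, abs_pow, abs_neg, abs_one, one_pow, one_mul]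
    exact hA _ hKA τ ⟨hpos, hτ⟩
  have h4 := hj₁ j ((le_max_left _ _).trans hj)
  rw [Real.dist_eq] at h4
  calc _ = |(mainTerm K τ - wallisSum K) + (wallisSum K - log (2 / π))| := by ring_nf
    _ ≤ _ := abs_add_le _ _
    _ ≤ κ := by linarith

lemma tendsto_integral_mainTerm :
    Tendsto (fun j ↦ ∫ τ in (0 : ℝ)..1, mainTerm (2 * j + 1) τ) atTop (𝓝 (log (2 / π))) := by
  have hpi := pi_pos
  have hc := continuous_sinc
  set G : ℝ → ℝ := fun τ ↦ sinc (π * τ / 2) / sinc (π * (1 - τ) / 2) with hG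
  have hGc : ContinuousOn G (Set.Icc 0 1) := by
    refine ContinuousOn.div (by fun_prop) (by fun_prop) fun τ hτ ↦ (sinc_pos ?_ ?_).ne'
    · have : 0 ≤ 1 - τ := by linarith [hτ.2]
      positivity
    · nlinarith [hτ.1]
  have h2 : ∀ K, ∫ τ in (0 : ℝ)..1, mainTerm K τ =
      wallisSum K + (-1) ^ K * ∫ σ in (0 : ℝ)..1, sin (K * π * σ) * G σ := by
    intro K
    have := intervalIntegral.integral_mul_deriv_eq_deriv_mul (a := 0) (b := 1)
      (u := mainTerm K) (u' := mainTermDeriv K)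
      (v := fun σ ↦ -(1 - σ)) (v' := fun σ ↦ 1)
      (fun σ _ ↦ hasDerivAt_mainTerm K σ) (fun σ _ ↦ by
        refine ((hasDerivAt_id σ).const_sub 1).neg.congr_deriv ?_
        simp) ((continuous_mainTermDeriv K).intervalIntegrable _ _)
        intervalIntegrable_const
    simp only [mul_one, sub_self, neg_zero, mul_zero, sub_zero, mul_neg,
      intervalIntegral.integral_neg, mainTerm_zero, sub_neg_eq_add] at this
    have e : ∫ σ in (0 : ℝ)..1, mainTermDeriv K σ * (1 - σ) =
        ∫ σ in (0 : ℝ)..1, (-1 : ℝ) ^ K * (sin (K * π * σ) * G σ) := by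
      refine intervalIntegral.integral_congr fun σ hσ ↦ ?_
      rw [Set.uIcc_of_le zero_le_one] at hσ
      rw [mul_comm, one_sub_mul_mainTermDeriv K hσ.1 hσ.2]
    rw [this, e, ← intervalIntegral.integral_const_mul, zero_add]
  rw [Metric.tendsto_atTop]
  intro κ hκ
  obtain ⟨A₀, hA₀, hA⟩ := exists_abs_integral_sin_mul_le zero_le_one hGc (half_pos hκ)
  obtain ⟨j₁, hj₁⟩ := (Metric.tendsto_atTop.1 tendsto_wallisSum_odd) (κ / 2) (half_pos hκ)
  refine ⟨max j₁ ⌈A₀⌉₊, fun j hj ↦ ?_⟩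
  have h4 := hj₁ j ((le_max_left _ _).trans hj)
  set K := 2 * j + 1 with hK
  have hKA : A₀ ≤ K * π := by
    have : (⌈A₀⌉₊ : ℝ) ≤ j := by exact_mod_cast (le_max_right _ _).trans hj
    have h3 := (Nat.le_ceil A₀).trans this
    rw [hK]
    push_cast
    nlinarith [pi_gt_three, (by positivity : (0 : ℝ) ≤ j)]
  have h3 := hA _ hKA 1 ⟨zero_le_one, le_rfl⟩
  rw [Real.dist_eq] at h4 ⊢
  rw [h2]
  calc _ = |(wallisSum K - log (2 / π)) +
        (-1) ^ K * ∫ σ in (0 : ℝ)..1, sin (K * π * σ) * G σ| := by ring_nf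
    _ ≤ |wallisSum K - log (2 / π)| + |∫ σ in (0 : ℝ)..1, sin (K * π * σ) * G σ| := by
      refine (abs_add_le _ _).trans ?_
      rw [abs_mul, abs_pow, abs_neg, abs_one, one_pow, one_mul]
    _ < κ := by linarith

end Oscillation

section Alternating
open Filter Topology MeasureTheory Real

/-- The twisted Mertens sum `∑ log(n)⁻¹ Λ(n) n⁻¹ cos(t log n)` over `log n ≤ u`. -/
noncomputable def oscSum (t u : ℝ) : ℝ := logSum (fun n ↦ logCoeff n / n * cos (t * log n)) u

lemma integral_mul_sin_mul_log (t : ℝ) {a b : ℝ} (ha : 0 ≤ a) (hab : a ≤ b) :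
    ∫ v in a..b, t * sin (t * v) * log v =
      (1 - cos (t * b)) * log b - (1 - cos (t * a)) * log a +
        ∫ v in a..b, (cos (t * v) - 1) / v := by
  have hc1 := continuous_cos_sub_one_div t
  have hF : Continuous fun v ↦ (1 - cos (t * v)) * log v := by
    have : (fun v ↦ (1 - cos (t * v)) * log v) =
        fun v ↦ -((cos (t * v) - 1) / v) * (v * log v) := by
      ext v
      rcases eq_or_ne v 0 with rfl | hv
      · simp
      · field_simp
        ring
    rw [this]
    exact hc1.neg.mul continuous_mul_log
  have hlog : IntervalIntegrable (fun v ↦ t * sin (t * v) * log v) volume a b :=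
    intervalIntegral.intervalIntegrable_log'.continuousOn_mul
      (by fun_prop : Continuous fun v ↦ t * sin (t * v)).continuousOn
  have hq : IntervalIntegrable (fun v ↦ (cos (t * v) - 1) / v) volume a b :=
    hc1.intervalIntegrable _ _
  have := intervalIntegral.integral_eq_sub_of_hasDerivAt_of_le hab hF.continuousOn
    (f' := fun v ↦ t * sin (t * v) * log v - (cos (t * v) - 1) / v) (fun v hv ↦ by
      have hv0 : v ≠ 0 := (ha.trans_lt hv.1).ne'
      have h := ((((hasDerivAt_id v).const_mul t).cos).const_sub 1).mul (hasDerivAt_log hv0)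
      refine h.congr_deriv ?_
      simp
      field_simp
      ring) (hlog.sub hq)
  rw [intervalIntegral.integral_sub hlog hq] at this
  linarith

lemma intervalIntegrable_mertensError (a b : ℝ) :
    IntervalIntegrable mertensError volume a b :=
  ((mertensSum_mono.intervalIntegrable).sub intervalIntegral.intervalIntegrable_log').sub
    intervalIntegrable_const

lemma oscSum_sub (t : ℝ) {a b : ℝ} (ha : 0 ≤ a) (hab : a ≤ b) :
    oscSum t b - oscSum t a = log b - log a + (∫ v in a..b, (cos (t * v) - 1) / v) +
      (cos (t * b) * mertensError b - cos (t * a) * mertensError a) +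
      ∫ v in a..b, t * sin (t * v) * mertensError v := by
  have h := logSum_mul_sub (fun n ↦ logCoeff n / n) (φ := fun v ↦ cos (t * v))
    (φ' := fun v ↦ -(t * sin (t * v))) hab (fun v _ ↦ by
      refine (((hasDerivAt_id v).const_mul t).cos).congr_deriv ?_
      simp
      ring) (by fun_prop)
  have hsin : Continuous fun v ↦ t * sin (t * v) := by fun_prop
  have hi1 : IntervalIntegrable (fun v ↦ t * sin (t * v) * log v) volume a b :=
    intervalIntegral.intervalIntegrable_log'.continuousOn_mul hsin.continuousOn
  have hi2 : IntervalIntegrable (fun v ↦ t * sin (t * v) * mertensError v) volume a b :=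
    (intervalIntegrable_mertensError a b).continuousOn_mul hsin.continuousOn
  have hi3 : IntervalIntegrable (fun v ↦ t * sin (t * v) * eulerMascheroniConstant) volume a b :=
    (hsin.mul continuous_const).intervalIntegrable _ _
  have h1 : ∫ v in a..b, -(t * sin (t * v)) * logSum (fun n ↦ logCoeff n / n) v =
      -((∫ v in a..b, t * sin (t * v) * log v) +
        (∫ v in a..b, t * sin (t * v) * eulerMascheroniConstant) +
        ∫ v in a..b, t * sin (t * v) * mertensError v) := by
    rw [← intervalIntegral.integral_add hi1 hi3, ← intervalIntegral.integral_add (hi1.add hi3) hi2,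
      ← intervalIntegral.integral_neg]
    refine intervalIntegral.integral_congr fun v _ ↦ ?_
    simp only [mertensError, mertensSum]
    ring
  have h2 : ∫ v in a..b, t * sin (t * v) * eulerMascheroniConstant =
      (cos (t * a) - cos (t * b)) * eulerMascheroniConstant := by
    rw [intervalIntegral.integral_mul_const]
    congr 1
    rw [intervalIntegral.integral_eq_sub_of_hasDerivAt (f := fun v ↦ -cos (t * v))]
    · ring
    · intro v _
      refine (((hasDerivAt_id v).const_mul t).cos).neg.congr_deriv ?_
      simp
      ring
    · exact hsin.intervalIntegrable _ _
  rw [h1, h2, integral_mul_sin_mul_log t ha hab] at h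
  have e : ∀ u, logSum (fun n ↦ logCoeff n / n) u =
      mertensError u + log u + eulerMascheroniConstant := fun u ↦ by
    simp only [mertensError, mertensSum]; ring
  rw [e, e] at h
  simp only [oscSum]
  linarith

/-- The increments of `oscSum t` over consecutive intervals of length `π w`, with alternating
signs. -/
noncomputable def altSum (w t : ℝ) (K : ℕ) : ℝ :=
  ∑ m ∈ Finset.range K, (-1 : ℝ) ^ m * (oscSum t (w * (π * (m + 1))) - oscSum t (w * (π * m)))

lemma integral_scale {w : ℝ} (hw : 0 < w) (t a b : ℝ) :
    ∫ v in (w * a)..(w * b), (cos (t * v) - 1) / v = ∫ x in a..b, (cos (w * t * x) - 1) / x := by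
  rw [← intervalIntegral.mul_integral_comp_mul_left, ← intervalIntegral.integral_const_mul]
  refine intervalIntegral.integral_congr fun x _ ↦ ?_
  rw [show t * (w * x) = w * t * x by ring]
  rcases eq_or_ne x 0 with rfl | hx
  · simp
  · field_simp

lemma sum_log_sub {w : ℝ} (hw : 0 < w) {K : ℕ} (hK : 1 ≤ K) :
    ∑ m ∈ Finset.range K, (-1 : ℝ) ^ m * (log (w * (π * (m + 1))) - log (w * (π * m))) =
      log (w * π) + wallisSum K := by
  have hpi := pi_pos
  induction K, hK using Nat.le_induction with
  | base => simp [wallisSum]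
  | succ K hK ih =>
    have hK0 : (0 : ℝ) < K := by exact_mod_cast hK
    have h1 : log (w * (π * (K + 1))) = log (w * π) + log (K + 1) := by
      rw [← mul_assoc, log_mul (by positivity) (by positivity)]
    have h2 : log (w * (π * K)) = log (w * π) + log K := by
      rw [← mul_assoc, log_mul (by positivity) (by positivity)]
    rw [Finset.sum_range_succ, ih, wallisSum, wallisSum, Finset.sum_range_succ, h1, h2]
    ring

lemma exists_abs_altSum_sub_le : ∃ C > 0, ∀ w t : ℝ, ∀ K : ℕ, 2 ≤ w → |t| ≤ 1 / w → 1 ≤ K →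
    |altSum w t K - (eulerMascheroniConstant + log (w * π) + mainTerm K (w * t))| ≤ C / w ^ 2 := by
  obtain ⟨C, hC, hE⟩ := exists_abs_mertensError_le
  obtain ⟨-, hI⟩ := integrableOn_mertensError
  have hpi := pi_gt_three
  set Z : ℝ := ∑' n : ℕ, ((n : ℝ) ^ 3)⁻¹ with hZ
  have hZs : Summable fun n : ℕ ↦ ((n : ℝ) ^ 3)⁻¹ := Real.summable_nat_pow_inv.2 (by norm_num)
  have hZ0 : 0 ≤ Z := tsum_nonneg fun n ↦ by positivity
  set I : ℝ := ∫ v in Set.Ioi (0 : ℝ), |v * mertensError v| with hIdef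
  have hI0 : 0 ≤ I := integral_nonneg fun v ↦ abs_nonneg _
  refine ⟨2 * C * Z + I + 1, by positivity, fun w t K hw ht hK ↦ ?_⟩
  have hw0 : 0 < w := by linarith
  set u : ℕ → ℝ := fun m ↦ w * (π * m) with hu
  have hu0 : ∀ m, 0 ≤ u m := fun m ↦ by positivity
  have hus : ∀ m : ℕ, w * (π * (m + 1)) = u (m + 1) := fun m ↦ by simp [hu]
  have hum : ∀ m, u m ≤ u (m + 1) := fun m ↦ by
    simp only [hu]; gcongr; simp
  have hEu : ∀ m : ℕ, |mertensError (u (m + 1))| ≤ C / w ^ 2 * (((m + 1 : ℕ) : ℝ) ^ 3)⁻¹ := by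
    intro m
    have hm : (1 : ℝ) ≤ ((m + 1 : ℕ) : ℝ) := by exact_mod_cast Nat.le_add_left 1 m
    have h3 : w * ((m + 1 : ℕ) : ℝ) ≤ u (m + 1) := by
      simp only [hu]
      gcongr
      nlinarith
    refine (hE _ (by nlinarith)).trans ?_
    rw [div_mul_eq_mul_div, ← div_eq_mul_inv, div_div]
    gcongr
    calc ((m + 1 : ℕ) : ℝ) ^ 3 * w ^ 2 ≤ (w * ((m + 1 : ℕ) : ℝ)) ^ 3 := by
          rw [mul_pow, mul_comm]
          gcongr
          · linarith
          · norm_num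
      _ ≤ _ := by gcongr
  -- the decomposition
  have hdec : altSum w t K = log (w * π) + mainTerm K (w * t) +
      (∑ m ∈ Finset.range K, (-1 : ℝ) ^ m * (cos (t * u (m + 1)) * mertensError (u (m + 1)) -
        cos (t * u m) * mertensError (u m))) +
      ∑ m ∈ Finset.range K, (-1 : ℝ) ^ m *
        ∫ v in (u m)..(u (m + 1)), t * sin (t * v) * mertensError v := by
    rw [mainTerm, ← add_assoc, ← sum_log_sub hw0 hK, altSum, ← Finset.sum_add_distrib,
      ← Finset.sum_add_distrib, ← Finset.sum_add_distrib]
    refine Finset.sum_congr rfl fun m _ ↦ ?_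
    rw [← integral_scale hw0, hus, oscSum_sub t (hu0 m) (hum m)]
    ring
  have hb : |(∑ m ∈ Finset.range K, (-1 : ℝ) ^ m * (cos (t * u (m + 1)) * mertensError (u (m + 1)) -
        cos (t * u m) * mertensError (u m))) - eulerMascheroniConstant| ≤ 2 * C * Z / w ^ 2 := by
    set e : ℕ → ℝ := fun m ↦ cos (t * u m) * mertensError (u m) with he
    have he1 : ∀ m, |e (m + 1)| ≤ C / w ^ 2 * (((m + 1 : ℕ) : ℝ) ^ 3)⁻¹ := fun m ↦ by
      rw [he, abs_mul]
      exact (mul_le_of_le_one_left (abs_nonneg _) (abs_cos_le_one _)).trans (hEu m)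
    have he0 : e 0 = -eulerMascheroniConstant := by
      simp [he, hu, mertensError, mertensSum_eq_zero (log_pos one_lt_two)]
    have hpart : ∀ J : ℕ, |∑ m ∈ Finset.range J, (-1 : ℝ) ^ m * e (m + 1)| ≤ C / w ^ 2 * Z := by
      intro J
      refine (Finset.abs_sum_le_sum_abs _ _).trans ?_
      have h1 : ∑ m ∈ Finset.range J, (((m + 1 : ℕ) : ℝ) ^ 3)⁻¹ ≤ Z := by
        have h2 := hZs.sum_le_tsum (Finset.range (J + 1)) fun n _ ↦ by positivity
        rw [Finset.sum_range_succ'] at h2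
        refine le_trans ?_ h2
        simp
      calc _ ≤ ∑ m ∈ Finset.range J, C / w ^ 2 * (((m + 1 : ℕ) : ℝ) ^ 3)⁻¹ := by
            refine Finset.sum_le_sum fun m _ ↦ ?_
            rw [abs_mul, abs_pow, abs_neg, abs_one, one_pow, one_mul]
            exact he1 m
        _ ≤ _ := by rw [← Finset.mul_sum]; gcongr
    obtain ⟨J, rfl⟩ := Nat.exists_eq_succ_of_ne_zero (by omega : K ≠ 0)
    have hsplit : ∑ m ∈ Finset.range (J + 1), (-1 : ℝ) ^ m * (e (m + 1) - e m) =
        ∑ m ∈ Finset.range (J + 1), (-1 : ℝ) ^ m * e (m + 1) +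
        ∑ m ∈ Finset.range J, (-1 : ℝ) ^ m * e (m + 1) - e 0 := by
      simp_rw [mul_sub]
      rw [Finset.sum_sub_distrib, Finset.sum_range_succ' (fun m ↦ (-1 : ℝ) ^ m * e m)]
      simp_rw [pow_succ]
      simp only [mul_neg, mul_one, neg_mul, Finset.sum_neg_distrib, pow_zero, one_mul]
      ring
    rw [Nat.succ_eq_add_one, hsplit, he0]
    have h1 := abs_le.1 (hpart J)
    have h2 := abs_le.1 (hpart (J + 1))
    have h3 : 2 * C * Z / w ^ 2 = C / w ^ 2 * Z + C / w ^ 2 * Z := by ring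
    rw [h3, abs_le]
    constructor <;> linarith
  have hc : |∑ m ∈ Finset.range K, (-1 : ℝ) ^ m *
        ∫ v in (u m)..(u (m + 1)), t * sin (t * v) * mertensError v| ≤ I / w ^ 2 := by
    have hintg : ∀ a b : ℝ, 0 ≤ a → 0 ≤ b →
        IntervalIntegrable (fun v ↦ |v * mertensError v|) volume a b := fun a b ha hb ↦
      (intervalIntegrable_iff.2 (hI.mono_set fun x hx ↦ (le_min ha hb).trans_lt hx.1)).abs
    calc _ ≤ ∑ m ∈ Finset.range K, t ^ 2 * ∫ v in (u m)..(u (m + 1)), |v * mertensError v| := by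
          refine (Finset.abs_sum_le_sum_abs _ _).trans (Finset.sum_le_sum fun m _ ↦ ?_)
          rw [abs_mul, abs_pow, abs_neg, abs_one, one_pow, one_mul,
            ← intervalIntegral.integral_const_mul]
          refine intervalIntegral.norm_integral_le_of_norm_le (μ := volume)
            (f := fun v ↦ t * sin (t * v) * mertensError v) (g := fun v ↦ t ^ 2 * |v * mertensError v|) (hum m)
            (Eventually.of_forall fun v hv ↦ ?_) ((hintg _ _ (hu0 _) (hu0 _)).const_mul _)
          have h1 := abs_sin_le_abs (x := t * v)
          rw [norm_mul, norm_mul, abs_mul, ← sq_abs t]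
          simp only [Real.norm_eq_abs]
          rw [abs_mul] at h1
          calc |t| * |sin (t * v)| * |mertensError v| ≤ |t| * (|t| * |v|) * |mertensError v| := by
                gcongr
            _ = _ := by ring
      _ = t ^ 2 * ∫ v in (u 0)..(u K), |v * mertensError v| := by
          rw [← Finset.mul_sum, intervalIntegral.sum_integral_adjacent_intervals
            fun k _ ↦ hintg _ _ (hu0 _) (hu0 _)]
      _ ≤ (1 / w) ^ 2 * I := by
          have h1 : u 0 = 0 := by simp [hu]
          rw [h1, intervalIntegral.integral_of_le (hu0 K), ← sq_abs t]
          have h2 : ∫ v in Set.Ioc 0 (u K), |v * mertensError v| ≤ I :=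
            setIntegral_mono_set hI.abs (Eventually.of_forall fun v ↦ abs_nonneg _)
              (Eventually.of_forall fun v hv ↦ hv.1)
          exact mul_le_mul (by gcongr) h2 (integral_nonneg fun v ↦ abs_nonneg _) (by positivity)
      _ = _ := by ring
  have h1 : (2 * C * Z + I + 1) / w ^ 2 = 2 * C * Z / w ^ 2 + I / w ^ 2 + 1 / w ^ 2 := by ring
  have h2 : 0 < 1 / w ^ 2 := by positivity
  rw [abs_le] at hb hc
  rw [hdec, h1, abs_le]
  constructor <;> linarith

end Alternating

section LowerBound
open Filter Topology MeasureTheory Real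

/-- The sign of `sin (v / w)`, as a left-continuous function of `v`. -/
noncomputable def altSign (w v : ℝ) : ℝ := (-1) ^ (⌈v / (w * π)⌉₊ + 1)

lemma altSign_of_mem {w v : ℝ} (hw : 0 < w) {m : ℕ} (h1 : w * (π * m) < v)
    (h2 : v ≤ w * (π * (m + 1))) : altSign w v = (-1) ^ m := by
  have hpi := pi_pos
  have h : ⌈v / (w * π)⌉₊ = m + 1 := by
    rw [Nat.ceil_eq_iff (by omega)]
    rw [lt_div_iff₀ (by positivity), div_le_iff₀ (by positivity)]
    push_cast
    constructor <;> linarith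
  rw [altSign, h, pow_add]
  simp [pow_succ]

lemma abs_altSign (w v : ℝ) : |altSign w v| = 1 := by
  rw [altSign, abs_pow, abs_neg, abs_one, one_pow]

lemma exists_mem_window {w v : ℝ} (hw : 0 < w) (hv : 0 < v) :
    ∃ m : ℕ, w * (π * m) < v ∧ v ≤ w * (π * (m + 1)) := by
  have hpi := pi_pos
  have hq : 0 < v / (w * π) := by positivity
  obtain ⟨m, hm⟩ := Nat.exists_eq_succ_of_ne_zero (Nat.ceil_pos.2 hq).ne'
  have h := (Nat.ceil_eq_iff (Nat.succ_ne_zero m)).1 hm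
  rw [lt_div_iff₀ (by positivity), div_le_iff₀ (by positivity)] at h
  push_cast at h
  exact ⟨m, by linarith, by linarith⟩

lemma altSign_mul_sin {w v : ℝ} (hw : 0 < w) (hv : 0 ≤ v) :
    altSign w v * sin (v / w) = |sin (v / w)| := by
  rcases hv.eq_or_lt with rfl | hv
  · simp
  obtain ⟨m, h1, h2⟩ := exists_mem_window hw hv
  rw [altSign_of_mem hw h1 h2]
  have h3 : sin (v / w - m * π) = (-1) ^ m * sin (v / w) := sin_sub_nat_mul_pi _ m
  have h4 : 0 ≤ sin (v / w - m * π) := by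
    refine sin_nonneg_of_nonneg_of_le_pi ?_ ?_
    · rw [sub_nonneg, le_div_iff₀ hw]
      linarith
    · rw [sub_le_iff_le_add, div_le_iff₀ hw]
      linarith
  rw [h3] at h4
  rw [← abs_of_nonneg h4, abs_mul, abs_pow, abs_neg, abs_one, one_pow, one_mul]

lemma mul_logSum_sub {b b' : ℕ → ℝ} {c u v : ℝ} (huv : u ≤ v)
    (h : ∀ n : ℕ, u < log n → log n ≤ v → c * b n = b' n) :
    c * (logSum b v - logSum b u) = logSum b' v - logSum b' u := by
  rw [logSum_eq_sum_ite b huv, logSum_eq_sum_ite b' huv, logSum, logSum,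
    ← Finset.sum_sub_distrib, ← Finset.sum_sub_distrib, Finset.mul_sum]
  refine Finset.sum_congr rfl fun n hn ↦ ?_
  rw [mem_Icc_floor_exp] at hn
  split_ifs with h1
  · simp
  · rw [sub_zero, sub_zero, h n (not_le.1 h1) hn.2]

lemma sum_neg_one_pow_mul_logSum_sub {w : ℝ} (hw : 0 < w) (φ : ℕ → ℝ) (K : ℕ) :
    ∑ m ∈ Finset.range K, (-1 : ℝ) ^ m * (logSum (fun n ↦ logCoeff n / n * φ n) (w * (π * (m + 1)))
      - logSum (fun n ↦ logCoeff n / n * φ n) (w * (π * m))) =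
      logSum (fun n ↦ logCoeff n / n * (altSign w (log n) * φ n)) (w * (π * K)) := by
  have hpi := pi_pos
  induction K with
  | zero => simp [logSum_logCoeff_zero]
  | succ K ih =>
    have h0 : w * (π * K) ≤ w * (π * (K + 1)) := by gcongr; simp
    rw [Finset.sum_range_succ, ih, mul_logSum_sub
      (b' := fun n ↦ logCoeff n / n * (altSign w (log n) * φ n)) h0]
    · push_cast
      ring
    · intro n h1 h2
      rw [altSign_of_mem hw h1 h2]
      ring

lemma altSum_eq_logSum {w : ℝ} (hw : 0 < w) (t : ℝ) (K : ℕ) :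
    altSum w t K = logSum (fun n ↦ logCoeff n / n * (altSign w (log n) * cos (t * log n)))
      (w * (π * K)) :=
  sum_neg_one_pow_mul_logSum_sub hw _ K

lemma integral_cos_mul (x a b : ℝ) (hx : x ≠ 0) :
    ∫ t in a..b, cos (t * x) = (sin (b * x) - sin (a * x)) / x := by
  rw [intervalIntegral.integral_comp_mul_right (fun y ↦ cos y) hx, integral_cos, smul_eq_mul]
  ring

lemma integral_altSum {w : ℝ} (hw : 0 < w) (K : ℕ) :
    ∫ t in (-(1 / w))..(1 / w), altSum w t K =
      2 * logSum (fun n ↦ logCoeff n / n * (|sin (log n / w)| / log n)) (w * (π * K)) := by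
  simp_rw [altSum_eq_logSum hw, logSum]
  rw [intervalIntegral.integral_finsetSum fun n _ ↦
    (by fun_prop : Continuous _).intervalIntegrable _ _, Finset.mul_sum]
  refine Finset.sum_congr rfl fun n hn ↦ ?_
  rw [mem_Icc_floor_exp] at hn
  rcases hn.1.eq_or_lt with rfl | h1
  · simp [logCoeff_one]
  have hl : 0 < log n := log_pos (by exact_mod_cast h1)
  rw [intervalIntegral.integral_const_mul, intervalIntegral.integral_const_mul,
    integral_cos_mul _ _ _ hl.ne', ← altSign_mul_sin hw hl.le, neg_mul, sin_neg,
    show 1 / w * log n = log n / w by ring]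
  ring

lemma integral_mainTerm_comp {w : ℝ} (hw : 0 < w) (K : ℕ) :
    ∫ t in (-(1 / w))..(1 / w), mainTerm K (w * t) = 2 / w * ∫ τ in (0 : ℝ)..1, mainTerm K τ := by
  have hc : Continuous (mainTerm K) :=
    continuous_iff_continuousAt.2 fun τ ↦ (hasDerivAt_mainTerm K τ).continuousAt
  rw [intervalIntegral.integral_comp_mul_left (fun τ ↦ mainTerm K τ) hw.ne', mul_neg,
    mul_one_div_cancel hw.ne', ← intervalIntegral.integral_add_adjacent_intervals
    (hc.intervalIntegrable (-1) 0) (hc.intervalIntegrable 0 1)]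
  have h : ∫ τ in (-1 : ℝ)..0, mainTerm K τ = ∫ τ in (0 : ℝ)..1, mainTerm K τ := by
    have := intervalIntegral.integral_comp_neg (a := (0 : ℝ)) (b := 1) (mainTerm K)
    rw [neg_zero] at this
    rw [← this]
    simp_rw [mainTerm_neg]
  rw [h, smul_eq_mul]
  ring

/-- The mean of `log |ζ|` over windows of length `2 / w` is bounded by the Mertens type sums
weighted by the Fejér-like kernel. -/
lemma exists_logSum_abs_sin_le : ∃ C > 0, ∀ w : ℝ, 2 ≤ w → ∀ u : ℝ,
    w * logSum (fun n ↦ logCoeff n / n * (|sin (log n / w)| / log n)) u ≤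
      eulerMascheroniConstant + log (2 * w) + C / w ^ 2 := by
  obtain ⟨C, hC, h⟩ := exists_abs_altSum_sub_le
  have hpi := pi_pos
  refine ⟨C, hC, fun w hw u ↦ ?_⟩
  have hw0 : 0 < w := by linarith
  have hmono : Monotone (logSum fun n ↦ logCoeff n / n * (|sin (log n / w)| / log n)) :=
    logSum_mono fun n ↦ mul_nonneg (div_nonneg (logCoeff_nonneg n) n.cast_nonneg)
      (div_nonneg (abs_nonneg _) (log_natCast_nonneg n))
  have hlim := (tendsto_integral_mainTerm.const_add
    (eulerMascheroniConstant + log (w * π) + C / w ^ 2))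
  have hval : eulerMascheroniConstant + log (w * π) + C / w ^ 2 + log (2 / π) =
      eulerMascheroniConstant + log (2 * w) + C / w ^ 2 := by
    have : log (2 * w) = log (w * π) + log (2 / π) := by
      rw [← log_mul (by positivity) (by positivity)]
      congr 1
      field_simp
    rw [this]
    ring
  rw [hval] at hlim
  refine ge_of_tendsto hlim ?_
  filter_upwards [eventually_ge_atTop ⌈u⌉₊] with j hj
  set K := 2 * j + 1 with hK
  have hu : u ≤ w * (π * K) := by
    have h1 : u ≤ j := (Nat.le_ceil u).trans (by exact_mod_cast hj)
    have h2 : (j : ℝ) ≤ K := by exact_mod_cast (by omega : j ≤ K)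
    have h3 : (0 : ℝ) ≤ K := K.cast_nonneg
    nlinarith [mul_nonneg hpi.le h3, mul_nonneg (sub_nonneg.2 hw) (mul_nonneg hpi.le h3),
      mul_nonneg (sub_nonneg.2 pi_gt_three.le) h3]
  have hc : Continuous (mainTerm K) :=
    continuous_iff_continuousAt.2 fun τ ↦ (hasDerivAt_mainTerm K τ).continuousAt
  have hca : Continuous fun t ↦ altSum w t K := by
    simp_rw [altSum_eq_logSum hw0, logSum]
    fun_prop
  have hle : (-(1 / w)) ≤ 1 / w := by
    have : 0 < 1 / w := by positivity
    linarith
  have h1 : ∫ t in (-(1 / w))..(1 / w), altSum w t K ≤ ∫ t in (-(1 / w))..(1 / w),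
      ((eulerMascheroniConstant + log (w * π) + C / w ^ 2) + mainTerm K (w * t)) := by
    refine intervalIntegral.integral_mono_on hle (hca.intervalIntegrable _ _)
      ((by fun_prop : Continuous _).intervalIntegrable _ _) fun t ht ↦ ?_
    have := (abs_le.1 (h w t K hw (abs_le.2 ⟨ht.1, ht.2⟩) (by omega))).2
    linarith
  rw [integral_altSum hw0, intervalIntegral.integral_add intervalIntegrable_const
    ((by fun_prop : Continuous _).intervalIntegrable _ _), integral_mainTerm_comp hw0,
    intervalIntegral.integral_const, smul_eq_mul] at h1
  have h2 := hmono hu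
  have h3 : w * logSum (fun n ↦ logCoeff n / n * (|sin (log n / w)| / log n)) (w * (π * K)) ≤
      (eulerMascheroniConstant + log (w * π) + C / w ^ 2) + ∫ τ in (0 : ℝ)..1, mainTerm K τ := by
    have := mul_le_mul_of_nonneg_left h1 (by positivity : 0 ≤ w / 2)
    have e1 : w / 2 * ((1 / w - -(1 / w)) *
        (eulerMascheroniConstant + log (w * π) + C / w ^ 2) +
        2 / w * ∫ τ in (0 : ℝ)..1, mainTerm K τ) = (eulerMascheroniConstant + log (w * π) +
        C / w ^ 2) + ∫ τ in (0 : ℝ)..1, mainTerm K τ := by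
      field_simp
      ring
    rw [e1] at this
    linarith
  exact (mul_le_mul_of_nonneg_left h2 hw0.le).trans h3

lemma continuous_log_norm_zeta {η : ℝ} (hη : 0 < η) :
    Continuous fun t : ℝ ↦ log ‖riemannZeta (1 + η + t * Complex.I)‖ := by
  refine Continuous.log (Continuous.norm ?_) fun t ↦ ?_
  · refine continuous_iff_continuousAt.2 fun t ↦ ?_
    refine ContinuousAt.comp (f := fun t : ℝ ↦ (1 + η + t * Complex.I : ℂ)) (g := riemannZeta)
      (differentiableAt_riemannZeta ?_).continuousAt (by fun_prop)
    intro h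
    have := congrArg Complex.re h
    simp at this
    linarith
  · rw [norm_ne_zero_iff]
    exact riemannZeta_ne_zero_of_one_le_re (by simp; linarith)

lemma exists_integral_log_norm_zeta_le : ∃ C > 0, ∀ w : ℝ, 2 ≤ w → ∀ η > 0, ∀ T : ℝ,
    w / 2 * ∫ t in T..(T + 2 / w), log ‖riemannZeta (1 + (η : ℝ) + t * Complex.I)‖ ≤
      eulerMascheroniConstant + log (2 * w) + C / w ^ 2 := by
  obtain ⟨C, hC, h⟩ := exists_logSum_abs_sin_le
  refine ⟨C, hC, fun w hw η hη T ↦ ?_⟩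
  have hw0 : 0 < w := by linarith
  have hTT : T ≤ T + 2 / w := by
    have : 0 < 2 / w := by positivity
    linarith
  set a : ℕ → ℝ := fun n ↦ logCoeff n / n with ha
  have ha0 : ∀ n, 0 ≤ a n := fun n ↦ div_nonneg (logCoeff_nonneg n) n.cast_nonneg
  set E : ℕ → ℝ := fun n ↦ exp (-(η * log n)) with hE
  have hE1 : ∀ n, E n ≤ 1 := fun n ↦ exp_le_one_iff.2 (by
    have := log_natCast_nonneg n
    nlinarith [mul_nonneg hη.le this])
  have hsum : Summable fun n ↦ a n * E n := by
    have := (hasSum_log_norm_riemannZeta hη 0).summable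
    simpa using this
  have hintg := intervalIntegral.hasSum_integral_of_dominated_convergence (μ := volume) (a := T)
    (b := T + 2 / w) (F := fun n t ↦ a n * (E n * cos (t * log n)))
    (f := fun t ↦ log ‖riemannZeta (1 + (η : ℝ) + t * Complex.I)‖) (fun n _ ↦ a n * E n)
    (fun n ↦ (by fun_prop : Continuous _).aestronglyMeasurable)
    (fun n ↦ Eventually.of_forall fun t _ ↦ by
      rw [← mul_assoc, norm_mul, Real.norm_of_nonneg (mul_nonneg (ha0 n) (exp_pos _).le)]
      exact mul_le_of_le_one_right (mul_nonneg (ha0 n) (exp_pos _).le) (abs_cos_le_one _))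
    (Eventually.of_forall fun t _ ↦ hsum) intervalIntegrable_const
    (Eventually.of_forall fun t _ ↦ hasSum_log_norm_riemannZeta hη t)
  have hlim := (tendsto_logSum (by simp [ha]) hintg).const_mul (w / 2)
  refine le_of_tendsto' hlim fun u ↦ ?_
  refine le_trans ?_ (h w hw u)
  rw [logSum, logSum, Finset.mul_sum, Finset.mul_sum]
  refine Finset.sum_le_sum fun n hn ↦ ?_
  rw [mem_Icc_floor_exp] at hn
  rcases hn.1.eq_or_lt with rfl | h1
  · simp [ha, logCoeff_one]
  have hl : 0 < log n := log_pos (by exact_mod_cast h1)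
  rw [intervalIntegral.integral_const_mul, intervalIntegral.integral_const_mul,
    integral_cos_mul _ _ _ hl.ne', Real.sin_sub_sin]
  have e1 : ((T + 2 / w) * log n - T * log n) / 2 = log n / w := by ring
  rw [e1]
  set c := cos (((T + 2 / w) * log n + T * log n) / 2)
  have h2 : sin (log n / w) * c ≤ |sin (log n / w)| := by
    refine (le_abs_self _).trans ?_
    rw [abs_mul]
    exact mul_le_of_le_one_right (abs_nonneg _) (abs_cos_le_one _)
  calc w / 2 * (a n * (E n * (2 * sin (log n / w) * c / log n))) =
        w * a n * (E n * (sin (log n / w) * c / log n)) := by ring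
    _ ≤ w * a n * (1 * (|sin (log n / w)| / log n)) := by
        have := ha0 n
        refine mul_le_mul_of_nonneg_left ?_ (by positivity)
        calc E n * (sin (log n / w) * c / log n) ≤ E n * (|sin (log n / w)| / log n) := by
              have := (exp_pos (-(η * log n))).le
              gcongr
          _ ≤ _ := by
              gcongr
              exact hE1 n
    _ = _ := by ring

/-- The modulus of `1 / ζ`, extended continuously to `s = 1`. -/
noncomputable def invNorm (s : ℂ) : ℝ := ‖s - 1‖ / ‖zetaOne s‖

lemma invNorm_of_ne {s : ℂ} (hs : s ≠ 1) : invNorm s = ‖riemannZeta s‖⁻¹ := by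
  have : s - 1 ≠ 0 := sub_ne_zero.2 hs
  rw [invNorm, zetaOne_of_ne hs, norm_mul]
  field_simp

lemma invNorm_nonneg (s : ℂ) : 0 ≤ invNorm s := by unfold invNorm; positivity

lemma continuousOn_invNorm : ContinuousOn invNorm {s | 1 ≤ s.re} :=
  ((continuous_id.sub continuous_const).norm.continuousOn).div
    differentiable_zetaOne.continuous.norm.continuousOn fun _ hs ↦
      norm_ne_zero_iff.2 (zetaOne_ne_zero hs)

lemma exp_mean_log_le {f : ℝ → ℝ} (hf : Continuous f) {a b : ℝ} (hab : a < b) :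
    exp ((b - a)⁻¹ * ∫ t in a..b, f t) ≤ (b - a)⁻¹ * ∫ t in a..b, exp (f t) := by
  have hba : 0 < b - a := by linarith
  set m := (b - a)⁻¹ * ∫ t in a..b, f t with hm
  have hm' : ∫ t in a..b, f t = (b - a) * m := by rw [hm, mul_inv_cancel_left₀ hba.ne']
  have h1 : ∫ t in a..b, exp m * (1 + (f t - m)) ≤ ∫ t in a..b, exp (f t) := by
    refine intervalIntegral.integral_mono_on hab.le
      ((by fun_prop : Continuous _).intervalIntegrable _ _)
      ((by fun_prop : Continuous _).intervalIntegrable _ _) fun t _ ↦ ?_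
    have h2 := add_one_le_exp (f t - m)
    calc exp m * (1 + (f t - m)) ≤ exp m * exp (f t - m) := by
          gcongr
          linarith
      _ = _ := by rw [← exp_add]; ring_nf
  rw [intervalIntegral.integral_const_mul, intervalIntegral.integral_add intervalIntegrable_const
    ((by fun_prop : Continuous _).intervalIntegrable _ _), intervalIntegral.integral_sub
    (hf.intervalIntegrable _ _) intervalIntegrable_const, hm'] at h1
  simp only [intervalIntegral.integral_const, smul_eq_mul] at h1
  rw [le_inv_mul_iff₀ hba]
  linarith

theorem exists_le_mean_invNorm : ∃ C > 0, ∀ δ : ℝ, 0 < δ → δ ≤ 1 → ∀ p : ℝ, 0 < p → ∀ T : ℝ,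
    exp (-eulerMascheroniConstant) / 4 * δ * exp (-(C * δ ^ 2)) ≤
      ((1 / δ) * ∫ t in T..(T + δ), invNorm (1 + (t : ℝ) * Complex.I) ^ p) ^ (1 / p) := by
  obtain ⟨C, hC, h⟩ := exists_integral_log_norm_zeta_le
  refine ⟨C, hC, fun δ hδ hδ1 p hp T ↦ ?_⟩
  set w := 2 / δ with hw
  have hw0 : 0 < w := by positivity
  have hw2 : 2 ≤ w := by rw [hw, le_div_iff₀ hδ]; linarith
  have hwδ : 2 / w = δ := by rw [hw]; field_simp
  set B := eulerMascheroniConstant + log (2 * w) + C / w ^ 2 with hB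
  have hBval : exp (-eulerMascheroniConstant) / 4 * δ * exp (-(C * δ ^ 2)) ≤ exp (-B) := by
    have e1 : log (2 * w) = -log (δ / 4) := by
      rw [← log_inv]
      congr 1
      rw [hw]
      field_simp
      norm_num
    have e2 : C / w ^ 2 ≤ C * δ ^ 2 := by
      rw [hw, div_pow, div_div_eq_mul_div]
      have : 0 < C * δ ^ 2 := by positivity
      linarith
    calc _ = exp (-eulerMascheroniConstant) * exp (log (δ / 4)) * exp (-(C * δ ^ 2)) := by
          rw [exp_log (by positivity)]
          ring
      _ = exp (-eulerMascheroniConstant + log (δ / 4) - C * δ ^ 2) := by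
          rw [← exp_add, ← exp_add]
          ring_nf
      _ ≤ _ := by
          rw [exp_le_exp, hB, e1]
          linarith
  have hη : ∀ η : ℝ, 0 < η → exp (-B) ^ p ≤
      (1 / δ) * ∫ t in T..(T + δ), invNorm (1 + (|η| : ℝ) + (t : ℝ) * Complex.I) ^ p := by
    intro η hη
    have h1 := h w hw2 η hη T
    rw [hwδ] at h1
    have hcont := continuous_log_norm_zeta hη
    have h2 := exp_mean_log_le (f := fun t ↦
      -p * log ‖riemannZeta (1 + (η : ℝ) + t * Complex.I)‖) (by fun_prop)
      (by linarith : T < T + δ)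
    rw [add_sub_cancel_left, intervalIntegral.integral_const_mul] at h2
    have h3 : ∀ t : ℝ, exp (-p * log ‖riemannZeta (1 + (η : ℝ) + t * Complex.I)‖) =
        invNorm (1 + (|η| : ℝ) + (t : ℝ) * Complex.I) ^ p := by
      intro t
      have hne : (1 + (η : ℂ) + t * Complex.I) ≠ 1 := by
        intro h
        have := congrArg Complex.re h
        simp at this
        linarith
      have hz : 0 < ‖riemannZeta (1 + (η : ℝ) + t * Complex.I)‖ := norm_pos_iff.2
        (riemannZeta_ne_zero_of_one_le_re (by simp; linarith))
      rw [abs_of_pos hη, invNorm_of_ne hne, inv_rpow hz.le, ← rpow_neg hz.le, rpow_def_of_pos hz]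
      ring_nf
    simp_rw [h3] at h2
    rw [one_div]
    refine le_trans ?_ h2
    rw [← exp_mul, exp_le_exp]
    have : w / 2 = δ⁻¹ := by rw [hw]; field_simp
    rw [this] at h1
    nlinarith
  have hcont : Continuous fun q : ℝ × ℝ ↦ invNorm (1 + (|q.1| : ℝ) + q.2 * Complex.I) ^ p := by
    refine Continuous.rpow_const ?_ fun _ ↦ Or.inr hp.le
    refine continuousOn_invNorm.comp_continuous
      (f := fun q : ℝ × ℝ ↦ (1 + (|q.1| : ℝ) + q.2 * Complex.I : ℂ)) ?_ fun q ↦ ?_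
    · exact (continuous_const.add (Complex.continuous_ofReal.comp
        (continuous_abs.comp continuous_fst))).add
        ((Complex.continuous_ofReal.comp continuous_snd).mul continuous_const)
    · simp
  have hci : Continuous fun η : ℝ ↦
      (1 / δ) * ∫ t in T..(T + δ), invNorm (1 + (|η| : ℝ) + (t : ℝ) * Complex.I) ^ p :=
    continuous_const.mul (intervalIntegral.continuous_parametric_intervalIntegral_of_continuous'
      (f := fun η t ↦ invNorm (1 + (|η| : ℝ) + (t : ℝ) * Complex.I) ^ p) hcont _ _)
  have h0 : exp (-B) ^ p ≤ (1 / δ) * ∫ t in T..(T + δ), invNorm (1 + (t : ℝ) * Complex.I) ^ p := by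
    have hlim : Tendsto (fun η : ℝ ↦ (1 / δ) * ∫ t in T..(T + δ),
        invNorm (1 + (|η| : ℝ) + (t : ℝ) * Complex.I) ^ p) (𝓝[>] 0) _ :=
      (hci.tendsto 0).mono_left nhdsWithin_le_nhds
    have := ge_of_tendsto hlim (eventually_mem_nhdsWithin.mono fun η hη' ↦ hη η hη')
    simpa using this
  refine hBval.trans ?_
  calc exp (-B) = (exp (-B) ^ p) ^ (1 / p) := by
        rw [one_div, rpow_rpow_inv (exp_pos _).le hp.ne']
    _ ≤ _ := rpow_le_rpow (by positivity) h0 (by positivity)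

end LowerBound

section MeanSquare
open Filter Topology MeasureTheory Real

/-- The character `T ↦ n ^ (-iT)`. -/
noncomputable def osc (n : ℕ) (T : ℝ) : ℂ := Complex.exp (-(T * Real.log n : ℝ) * Complex.I)

lemma norm_osc (n : ℕ) (T : ℝ) : ‖osc n T‖ = 1 := by
  rw [osc, ← Complex.ofReal_neg, Complex.norm_exp_ofReal_mul_I]

lemma osc_mul {m n : ℕ} (hm : m ≠ 0) (hn : n ≠ 0) (T : ℝ) :
    osc (m * n) T = osc m T * osc n T := by
  rw [osc, osc, osc, ← Complex.exp_add]
  congr 1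
  push_cast
  rw [Real.log_mul (by exact_mod_cast hm) (by exact_mod_cast hn)]
  push_cast
  ring

lemma osc_add (n : ℕ) (S T : ℝ) : osc n (S + T) = osc n S * osc n T := by
  rw [osc, osc, osc, ← Complex.exp_add]
  congr 1
  push_cast
  ring

lemma osc_one (T : ℝ) : osc 1 T = 1 := by simp [osc]

lemma osc_pow {n : ℕ} (hn : n ≠ 0) (j : ℕ) (T : ℝ) : osc (n ^ j) T = osc n T ^ j := by
  induction j with
  | zero => simp [osc_one]
  | succ j ih => rw [pow_succ, osc_mul (pow_ne_zero _ hn) hn, ih, pow_succ]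

@[fun_prop]
lemma continuous_osc (n : ℕ) : Continuous (osc n) := by
  unfold osc
  fun_prop

lemma norm_integral_osc_mul_conj_le {m n : ℕ} (hm : 1 ≤ m) (hmn : m < n) (X : ℝ) :
    ‖∫ T in (0 : ℝ)..X, osc m T * (starRingEnd ℂ) (osc n T)‖ ≤ 2 * (n / (n - m : ℕ)) ∧
    ‖∫ T in (0 : ℝ)..X, osc n T * (starRingEnd ℂ) (osc m T)‖ ≤ 2 * (n / (n - m : ℕ)) := by
  have hm0 : (0 : ℝ) < m := by exact_mod_cast hm
  have hmn' : (m : ℝ) < n := by exact_mod_cast hmn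
  have hn0 : (0 : ℝ) < n := hm0.trans hmn'
  have hl : ((n - m : ℕ) : ℝ) / n ≤ log n - log m := by
    rw [Nat.cast_sub hmn.le, ← log_div hn0.ne' hm0.ne']
    have := one_sub_inv_le_log_of_pos (div_pos hn0 hm0)
    rw [inv_div] at this
    rw [sub_div, div_self hn0.ne']
    exact this
  have hd : (0 : ℝ) < ((n - m : ℕ) : ℝ) := by exact_mod_cast Nat.sub_pos_of_lt hmn
  have hl0 : 0 < log n - log m := (div_pos hd hn0).trans_le hl
  have key : ∀ x : ℝ, |x| = log n - log m →
      ‖∫ T in (0 : ℝ)..X, Complex.exp ((x * Complex.I) * T)‖ ≤ 2 * (n / (n - m : ℕ)) := by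
    intro x hx
    have hx0 : x ≠ 0 := by
      intro h
      rw [h, abs_zero] at hx
      linarith
    have hxI : (x * Complex.I : ℂ) ≠ 0 := mul_ne_zero (by exact_mod_cast hx0) Complex.I_ne_zero
    rw [integral_exp_mul_complex hxI, norm_div, norm_mul, Complex.norm_I, mul_one,
      Complex.norm_real, Real.norm_eq_abs, hx, div_le_iff₀ hl0]
    have h1 : ∀ y : ℝ, ‖Complex.exp (x * Complex.I * y)‖ = 1 := fun y ↦ by
      rw [show (x * Complex.I * y : ℂ) = ((x * y : ℝ) : ℂ) * Complex.I by push_cast; ring,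
        Complex.norm_exp_ofReal_mul_I]
    calc _ ≤ (1 : ℝ) + 1 := by
          refine (norm_sub_le _ _).trans ?_
          rw [h1, h1]
      _ = 2 * (n / (n - m : ℕ)) * (((n - m : ℕ) : ℝ) / n) := by field_simp; norm_num
      _ ≤ _ := by gcongr
  have conj_osc : ∀ (k l : ℕ) (T : ℝ), osc k T * (starRingEnd ℂ) (osc l T) =
      Complex.exp ((((log l - log k : ℝ) : ℂ) * Complex.I) * T) := by
    intro k l T
    rw [osc, osc, ← Complex.exp_conj, ← Complex.exp_add]
    congr 1
    simp only [map_mul, map_neg, Complex.conj_ofReal, Complex.conj_I]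
    push_cast
    ring
  simp_rw [conj_osc]
  exact ⟨key _ (abs_of_pos hl0), key _ (by rw [abs_sub_comm]; exact abs_of_pos hl0)⟩

lemma summable_rpow_neg {σ : ℝ} (hσ : 0 < σ) : Summable fun n : ℕ ↦ (n : ℝ) ^ (-(1 + σ)) :=
  Real.summable_nat_rpow.2 (by linarith)

/-- The real zeta values `ζ(1 + σ)`. -/
noncomputable def zetaSum (σ : ℝ) : ℝ := ∑' n : ℕ, (n : ℝ) ^ (-(1 + σ))

lemma zetaSum_nonneg (σ : ℝ) : 0 ≤ zetaSum σ := tsum_nonneg fun n ↦ by positivity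

lemma sum_rpow_le_zetaSum {ι : Type*} {σ : ℝ} (hσ : 0 < σ) (s : Finset ι) (f : ι → ℕ)
    (hf : Set.InjOn f s) : ∑ i ∈ s, (f i : ℝ) ^ (-(1 + σ)) ≤ zetaSum σ := by
  classical
  rw [← Finset.sum_image (f := fun n : ℕ ↦ (n : ℝ) ^ (-(1 + σ))) hf]
  exact (summable_rpow_neg hσ).sum_le_tsum _ fun n _ ↦ by positivity

lemma eventually_zetaSum_le : ∀ᶠ σ in 𝓝[>] (0 : ℝ), zetaSum σ ≤ 2 / σ := by
  have h1 : Tendsto (fun σ : ℝ ↦ 1 + σ) (𝓝[>] 0) (𝓝[>] 1) := by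
    refine tendsto_nhdsWithin_iff.2 ⟨?_, ?_⟩
    · have : Tendsto (fun σ : ℝ ↦ 1 + σ) (𝓝 0) (𝓝 (1 + 0)) :=
        (continuous_const.add continuous_id).tendsto 0
      rw [add_zero] at this
      exact this.mono_left nhdsWithin_le_nhds
    · filter_upwards [self_mem_nhdsWithin] with σ hσ
      simp only [Set.mem_Ioi] at hσ ⊢
      linarith
  filter_upwards [(tendsto_sub_mul_tsum_nat_rpow.comp h1).eventually_le_const
    (by norm_num : (1 : ℝ) < 2), self_mem_nhdsWithin] with σ hσ hσ0
  rw [le_div_iff₀ hσ0, mul_comm]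
  refine le_trans (le_of_eq ?_) hσ
  simp only [Function.comp_apply, add_sub_cancel_left, zetaSum, one_div]
  congr 1
  refine tsum_congr fun n ↦ ?_
  rw [rpow_neg n.cast_nonneg]

lemma offDiag_bound {σ C : ℝ} (hσ : 0 < σ) {m n : ℕ} (hm : 1 ≤ m) (hmn : m < n) {x y : ℝ}
    (hx0 : 0 ≤ x) (hx : x ≤ C * (m : ℝ) ^ (-(1 + σ)))
    (hy0 : 0 ≤ y) (hy : y ≤ C * (n : ℝ) ^ (-(1 + σ))) :
    x * y * (2 * (n / (n - m : ℕ))) ≤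
      2 * C ^ 2 * ((m : ℝ) ^ (-(1 + σ)) * ((n - m : ℕ) : ℝ) ^ (-(1 + σ))) := by
  have hn0 : (0 : ℝ) < n := by exact_mod_cast Nat.zero_lt_of_lt hmn
  have hd : (0 : ℝ) < ((n - m : ℕ) : ℝ) := by exact_mod_cast Nat.sub_pos_of_lt hmn
  have hdn : ((n - m : ℕ) : ℝ) ≤ n := by exact_mod_cast Nat.sub_le n m
  calc x * y * (2 * (n / (n - m : ℕ))) ≤
        (C * (m : ℝ) ^ (-(1 + σ))) * (C * (n : ℝ) ^ (-(1 + σ))) * (2 * (n / (n - m : ℕ))) := by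
        gcongr
        exact hx0.trans hx
    _ = 2 * C ^ 2 * ((m : ℝ) ^ (-(1 + σ)) * ((n : ℝ) ^ (-σ) * ((n - m : ℕ) : ℝ)⁻¹)) := by
        have : (n : ℝ) ^ (-(1 + σ)) = (n : ℝ)⁻¹ * (n : ℝ) ^ (-σ) := by
          rw [neg_add, rpow_add hn0, rpow_neg_one]
        rw [this]
        field_simp
    _ ≤ _ := by
        have : ((n - m : ℕ) : ℝ) ^ (-(1 + σ)) =
            ((n - m : ℕ) : ℝ) ^ (-σ) * ((n - m : ℕ) : ℝ)⁻¹ := by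
          rw [neg_add_rev, rpow_add hd, rpow_neg_one]
        rw [this]
        gcongr 2 * C ^ 2 * (_ * (?_ * _))
        exact rpow_le_rpow_of_nonpos hd hdn (by linarith)

/-- A Montgomery-Vaughan type mean value estimate. -/
lemma abs_integral_norm_sq_sub_le {ι : Type*} (s : Finset ι) (c : ι → ℂ) (f : ι → ℕ)
    (hf : ∀ i ∈ s, 1 ≤ f i) (hinj : Set.InjOn f s) {C σ X : ℝ} (hσ : 0 < σ)
    (hc : ∀ i ∈ s, ‖c i‖ ≤ C * (f i : ℝ) ^ (-(1 + σ))) :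
    |(∫ T in (0 : ℝ)..X, ‖∑ i ∈ s, c i * osc (f i) T‖ ^ 2) - X * ∑ i ∈ s, ‖c i‖ ^ 2| ≤
      4 * C ^ 2 * zetaSum σ ^ 2 := by
  classical
  set J : ι → ι → ℂ := fun i j ↦ ∫ T in (0 : ℝ)..X, osc (f i) T * (starRingEnd ℂ) (osc (f j) T)
    with hJ
  have hexp : ((∫ T in (0 : ℝ)..X, ‖∑ i ∈ s, c i * osc (f i) T‖ ^ 2 : ℝ) : ℂ) =
      ∑ i ∈ s, ∑ j ∈ s, c i * (starRingEnd ℂ) (c j) * J i j := by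
    rw [← intervalIntegral.integral_ofReal]
    have h1 : ∀ T, ((‖∑ i ∈ s, c i * osc (f i) T‖ ^ 2 : ℝ) : ℂ) = ∑ i ∈ s, ∑ j ∈ s,
        c i * (starRingEnd ℂ) (c j) * (osc (f i) T * (starRingEnd ℂ) (osc (f j) T)) := by
      intro T
      rw [Complex.ofReal_pow, ← Complex.mul_conj', map_sum, Finset.sum_mul_sum]
      refine Finset.sum_congr rfl fun i _ ↦ Finset.sum_congr rfl fun j _ ↦ ?_
      rw [map_mul]
      ring
    have hcont : ∀ i j, Continuous fun T ↦ c i * (starRingEnd ℂ) (c j) *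
        (osc (f i) T * (starRingEnd ℂ) (osc (f j) T)) := fun i j ↦
      continuous_const.mul ((continuous_osc _).mul (Complex.continuous_conj.comp (continuous_osc _)))
    simp_rw [h1]
    rw [intervalIntegral.integral_finsetSum fun i _ ↦
      (continuous_finsetSum _ fun j _ ↦ hcont i j).intervalIntegrable _ _]
    refine Finset.sum_congr rfl fun i _ ↦ ?_
    rw [intervalIntegral.integral_finsetSum fun j _ ↦ (hcont i j).intervalIntegrable _ _]
    refine Finset.sum_congr rfl fun j _ ↦ ?_
    rw [intervalIntegral.integral_const_mul]
  have hdiag : ∀ i, J i i = X := by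
    intro i
    simp only [hJ]
    have : ∀ T, osc (f i) T * (starRingEnd ℂ) (osc (f i) T) = 1 := fun T ↦ by
      rw [Complex.mul_conj', norm_osc]; simp
    simp_rw [this]
    simp
  set u : ℕ → ℝ := fun n ↦ (n : ℝ) ^ (-(1 + σ)) with hu
  have hu0 : ∀ n, 0 ≤ u n := fun n ↦ by positivity
  have hterm : ∀ i ∈ s, ∀ j ∈ s, ‖c i * (starRingEnd ℂ) (c j) * J i j -
      if i = j then ((X * ‖c i‖ ^ 2 : ℝ) : ℂ) else 0‖ ≤
      2 * C ^ 2 * (u (f j) * u (f i - f j) + u (f i) * u (f j - f i)) := by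
    intro i hi j hj
    split_ifs with h
    · subst h
      rw [hdiag, Complex.mul_conj']
      have : (‖c i‖ : ℂ) ^ 2 * X - ((X * ‖c i‖ ^ 2 : ℝ) : ℂ) = 0 := by push_cast; ring
      rw [this, norm_zero]
      have := hu0 (f i)
      have := hu0 (f i - f i)
      positivity
    · rw [sub_zero, norm_mul, norm_mul, RCLike.norm_conj]
      have hne : f i ≠ f j := fun e ↦ h (hinj hi hj e)
      rcases hne.lt_or_gt with hlt | hlt
      · have h1 := (norm_integral_osc_mul_conj_le (hf i hi) hlt X).1
        have h2 := offDiag_bound hσ (hf i hi) hlt (norm_nonneg _) (hc i hi) (norm_nonneg _) (hc j hj)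
        have h3 : 0 ≤ 2 * C ^ 2 * (u (f j) * u (f i - f j)) := by
          have := hu0 (f j)
          have := hu0 (f i - f j)
          positivity
        calc _ ≤ ‖c i‖ * ‖c j‖ * (2 * (f j / (f j - f i : ℕ))) := by gcongr
          _ ≤ 2 * C ^ 2 * (u (f i) * u (f j - f i)) := h2
          _ ≤ _ := by rw [mul_add]; linarith
      · have h1 := (norm_integral_osc_mul_conj_le (hf j hj) hlt X).2
        have h2 := offDiag_bound hσ (hf j hj) hlt (norm_nonneg _) (hc j hj) (norm_nonneg _) (hc i hi)
        have h3 : 0 ≤ 2 * C ^ 2 * (u (f i) * u (f j - f i)) := by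
          have := hu0 (f i)
          have := hu0 (f j - f i)
          positivity
        calc _ ≤ ‖c j‖ * ‖c i‖ * (2 * (f i / (f i - f j : ℕ))) := by
              rw [mul_comm ‖c i‖]
              gcongr
          _ ≤ 2 * C ^ 2 * (u (f j) * u (f i - f j)) := h2
          _ ≤ _ := by rw [mul_add]; linarith
  have hZ1 : ∑ i ∈ s, u (f i) ≤ zetaSum σ := sum_rpow_le_zetaSum hσ s f hinj
  have hZ2 : ∀ j, ∑ i ∈ s, u (f i - f j) ≤ zetaSum σ := by
    intro j
    have h1 : ∑ i ∈ s with f j < f i, u (f i - f j) = ∑ i ∈ s, u (f i - f j) := by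
      refine Finset.sum_filter_of_ne fun i hi h ↦ ?_
      by_contra! hle
      refine h ?_
      simp only [hu, Nat.sub_eq_zero_of_le hle, Nat.cast_zero]
      exact zero_rpow (by linarith)
    rw [← h1]
    refine sum_rpow_le_zetaSum hσ _ (fun i ↦ f i - f j) fun i hi k hk h ↦ ?_
    rw [Finset.mem_coe, Finset.mem_filter] at hi hk
    simp only at h
    exact hinj hi.1 hk.1 (by omega)
  have hZ0 := zetaSum_nonneg σ
  have hdouble : ∑ i ∈ s, ∑ j ∈ s, u (f i) * u (f j - f i) ≤ zetaSum σ ^ 2 := by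
    calc _ ≤ ∑ i ∈ s, u (f i) * zetaSum σ := by
          refine Finset.sum_le_sum fun i _ ↦ ?_
          rw [← Finset.mul_sum]
          exact mul_le_mul_of_nonneg_left (hZ2 i) (hu0 _)
      _ ≤ _ := by
          rw [← Finset.sum_mul, sq]
          gcongr
  have hdouble' : ∑ i ∈ s, ∑ j ∈ s, u (f j) * u (f i - f j) ≤ zetaSum σ ^ 2 := by
    rw [Finset.sum_comm]
    exact hdouble
  have hfin : (((∫ T in (0 : ℝ)..X, ‖∑ i ∈ s, c i * osc (f i) T‖ ^ 2) -
      X * ∑ i ∈ s, ‖c i‖ ^ 2 : ℝ) : ℂ) = ∑ i ∈ s, ∑ j ∈ s, (c i * (starRingEnd ℂ) (c j) * J i j -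
      if i = j then ((X * ‖c i‖ ^ 2 : ℝ) : ℂ) else 0) := by
    rw [Complex.ofReal_sub, hexp]
    simp_rw [Finset.sum_sub_distrib]
    congr 1
    rw [Complex.ofReal_mul, Complex.ofReal_sum, Finset.mul_sum]
    refine Finset.sum_congr rfl fun i hi ↦ ?_
    rw [Finset.sum_ite_eq, if_pos hi]
    push_cast
    ring
  rw [← Real.norm_eq_abs, ← Complex.norm_real, hfin]
  calc _ ≤ ∑ i ∈ s, ∑ j ∈ s, 2 * C ^ 2 * (u (f j) * u (f i - f j) + u (f i) * u (f j - f i)) :=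
        (norm_sum_le _ _).trans (Finset.sum_le_sum fun i hi ↦ (norm_sum_le _ _).trans
          (Finset.sum_le_sum fun j hj ↦ hterm i hi j hj))
    _ = 2 * C ^ 2 * (∑ i ∈ s, ∑ j ∈ s, u (f j) * u (f i - f j) +
          ∑ i ∈ s, ∑ j ∈ s, u (f i) * u (f j - f i)) := by
        rw [← Finset.sum_add_distrib, Finset.mul_sum]
        refine Finset.sum_congr rfl fun i _ ↦ ?_
        rw [← Finset.sum_add_distrib, Finset.mul_sum]
    _ ≤ 2 * C ^ 2 * (zetaSum σ ^ 2 + zetaSum σ ^ 2) := by gcongr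
    _ = _ := by ring

end MeanSquare

section Resonator
open Filter Topology MeasureTheory Real

variable {ι : Type*} [Fintype ι]

lemma factorization_prod_pow {q : ι → ℕ} (hq : ∀ i, (q i).Prime) (hinj : Function.Injective q)
    (e : ι → ℕ) (i : ι) : (∏ j, q j ^ e j).factorization (q i) = e i := by
  classical
  rw [Nat.factorization_prod_apply fun j _ ↦ pow_ne_zero _ (hq j).ne_zero,
    Finset.sum_eq_single i]
  · simp [Nat.factorization_pow, (hq i).factorization_self]
  · intro j _ hj
    rw [Nat.factorization_pow, (hq j).factorization]
    simp [hinj.ne hj]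
  · simp

lemma exists_resonance_mean [DecidableEq ι] {q : ι → ℕ} (hq : ∀ i, (q i).Prime)
    (hinj : Function.Injective q) (t : ι → Finset ℕ) (c : ι → ℕ → ℂ) (hc : ∀ i j, ‖c i j‖ = 1) :
    ∃ D > 0, ∀ (B : Finset ℕ) (d : ℕ → ℂ) (σ D₀ X : ℝ), 0 < σ → σ ≤ 1 →
      (∀ b ∈ B, 1 ≤ b ∧ ∀ i, ¬ q i ∣ b) → (∀ b ∈ B, ‖d b‖ ≤ D₀ * (b : ℝ) ^ (-(1 + σ))) →
      |(∫ T in (0 : ℝ)..X, ‖(∏ i, ∑ j ∈ t i, c i j * osc (q i) T ^ j) *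
        ∑ b ∈ B, d b * osc b T‖ ^ 2) - X * ((∏ i, ((t i).card : ℝ)) * ∑ b ∈ B, ‖d b‖ ^ 2)| ≤
      D * D₀ ^ 2 * zetaSum σ ^ 2 := by
  set n : (ι → ℕ) → ℕ := fun e ↦ ∏ i, q i ^ e i with hn
  have hn1 : ∀ e, n e ≠ 0 := fun e ↦
    Finset.prod_ne_zero_iff.2 fun i _ ↦ pow_ne_zero _ (hq i).ne_zero
  set M : ℕ := ∑ e ∈ Fintype.piFinset t, n e + 1 with hMdef
  have hM : ∀ e ∈ Fintype.piFinset t, n e ≤ M := fun e he ↦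
    (Finset.single_le_sum (f := n) (fun _ _ ↦ Nat.zero_le _) he).trans (Nat.le_succ _)
  have hM1 : (1 : ℝ) ≤ M := by exact_mod_cast Nat.le_add_left 1 _
  refine ⟨4 * (M : ℝ) ^ 4, by positivity, fun B d σ D₀ X hσ hσ1 hB hd ↦ ?_⟩
  set s : Finset ((ι → ℕ) × ℕ) := Fintype.piFinset t ×ˢ B with hs
  set a : (ι → ℕ) × ℕ → ℂ := fun x ↦ (∏ i, c i (x.1 i)) * d x.2 with ha
  set f : (ι → ℕ) × ℕ → ℕ := fun x ↦ n x.1 * x.2 with hf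
  have hnc : ∀ e : ι → ℕ, ‖∏ i, c i (e i)‖ = 1 := fun e ↦ by
    rw [norm_prod]
    exact Finset.prod_eq_one fun i _ ↦ hc _ _
  have hna : ∀ x, ‖a x‖ = ‖d x.2‖ := fun x ↦ by rw [ha, norm_mul, hnc, one_mul]
  have hosc : ∀ (e : ι → ℕ) (T : ℝ), osc (n e) T = ∏ i, osc (q i) T ^ e i := by
    intro e T
    have : ∀ S : Finset ι, osc (∏ i ∈ S, q i ^ e i) T = ∏ i ∈ S, osc (q i) T ^ e i := by
      intro S
      induction S using Finset.induction_on with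
      | empty => simp [osc_one]
      | insert i S hi ih =>
        rw [Finset.prod_insert hi, Finset.prod_insert hi, osc_mul (pow_ne_zero _ (hq i).ne_zero)
          (Finset.prod_ne_zero_iff.2 fun i _ ↦ pow_ne_zero _ (hq i).ne_zero), ih,
          osc_pow (hq i).ne_zero]
    exact this Finset.univ
  have hexp : ∀ T, (∏ i, ∑ j ∈ t i, c i j * osc (q i) T ^ j) * ∑ b ∈ B, d b * osc b T =
      ∑ x ∈ s, a x * osc (f x) T := by
    intro T
    rw [Finset.prod_univ_sum, Finset.sum_mul_sum, hs, Finset.sum_product]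
    refine Finset.sum_congr rfl fun e _ ↦ Finset.sum_congr rfl fun b hb ↦ ?_
    rw [osc_mul (hn1 e) (Nat.one_le_iff_ne_zero.1 (hB b hb).1), hosc, Finset.prod_mul_distrib]
    ring
  have hsq : ∑ x ∈ s, ‖a x‖ ^ 2 = (∏ i, ((t i).card : ℝ)) * ∑ b ∈ B, ‖d b‖ ^ 2 := by
    simp_rw [hna]
    rw [hs, Finset.sum_product]
    dsimp only
    rw [Finset.sum_const, Fintype.card_piFinset, nsmul_eq_mul]
    push_cast
    rfl
  have hfac : ∀ e, ∀ b ∈ B, ∀ i, (n e * b).factorization (q i) = e i := by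
    intro e b hb i
    rw [Nat.factorization_mul (hn1 e) (Nat.one_le_iff_ne_zero.1 (hB b hb).1), Finsupp.add_apply,
      factorization_prod_pow hq hinj, Nat.factorization_eq_zero_of_not_dvd ((hB b hb).2 i), add_zero]
  have hfinj : Set.InjOn f s := by
    rintro ⟨e, b⟩ hx ⟨e', b'⟩ hx' h
    rw [Finset.mem_coe, hs, Finset.mem_product] at hx hx'
    simp only [hf] at h
    have he : e = e' := by
      ext i
      rw [← hfac e b hx.2 i, h, hfac e' b' hx'.2 i]
    subst he
    rw [Nat.eq_of_mul_eq_mul_left (Nat.pos_of_ne_zero (hn1 e)) h]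
  have hbound : ∀ x ∈ s, ‖a x‖ ≤ D₀ * (M : ℝ) ^ 2 * (f x : ℝ) ^ (-(1 + σ)) := by
    rintro ⟨e, b⟩ hx
    rw [hs, Finset.mem_product] at hx
    have hb0 : (0 : ℝ) < b := by exact_mod_cast (hB b hx.2).1
    have hne0 : (0 : ℝ) < n e := by exact_mod_cast Nat.pos_of_ne_zero (hn1 e)
    have hne1 : (1 : ℝ) ≤ n e := by exact_mod_cast Nat.pos_of_ne_zero (hn1 e)
    have hneM : (n e : ℝ) ≤ M := by exact_mod_cast hM e hx.1
    have hD0 : 0 ≤ D₀ := by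
      have h1 := (norm_nonneg _).trans (hd b hx.2)
      exact nonneg_of_mul_nonneg_left h1 (rpow_pos_of_pos hb0 _)
    have h1 : (1 : ℝ) ≤ (M : ℝ) ^ 2 * (n e : ℝ) ^ (-(1 + σ)) := by
      rw [rpow_neg hne0.le, ← div_eq_mul_inv, one_le_div (by positivity)]
      calc (n e : ℝ) ^ (1 + σ) ≤ (n e : ℝ) ^ (2 : ℝ) :=
            rpow_le_rpow_of_exponent_le hne1 (by linarith)
        _ = (n e : ℝ) ^ 2 := rpow_two _
        _ ≤ _ := by gcongr
    rw [hna]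
    refine (hd b hx.2).trans ?_
    simp only [hf]
    push_cast
    rw [mul_rpow hne0.le hb0.le]
    have h2 : 0 ≤ D₀ * (b : ℝ) ^ (-(1 + σ)) := by positivity
    calc D₀ * (b : ℝ) ^ (-(1 + σ)) ≤ D₀ * (b : ℝ) ^ (-(1 + σ)) *
          ((M : ℝ) ^ 2 * (n e : ℝ) ^ (-(1 + σ))) := le_mul_of_one_le_right h2 h1
      _ = _ := by ring
  have h := abs_integral_norm_sq_sub_le s a f (fun x hx ↦ by
    rw [hs, Finset.mem_product] at hx
    exact Nat.one_le_iff_ne_zero.2 (mul_ne_zero (hn1 _) (Nat.one_le_iff_ne_zero.1 (hB _ hx.2).1)))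
    hfinj hσ hbound (X := X)
  simp_rw [hexp, ← hsq]
  refine h.trans (le_of_eq ?_)
  ring

end Resonator

section Sobolev
open Filter Topology MeasureTheory Real

lemma norm_sq_le_integral {f f' : ℝ → ℂ} (hf : ∀ x, HasDerivAt f (f' x) x) (hf' : Continuous f')
    {a b : ℝ} (hab : a < b) {x : ℝ} (hx : x ∈ Set.Icc a b) :
    ‖f x‖ ^ 2 ≤ ∫ y in a..b, (2 / (b - a) * ‖f y‖ ^ 2 + 2 * (b - a) * ‖f' y‖ ^ 2) := by
  have hfc : Continuous f := continuous_iff_continuousAt.2 fun x ↦ (hf x).continuousAt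
  have hd : 0 < b - a := sub_pos.2 hab
  set D := ∫ y in a..b, ‖f' y‖ with hD
  have hintg : ∀ g : ℝ → ℝ, Continuous g → IntervalIntegrable g volume a b :=
    fun g hg ↦ hg.intervalIntegrable _ _
  have h1 : ∀ y ∈ Set.Icc a b, ‖f x - f y‖ ≤ D := by
    intro y hy
    rw [← intervalIntegral.integral_eq_sub_of_hasDerivAt (fun z _ ↦ hf z)
      (hf'.intervalIntegrable _ _)]
    refine intervalIntegral.norm_integral_le_abs_integral_norm.trans ?_
    refine (intervalIntegral.abs_integral_mono_interval ?_ ?_ (hintg _ hf'.norm)).trans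
      (le_of_eq (abs_of_nonneg
        (intervalIntegral.integral_nonneg hab.le fun _ _ ↦ norm_nonneg _)))
    · rw [Set.uIoc, Set.uIoc_of_le hab.le]
      exact Set.Ioc_subset_Ioc (le_min hy.1 hx.1) (max_le hy.2 hx.2)
    · exact Eventually.of_forall fun _ ↦ norm_nonneg _
  have h2 : D ^ 2 ≤ (b - a) * ∫ y in a..b, ‖f' y‖ ^ 2 := by
    have h : 0 ≤ ∫ y in a..b, (‖f' y‖ - D / (b - a)) ^ 2 :=
      intervalIntegral.integral_nonneg hab.le fun _ _ ↦ sq_nonneg _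
    have h' : ∫ y in a..b, (‖f' y‖ - D / (b - a)) ^ 2 =
        (∫ y in a..b, ‖f' y‖ ^ 2) - 2 * (D / (b - a)) * D + (b - a) * (D / (b - a)) ^ 2 := by
      have : ∀ y, (‖f' y‖ - D / (b - a)) ^ 2 =
          ‖f' y‖ ^ 2 - 2 * (D / (b - a)) * ‖f' y‖ + (D / (b - a)) ^ 2 := fun y ↦ by ring
      simp_rw [this]
      rw [intervalIntegral.integral_add (hintg _ (by fun_prop)) (hintg _ (by fun_prop)),
        intervalIntegral.integral_sub (hintg _ (by fun_prop)) (hintg _ (by fun_prop)),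
        intervalIntegral.integral_const_mul, intervalIntegral.integral_const, smul_eq_mul]
    rw [h'] at h
    have h3 : (b - a) * ((∫ y in a..b, ‖f' y‖ ^ 2) - 2 * (D / (b - a)) * D +
        (b - a) * (D / (b - a)) ^ 2) = (b - a) * (∫ y in a..b, ‖f' y‖ ^ 2) - D ^ 2 := by
      field_simp
      ring
    have := mul_nonneg hd.le h
    rw [h3] at this
    linarith
  have h3 : ∫ _ in a..b, ‖f x‖ ^ 2 ≤ ∫ y in a..b, (2 * ‖f y‖ ^ 2 + 2 * D ^ 2) := by
    refine intervalIntegral.integral_mono_on hab.le (hintg _ (by fun_prop)) (hintg _ (by fun_prop))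
      fun y hy ↦ ?_
    have h : ‖f x‖ ≤ ‖f y‖ + D := by
      calc ‖f x‖ = ‖f y + (f x - f y)‖ := by congr 1; ring
        _ ≤ _ := (norm_add_le _ _).trans (by gcongr; exact h1 y hy)
    nlinarith [norm_nonneg (f x), norm_nonneg (f y), sq_nonneg (‖f y‖ - D)]
  rw [intervalIntegral.integral_const, smul_eq_mul,
    intervalIntegral.integral_add (hintg _ (by fun_prop)) (hintg _ (by fun_prop)),
    intervalIntegral.integral_const_mul, intervalIntegral.integral_const, smul_eq_mul] at h3
  rw [intervalIntegral.integral_add (hintg _ (by fun_prop)) (hintg _ (by fun_prop)),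
    intervalIntegral.integral_const_mul, intervalIntegral.integral_const_mul]
  have h4 : ‖f x‖ ^ 2 ≤ 2 / (b - a) * (∫ y in a..b, ‖f y‖ ^ 2) + 2 * D ^ 2 := by
    rw [← sub_nonneg] at h3 ⊢
    have : (b - a)⁻¹ * (2 * (∫ y in a..b, ‖f y‖ ^ 2) + (b - a) * (2 * D ^ 2) -
        (b - a) * ‖f x‖ ^ 2) = 2 / (b - a) * (∫ y in a..b, ‖f y‖ ^ 2) + 2 * D ^ 2 - ‖f x‖ ^ 2 := by
      field_simp
    rw [← this]
    exact mul_nonneg (inv_nonneg.2 hd.le) h3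
  linarith

end Sobolev

section Resonance
open Filter Topology MeasureTheory Real

lemma hasDerivAt_osc (n : ℕ) (T : ℝ) :
    HasDerivAt (osc n) (-(Real.log n : ℝ) * Complex.I * osc n T) T := by
  have h : HasDerivAt (fun T : ℝ ↦ (-(T * Real.log n : ℝ) * Complex.I : ℂ))
      (-(Real.log n : ℝ) * Complex.I) T := by
    have := ((hasDerivAt_id T).mul_const (Real.log n)).ofReal_comp.neg.mul_const Complex.I
    simpa using this
  have := h.cexp
  rw [mul_comm] at this
  exact this

variable {ι : Type*} [Fintype ι]

lemma exists_resonator [DecidableEq ι] {q : ι → ℕ} (hq : ∀ i, (q i).Prime)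
    (hinj : Function.Injective q) (θ : ι → ℂ) (hθ : ∀ i, ‖θ i‖ = 1) (L : ℕ) (hL : 1 ≤ L) :
    ∃ D > 0, ∃ A : ℝ → ℂ, Continuous A ∧ ∀ σ D₀ X : ℝ, 0 < σ → σ ≤ 1 → 1 ≤ D₀ →
      |(∫ T in (0 : ℝ)..X, ‖A T‖ ^ 2) - X * (L : ℝ) ^ Fintype.card ι| ≤
        D * D₀ ^ 2 * zetaSum σ ^ 2 ∧
      (∀ i, |(∫ T in (0 : ℝ)..X, ‖A T * (1 - θ i * osc (q i) T)‖ ^ 2) -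
        X * (2 / L * (L : ℝ) ^ Fintype.card ι)| ≤ D * D₀ ^ 2 * zetaSum σ ^ 2) ∧
      ∀ (B : Finset ℕ) (d : ℕ → ℂ), (∀ b ∈ B, 1 ≤ b ∧ ∀ i, ¬ q i ∣ b) →
        (∀ b ∈ B, ‖d b‖ ≤ D₀ * (b : ℝ) ^ (-(1 + σ))) →
        |(∫ T in (0 : ℝ)..X, ‖A T * ∑ b ∈ B, d b * osc b T‖ ^ 2) -
          X * ((L : ℝ) ^ Fintype.card ι * ∑ b ∈ B, ‖d b‖ ^ 2)| ≤ D * D₀ ^ 2 * zetaSum σ ^ 2 := by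
  have hL0 : (0 : ℝ) < L := by exact_mod_cast hL
  set A : ℝ → ℂ := fun T ↦ ∏ i, ∑ j ∈ Finset.range L, θ i ^ j * osc (q i) T ^ j with hA
  obtain ⟨D₁, hD₁, h₁⟩ := exists_resonance_mean hq hinj (fun _ ↦ Finset.range L)
    (fun i j ↦ θ i ^ j) (fun i j ↦ by rw [norm_pow, hθ, one_pow])
  have h₂ : ∀ i₀ : ι, ∃ D > 0, ∀ (σ D₀ X : ℝ), 0 < σ → σ ≤ 1 → 1 ≤ D₀ →
      |(∫ T in (0 : ℝ)..X, ‖A T * (1 - θ i₀ * osc (q i₀) T)‖ ^ 2) -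
        X * (2 / L * (L : ℝ) ^ Fintype.card ι)| ≤ D * D₀ ^ 2 * zetaSum σ ^ 2 := by
    intro i₀
    obtain ⟨D, hD, h⟩ := exists_resonance_mean hq hinj
      (fun i ↦ if i = i₀ then {0, L} else Finset.range L)
      (fun i j ↦ if i = i₀ ∧ j = L then -θ i ^ j else θ i ^ j) (fun i j ↦ by
        split_ifs <;> simp [hθ])
    refine ⟨D, hD, fun σ D₀ X hσ hσ1 hD₀ ↦ ?_⟩
    have h' := h {1} (fun _ ↦ 1) σ D₀ X hσ hσ1
      (fun b hb ↦ by
        rw [Finset.mem_singleton] at hb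
        subst hb
        exact ⟨le_rfl, fun i hi ↦ (hq i).one_lt.ne' (Nat.dvd_one.1 hi)⟩)
      (fun b hb ↦ by
        rw [Finset.mem_singleton] at hb
        subst hb
        simpa using hD₀)
    have hcard : (∏ i, (((if i = i₀ then {0, L} else Finset.range L : Finset ℕ)).card : ℝ)) =
        2 / L * (L : ℝ) ^ Fintype.card ι := by
      have e1 : ∀ i, (((if i = i₀ then {0, L} else Finset.range L : Finset ℕ)).card : ℝ) =
          (if i = i₀ then 2 / (L : ℝ) else 1) * L := by
        intro i
        split_ifs
        · rw [Finset.card_pair (by omega)]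
          field_simp
          norm_num
        · simp
      simp_rw [e1]
      rw [Finset.prod_mul_distrib, Finset.prod_ite_eq' Finset.univ i₀, if_pos (Finset.mem_univ _)]
      simp
    have hfun : ∀ T, A T * (1 - θ i₀ * osc (q i₀) T) =
        (∏ i, ∑ j ∈ (if i = i₀ then {0, L} else Finset.range L),
          (if i = i₀ ∧ j = L then -θ i ^ j else θ i ^ j) * osc (q i) T ^ j) := by
      intro T
      rw [hA]
      dsimp only
      rw [← Finset.mul_prod_erase Finset.univ _ (Finset.mem_univ i₀),
        ← Finset.mul_prod_erase Finset.univ _ (Finset.mem_univ i₀)]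
      rw [mul_right_comm]
      congr 1
      · simp only [if_true, true_and]
        rw [Finset.sum_pair (by omega)]
        simp_rw [← mul_pow]
        rw [mul_comm, mul_neg_geom_sum, if_neg (by omega), if_pos trivial]
        ring
      · refine Finset.prod_congr rfl fun i hi ↦ ?_
        have hne := Finset.ne_of_mem_erase hi
        simp [hne]
    simp_rw [hfun, ← hcard]
    simpa [osc_one] using h'
  choose D₂ hD₂ h₂ using h₂
  have hsum0 : 0 ≤ ∑ i, D₂ i := Finset.sum_nonneg fun i _ ↦ (hD₂ i).le
  refine ⟨D₁ + ∑ i, D₂ i, by positivity, A, by fun_prop, fun σ D₀ X hσ hσ1 hD₀ ↦ ?_⟩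
  have hZ : 0 ≤ D₀ ^ 2 * zetaSum σ ^ 2 := by positivity
  have hle1 : D₁ * D₀ ^ 2 * zetaSum σ ^ 2 ≤ (D₁ + ∑ i, D₂ i) * D₀ ^ 2 * zetaSum σ ^ 2 := by
    rw [mul_assoc, mul_assoc]
    exact mul_le_mul_of_nonneg_right (by linarith) hZ
  have hB : ∀ (B : Finset ℕ) (d : ℕ → ℂ), (∀ b ∈ B, 1 ≤ b ∧ ∀ i, ¬ q i ∣ b) →
        (∀ b ∈ B, ‖d b‖ ≤ D₀ * (b : ℝ) ^ (-(1 + σ))) →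
        |(∫ T in (0 : ℝ)..X, ‖A T * ∑ b ∈ B, d b * osc b T‖ ^ 2) -
          X * ((L : ℝ) ^ Fintype.card ι * ∑ b ∈ B, ‖d b‖ ^ 2)| ≤
          (D₁ + ∑ i, D₂ i) * D₀ ^ 2 * zetaSum σ ^ 2 := by
    intro B d hB hd
    have := h₁ B d σ D₀ X hσ hσ1 hB hd
    rw [Finset.prod_const, Finset.card_univ, Finset.card_range] at this
    exact this.trans hle1
  refine ⟨?_, fun i ↦ (h₂ i σ D₀ X hσ hσ1 hD₀).trans ?_, hB⟩
  · have := hB {1} (fun _ ↦ 1)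
      (fun b hb ↦ by
        rw [Finset.mem_singleton] at hb
        subst hb
        exact ⟨le_rfl, fun i hi ↦ (hq i).one_lt.ne' (Nat.dvd_one.1 hi)⟩)
      (fun b hb ↦ by
        rw [Finset.mem_singleton] at hb
        subst hb
        simpa using hD₀)
    simpa [osc_one] using this
  · rw [mul_assoc, mul_assoc]
    refine mul_le_mul_of_nonneg_right ?_ hZ
    have := Finset.single_le_sum (f := D₂) (fun i _ ↦ (hD₂ i).le) (Finset.mem_univ i)
    linarith

set_option maxHeartbeats 1000000 in
lemma exists_simultaneous_approx [DecidableEq ι] {q : ι → ℕ} (hq : ∀ i, (q i).Prime)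
    (hinj : Function.Injective q) (θ : ι → ℂ) (hθ : ∀ i, ‖θ i‖ = 1) {ε κ δ : ℝ} (hε : 0 < ε)
    (hκ : 0 < κ) (hδ : 0 < δ) (hδ1 : δ ≤ 1) {N : ℕ}
    (hN : ∀ B : Finset ℕ, (∀ b ∈ B, N < b) →
      ∑ b ∈ B, (1 + Real.log b ^ 2) / (b : ℝ) ^ 2 ≤ κ ^ 2 / 16) :
    ∀ᶠ η in 𝓝[>] (0 : ℝ), ∀ (B : Finset ℕ) (β : ℕ → ℂ), (∀ b ∈ B, N < b ∧ ∀ i, ¬ q i ∣ b) →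
      (∀ b ∈ B, ‖β b‖ ≤ (b : ℝ) ^ (-(1 + η))) →
      ∃ T ∈ Set.Icc 0 (1 / η ^ 8), (∀ i, ‖1 - θ i * osc (q i) T‖ ≤ ε) ∧
        ∀ t : ℝ, |t| ≤ δ / 2 → ‖∑ b ∈ B, β b * osc b (T + t)‖ ≤ κ := by
  set k : ℝ := (Nat.cast (Fintype.card ι) : ℝ) with hk
  have hk0 : 0 ≤ k := Nat.cast_nonneg _
  obtain ⟨L, hL⟩ := exists_nat_ge (8 * k / ε ^ 2 + 1)
  have hL1 : 1 ≤ L := by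
    have : (1 : ℝ) ≤ L := le_trans (by have : 0 ≤ 8 * k / ε ^ 2 := by positivity
                                       linarith) hL
    exact_mod_cast this
  have hL0 : (0 : ℝ) < L := by exact_mod_cast hL1
  obtain ⟨D, hD, A, hA, hres⟩ := exists_resonator hq hinj θ hθ L hL1
  set M : ℝ := (L : ℝ) ^ Fintype.card ι with hM
  have hM1 : 1 ≤ M := one_le_pow₀ (by exact_mod_cast hL1)
  set G : ℝ := 64 * D * (1 + k / ε ^ 2 + 4 / κ ^ 2) with hG
  have hG0 : 0 ≤ G := by positivity
  have hev : ∀ᶠ η in 𝓝[>] (0 : ℝ), G * η ^ 4 < 1 / 2 := by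
    have : Tendsto (fun η : ℝ ↦ G * η ^ 4) (𝓝[>] 0) (𝓝 (G * 0 ^ 4)) :=
      ((continuous_const.mul (continuous_id.pow 4)).tendsto 0).mono_left nhdsWithin_le_nhds
    exact this.eventually_lt_const (by norm_num)
  have hev2 : ∀ᶠ η in 𝓝[>] (0 : ℝ), zetaSum (η / 2) ≤ 2 / (η / 2) := by
    have : Tendsto (fun η : ℝ ↦ η / 2) (𝓝[>] 0) (𝓝[>] 0) := by
      refine tendsto_nhdsWithin_iff.2 ⟨?_, ?_⟩
      · have : Tendsto (fun η : ℝ ↦ η / 2) (𝓝 0) (𝓝 (0 / 2)) :=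
          (continuous_id.div_const 2).tendsto 0
        rw [zero_div] at this
        exact this.mono_left nhdsWithin_le_nhds
      · filter_upwards [self_mem_nhdsWithin] with η hη
        exact half_pos (show (0 : ℝ) < η from hη)
    exact this.eventually eventually_zetaSum_le
  filter_upwards [hev, hev2, self_mem_nhdsWithin, Ioc_mem_nhdsGT one_pos] with η hηG hηZ hη0 hη1
    B β hB hβ
  replace hη0 : 0 < η := hη0
  replace hη1 : η ≤ 1 := hη1.2
  by_contra! hcon
  set X : ℝ := 1 / η ^ 8 with hX
  have hX0 : 0 < X := by positivity
  set e : ℝ := D * (2 / η) ^ 2 * zetaSum (η / 2) ^ 2 with he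
  have he0 : 0 ≤ e := by positivity
  have heX : e * (1 + k / ε ^ 2 + 4 / κ ^ 2) < X / 2 := by
    have h1 : e ≤ 64 * D * (1 / η ^ 4) := by
      calc e ≤ D * (2 / η) ^ 2 * (2 / (η / 2)) ^ 2 := by
            have := zetaSum_nonneg (η / 2)
            rw [he]
            gcongr
        _ = _ := by field_simp; norm_num
    calc e * (1 + k / ε ^ 2 + 4 / κ ^ 2) ≤ 64 * D * (1 / η ^ 4) * (1 + k / ε ^ 2 + 4 / κ ^ 2) := by
          gcongr
      _ = G * η ^ 4 * X := by rw [hG, hX]; field_simp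
      _ < 1 / 2 * X := by gcongr
      _ = X / 2 := by ring
  obtain ⟨hW1, hW2, hW3⟩ := hres (η / 2) (2 / η) X (by positivity) (by linarith)
    (by rw [le_div_iff₀ hη0]; linarith)
  rw [← he] at hW1 hW2 hW3
  set γ : ℕ → ℂ := fun b ↦ -(Real.log b : ℝ) * Complex.I * β b with hγ
  set f : ℝ → ℂ := fun T ↦ ∑ b ∈ B, β b * osc b T with hf
  set f' : ℝ → ℂ := fun T ↦ ∑ b ∈ B, γ b * osc b T with hf'
  have hfd : ∀ T, HasDerivAt f (f' T) T := by
    intro T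
    refine HasDerivAt.fun_sum fun b _ ↦ ?_
    have := (hasDerivAt_osc b T).const_mul (β b)
    refine this.congr_deriv ?_
    rw [hγ]
    ring
  have hfc : Continuous f := by fun_prop
  have hfc' : Continuous f' := by fun_prop
  have hB1 : ∀ b ∈ B, 1 ≤ b ∧ ∀ i, ¬ q i ∣ b := fun b hb ↦ ⟨by have := (hB b hb).1; omega, (hB b hb).2⟩
  have hb1 : ∀ b ∈ B, (1 : ℝ) ≤ b := fun b hb ↦ by exact_mod_cast (hB1 b hb).1
  have hpow : ∀ b ∈ B, (b : ℝ) ^ (-(1 + η)) ≤ (2 / η) * (b : ℝ) ^ (-(1 + η / 2)) := by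
    intro b hb
    have h1 : (b : ℝ) ^ (-(1 + η)) ≤ (b : ℝ) ^ (-(1 + η / 2)) :=
      rpow_le_rpow_of_exponent_le (hb1 b hb) (by linarith)
    refine h1.trans (le_mul_of_one_le_left (by positivity) ?_)
    rw [le_div_iff₀ hη0]
    linarith
  have hγb : ∀ b ∈ B, ‖γ b‖ ≤ Real.log b * (b : ℝ) ^ (-(1 + η)) := by
    intro b hb
    have : 0 ≤ Real.log b := Real.log_nonneg (hb1 b hb)
    rw [hγ]
    simp only [norm_mul, norm_neg, Complex.norm_real, Complex.norm_I, mul_one, Real.norm_eq_abs,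
      abs_of_nonneg this]
    exact mul_le_mul_of_nonneg_left (hβ b hb) this
  have hlogpow : ∀ b ∈ B, Real.log b * (b : ℝ) ^ (-(1 + η)) ≤
      (2 / η) * (b : ℝ) ^ (-(1 + η / 2)) := by
    intro b hb
    have hb0 : (0 : ℝ) < b := zero_lt_one.trans_le (hb1 b hb)
    have h1 := Real.log_le_rpow_div hb0.le (half_pos hη0)
    calc Real.log b * (b : ℝ) ^ (-(1 + η)) ≤ (b : ℝ) ^ (η / 2) / (η / 2) * (b : ℝ) ^ (-(1 + η)) := by
          gcongr
      _ = 2 / η * ((b : ℝ) ^ (η / 2) * (b : ℝ) ^ (-(1 + η))) := by field_simp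
      _ = _ := by
          rw [← rpow_add hb0]
          congr 2
          ring
  have hsq : ∀ b ∈ B, ((b : ℝ) ^ (-(1 + η))) ^ 2 ≤ 1 / (b : ℝ) ^ 2 := by
    intro b hb
    have hb0 : (0 : ℝ) < b := zero_lt_one.trans_le (hb1 b hb)
    have : (b : ℝ) ^ (-(1 + η)) ≤ 1 / b := by
      rw [one_div, ← rpow_neg_one]
      exact rpow_le_rpow_of_exponent_le (hb1 b hb) (by linarith)
    calc _ ≤ (1 / (b : ℝ)) ^ 2 := by gcongr
      _ = _ := by rw [div_pow, one_pow]
  set S₀ := ∑ b ∈ B, ‖β b‖ ^ 2 with hS₀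
  set S₁ := ∑ b ∈ B, ‖γ b‖ ^ 2 with hS₁
  have hS : S₀ + S₁ ≤ κ ^ 2 / 16 := by
    refine le_trans ?_ (hN B fun b hb ↦ (hB b hb).1)
    rw [hS₀, hS₁, ← Finset.sum_add_distrib]
    refine Finset.sum_le_sum fun b hb ↦ ?_
    have hl : 0 ≤ Real.log b := Real.log_nonneg (hb1 b hb)
    calc ‖β b‖ ^ 2 + ‖γ b‖ ^ 2 ≤ ((b : ℝ) ^ (-(1 + η))) ^ 2 +
          (Real.log b * (b : ℝ) ^ (-(1 + η))) ^ 2 := by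
          gcongr
          exacts [hβ b hb, hγb b hb]
      _ = (1 + Real.log b ^ 2) * ((b : ℝ) ^ (-(1 + η))) ^ 2 := by ring
      _ ≤ (1 + Real.log b ^ 2) * (1 / (b : ℝ) ^ 2) := by gcongr; exact hsq b hb
      _ = _ := by ring
  have hshift : ∀ (c : ℕ → ℂ), (∀ b ∈ B, ‖c b‖ ≤ 2 / η * (b : ℝ) ^ (-(1 + η / 2))) → ∀ s,
      (∫ T in (0 : ℝ)..X, ‖A T * ∑ b ∈ B, c b * osc b (T + s)‖ ^ 2) ≤
        X * (M * ∑ b ∈ B, ‖c b‖ ^ 2) + e := by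
    intro c hc s
    have h := hW3 B (fun b ↦ c b * osc b s) hB1 (fun b hb ↦ by
      rw [norm_mul, norm_osc, mul_one]
      exact hc b hb)
    simp only [norm_mul (c _), norm_osc, mul_one] at h
    have h2 : ∀ T, ∑ b ∈ B, c b * osc b s * osc b T = ∑ b ∈ B, c b * osc b (T + s) := fun T ↦
      Finset.sum_congr rfl fun b _ ↦ by rw [osc_add]; ring
    simp_rw [h2] at h
    linarith [(abs_le.1 h).2]
  have hf0 := hshift β fun b hb ↦ (hβ b hb).trans (hpow b hb)
  have hf1 := hshift γ fun b hb ↦ (hγb b hb).trans (hlogpow b hb)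
  rw [← hS₀] at hf0
  rw [← hS₁] at hf1
  set P : ℝ → ℝ → ℝ := fun T s ↦ 2 / δ * ‖A T * f (T + s)‖ ^ 2 + 2 * δ * ‖A T * f' (T + s)‖ ^ 2
    with hP
  have hPc : Continuous (Function.uncurry P) := by
    rw [hP]
    unfold Function.uncurry
    fun_prop
  have hpoint : ∀ T ∈ Set.Icc 0 X, ‖A T‖ ^ 2 ≤
      (∑ i, ‖A T * (1 - θ i * osc (q i) T)‖ ^ 2) / ε ^ 2 +
        (∫ s in (-(δ / 2))..(δ / 2), P T s) / κ ^ 2 := by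
    intro T hT
    have hI0 : 0 ≤ ∫ s in (-(δ / 2))..(δ / 2), P T s :=
      intervalIntegral.integral_nonneg (by linarith) fun s _ ↦ by positivity
    by_cases h : ∀ i, ‖1 - θ i * osc (q i) T‖ ≤ ε
    · obtain ⟨t, ht, htκ⟩ := hcon T hT h
      have hS := norm_sq_le_integral (f := fun s ↦ f (T + s)) (f' := fun s ↦ f' (T + s))
        (fun s ↦ (hfd (T + s)).comp_const_add T s) (by fun_prop)
        (show -(δ / 2) < δ / 2 by linarith) (abs_le.1 ht)
      rw [show δ / 2 - -(δ / 2) = δ by ring] at hS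
      have h2 : κ ^ 2 ≤ ‖f (T + t)‖ ^ 2 := by
        gcongr
      have h3 : ∫ s in (-(δ / 2))..(δ / 2), P T s = ‖A T‖ ^ 2 *
          ∫ s in (-(δ / 2))..(δ / 2), (2 / δ * ‖f (T + s)‖ ^ 2 + 2 * δ * ‖f' (T + s)‖ ^ 2) := by
        rw [← intervalIntegral.integral_const_mul]
        congr 1
        ext s
        simp only [hP, norm_mul]
        ring
      have h4 : ‖A T‖ ^ 2 ≤ (∫ s in (-(δ / 2))..(δ / 2), P T s) / κ ^ 2 := by
        rw [le_div_iff₀ (by positivity), h3]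
        exact mul_le_mul_of_nonneg_left (h2.trans hS) (by positivity)
      have : 0 ≤ (∑ i, ‖A T * (1 - θ i * osc (q i) T)‖ ^ 2) / ε ^ 2 := by positivity
      linarith
    · push Not at h
      obtain ⟨i, hi⟩ := h
      have h1 : ‖A T * (1 - θ i * osc (q i) T)‖ ^ 2 ≤
          ∑ i, ‖A T * (1 - θ i * osc (q i) T)‖ ^ 2 :=
        Finset.single_le_sum (f := fun i ↦ ‖A T * (1 - θ i * osc (q i) T)‖ ^ 2)
          (fun _ _ ↦ sq_nonneg _) (Finset.mem_univ i)
      have h2 : ‖A T‖ ^ 2 ≤ (∑ i, ‖A T * (1 - θ i * osc (q i) T)‖ ^ 2) / ε ^ 2 := by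
        rw [le_div_iff₀ (by positivity)]
        refine le_trans ?_ h1
        rw [norm_mul, mul_pow]
        gcongr
      have : 0 ≤ (∫ s in (-(δ / 2))..(δ / 2), P T s) / κ ^ 2 := by positivity
      linarith
  have hoscc : ∀ i, Continuous (fun T ↦ ‖A T * (1 - θ i * osc (q i) T)‖ ^ 2) := fun i ↦ by fun_prop
  have hIc : Continuous fun T ↦ ∫ s in (-(δ / 2))..(δ / 2), P T s :=
    intervalIntegral.continuous_parametric_intervalIntegral_of_continuous' hPc _ _
  have hintg := intervalIntegral.integral_mono_on (μ := volume) hX0.le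
    ((hA.norm.pow 2).intervalIntegrable _ _)
    (Continuous.intervalIntegrable (by fun_prop) _ _) hpoint
  rw [intervalIntegral.integral_add (Continuous.intervalIntegrable (by fun_prop) _ _)
    (Continuous.intervalIntegrable (by fun_prop) _ _), intervalIntegral.integral_div,
    intervalIntegral.integral_div, intervalIntegral.integral_finsetSum
      (fun i _ ↦ (hoscc i).intervalIntegrable _ _)] at hintg
  have hswap : ∫ T in (0 : ℝ)..X, ∫ s in (-(δ / 2))..(δ / 2), P T s =
      ∫ s in (-(δ / 2))..(δ / 2), ∫ T in (0 : ℝ)..X, P T s := by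
    refine intervalIntegral_intervalIntegral_swap ?_
    refine (hPc.continuousOn.integrableOn_compact
      (isCompact_uIcc.prod isCompact_uIcc)).mono_set
      (Set.prod_mono Set.uIoc_subset_uIcc Set.uIoc_subset_uIcc)
  have hinner : ∀ s, ∫ T in (0 : ℝ)..X, P T s ≤
      2 / δ * (X * (M * S₀) + e) + 2 * δ * (X * (M * S₁) + e) := by
    intro s
    rw [hP]
    dsimp only
    rw [intervalIntegral.integral_add (Continuous.intervalIntegrable (by fun_prop) _ _)
      (Continuous.intervalIntegrable (by fun_prop) _ _), intervalIntegral.integral_const_mul,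
      intervalIntegral.integral_const_mul]
    have h0 := hf0 s
    have h1 := hf1 s
    gcongr
  have hout : ∫ s in (-(δ / 2))..(δ / 2), ∫ T in (0 : ℝ)..X, P T s ≤
      X * M * (κ ^ 2 / 8) + 4 * e := by
    have hc : Continuous fun s ↦ ∫ T in (0 : ℝ)..X, P T s :=
      intervalIntegral.continuous_parametric_intervalIntegral_of_continuous'
        (f := fun s T ↦ P T s) (hPc.comp continuous_swap) _ _
    have h := intervalIntegral.integral_mono_on (μ := volume) (show -(δ / 2) ≤ δ / 2 by linarith)
      (hc.intervalIntegrable _ _) (Continuous.intervalIntegrable continuous_const _ _)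
      (fun s _ ↦ hinner s)
    rw [intervalIntegral.integral_const, smul_eq_mul] at h
    have hXM : 0 ≤ X * M := by positivity
    have hS₁0 : 0 ≤ S₁ := Finset.sum_nonneg fun _ _ ↦ sq_nonneg _
    calc _ ≤ _ := h
      _ = 2 * (X * M * S₀ + e) + 2 * δ ^ 2 * (X * M * S₁ + e) := by field_simp; ring
      _ ≤ 2 * (X * M * S₀ + e) + 2 * 1 ^ 2 * (X * M * S₁ + e) := by gcongr
      _ = X * M * (2 * (S₀ + S₁)) + 4 * e := by ring
      _ ≤ X * M * (2 * (κ ^ 2 / 16)) + 4 * e := by gcongr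
      _ = _ := by ring
  rw [hswap] at hintg
  have hsum : ∑ i, (∫ T in (0 : ℝ)..X, ‖A T * (1 - θ i * osc (q i) T)‖ ^ 2) ≤
      k * (X * (2 / L * M) + e) := by
    calc _ ≤ ∑ _i : ι, (X * (2 / L * M) + e) :=
          Finset.sum_le_sum fun i _ ↦ by linarith [(abs_le.1 (hW2 i)).2]
      _ = _ := by rw [Finset.sum_const, Finset.card_univ, nsmul_eq_mul]
  have hlow := (abs_le.1 hW1).1
  have hkL : k * (2 / L) / ε ^ 2 ≤ 1 / 4 := by
    have : 8 * k / ε ^ 2 ≤ L := by linarith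
    rw [div_le_iff₀ (by positivity)] at this ⊢
    rw [mul_div_assoc', div_le_iff₀ hL0]
    linarith
  have h1 : X * M - e ≤ k * (X * (2 / L * M) + e) / ε ^ 2 +
      (X * M * (κ ^ 2 / 8) + 4 * e) / κ ^ 2 := by
    calc X * M - e ≤ ∫ T in (0 : ℝ)..X, ‖A T‖ ^ 2 := by linarith
      _ ≤ _ := hintg
      _ ≤ _ := by gcongr
  have h2 : k * (X * (2 / L * M) + e) / ε ^ 2 + (X * M * (κ ^ 2 / 8) + 4 * e) / κ ^ 2 =
      X * M * (k * (2 / L) / ε ^ 2) + e * (k / ε ^ 2 + 4 / κ ^ 2) + X * M / 8 := by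
    field_simp
    ring
  have hXM : X ≤ X * M := le_mul_of_one_le_right hX0.le hM1
  have h3 : X * M * (k * (2 / L) / ε ^ 2) ≤ X * M * (1 / 4) := by gcongr
  rw [h2] at h1
  linarith

end Resonance

section LineShift
open Filter Topology MeasureTheory Real

lemma exists_abs_invNorm_sub_le : ∃ C > 0, ∀ η τ : ℝ, 0 ≤ η → η ≤ 1 →
    |invNorm (1 + τ * Complex.I) - invNorm (1 + η + τ * Complex.I)| ≤
      C * (1 + |τ|) ^ (1 / 16 : ℝ) * η := by
  obtain ⟨c, hc, hlow⟩ := exists_le_norm_zetaOne (ε := 1 / 32) (by norm_num) (by norm_num)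
  obtain ⟨r, hr, hr1, C, hC, hz⟩ := exists_zeroFree (ε := 1 / 32) (by norm_num) (by norm_num)
  refine ⟨1 / c * (1 + C), by positivity, fun η τ hη hη1 ↦ ?_⟩
  set x := 1 + |τ| with hx
  have hx1 : 1 ≤ x := by simp [hx]
  have hx0 : 0 < x := by linarith
  set g : ℂ → ℂ := fun s ↦ (s - 1) / zetaOne s with hg
  set S : Set ℂ := {s | 1 ≤ s.re ∧ s.re ≤ 2 ∧ s.im = τ} with hS
  have hconv : Convex ℝ S := by
    have h1 : Convex ℝ {s : ℂ | 1 ≤ s.re} := convex_halfSpace_re_ge 1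
    have h2 : Convex ℝ {s : ℂ | s.re ≤ 2} := convex_halfSpace_re_le 2
    have h3 : Convex ℝ {s : ℂ | s.im = τ} := by
      intro a ha b hb u v _ _ huv
      simp only [Set.mem_ofPred_eq] at ha hb ⊢
      simp only [Complex.add_im, Complex.smul_im, ha, hb, smul_eq_mul]
      rw [← add_mul, huv, one_mul]
    exact h1.inter (h2.inter h3)
  have hd : ∀ s ∈ S, HasDerivWithinAt g
      (1 / zetaOne s - (s - 1) / zetaOne s * (deriv zetaOne s / zetaOne s)) S s := by
    intro s hs
    have hne := zetaOne_ne_zero hs.1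
    have h := ((hasDerivAt_id s).sub_const 1).div (differentiable_zetaOne s).hasDerivAt hne
    refine (h.congr_deriv ?_).hasDerivWithinAt
    simp only [id]
    field_simp
  have hb : ∀ s ∈ S, ‖1 / zetaOne s - (s - 1) / zetaOne s * (deriv zetaOne s / zetaOne s)‖ ≤
      1 / c * (1 + C) * x ^ (1 / 16 : ℝ) := by
    intro s hs
    have hl := hlow s hs.1 hs.2.1
    have hq := (hz s s hs.1 hs.2.1 (by
      rw [sub_self, norm_zero]
      positivity)).2
    rw [hs.2.2, ← hx] at hl hq
    have hs1 : ‖s - 1‖ ≤ x := by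
      refine (Complex.norm_le_abs_re_add_abs_im _).trans ?_
      rw [Complex.sub_re, Complex.sub_im, Complex.one_re, Complex.one_im, sub_zero, hs.2.2, hx]
      gcongr
      rw [abs_le]
      constructor <;> linarith [hs.1, hs.2.1]
    have hpos : 0 < c * x ^ (1 - 1 / 32 : ℝ) := by positivity
    have h1 : ‖1 / zetaOne s‖ ≤ 1 / (c * x ^ (1 - 1 / 32 : ℝ)) := by
      rw [norm_div, norm_one]
      gcongr
    have hxx : x / x ^ (1 - 1 / 32 : ℝ) = x ^ (1 / 32 : ℝ) := by
      nth_rewrite 1 [← rpow_one x]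
      rw [← rpow_sub hx0]
      norm_num
    have h2 : ‖(s - 1) / zetaOne s‖ ≤ 1 / c * x ^ (1 / 32 : ℝ) := by
      calc ‖(s - 1) / zetaOne s‖ = ‖s - 1‖ * ‖1 / zetaOne s‖ := by rw [← norm_mul]; congr 1; ring
        _ ≤ x * (1 / (c * x ^ (1 - 1 / 32 : ℝ))) := by gcongr
        _ = 1 / c * (x / x ^ (1 - 1 / 32 : ℝ)) := by field_simp
        _ = _ := by rw [hxx]
    have h3 : 1 / (c * x ^ (1 - 1 / 32 : ℝ)) ≤ 1 / c * x ^ (1 / 16 : ℝ) := by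
      rw [← div_div, div_eq_mul_inv (1 / c)]
      gcongr
      exact (inv_le_one_of_one_le₀ (one_le_rpow hx1 (by norm_num))).trans
        (one_le_rpow hx1 (by norm_num))
    calc _ ≤ ‖1 / zetaOne s‖ + ‖(s - 1) / zetaOne s‖ * ‖deriv zetaOne s / zetaOne s‖ :=
          (norm_sub_le _ _).trans (by rw [norm_mul])
      _ ≤ 1 / c * x ^ (1 / 16 : ℝ) + 1 / c * x ^ (1 / 32 : ℝ) * (C * x ^ (1 / 32 : ℝ)) := by
          gcongr
          exact h1.trans h3
      _ = 1 / c * x ^ (1 / 16 : ℝ) + 1 / c * C * (x ^ (1 / 32 : ℝ) * x ^ (1 / 32 : ℝ)) := by ring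
      _ = _ := by
          rw [← rpow_add hx0]
          norm_num
          ring
  have hgn : ∀ s, invNorm s = ‖g s‖ := fun s ↦ by rw [invNorm, hg, norm_div]
  rw [hgn, hgn]
  refine (abs_norm_sub_norm_le _ _).trans ?_
  refine (hconv.norm_image_sub_le_of_norm_hasDerivWithin_le hd hb (x := 1 + η + τ * Complex.I)
    (y := 1 + τ * Complex.I) ?_ ?_).trans (le_of_eq ?_)
  · simp [hS, hη]
    linarith
  · simp [hS]
  · rw [show (1 + τ * Complex.I - (1 + η + τ * Complex.I) : ℂ) = -η by ring, norm_neg,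
      Complex.norm_real, Real.norm_eq_abs, abs_of_nonneg hη]

end LineShift

section Rough
open Filter Topology MeasureTheory Real
open scoped Nat

lemma natCast_cpow_eq {b : ℕ} (hb : b ≠ 0) (σ τ : ℝ) :
    (b : ℂ) ^ (-(σ + τ * Complex.I)) = ((b : ℝ) ^ (-σ) : ℝ) * osc b τ := by
  have hb0 : (0 : ℝ) < b := by exact_mod_cast Nat.pos_of_ne_zero hb
  rw [osc, Complex.ofReal_cpow hb0.le, ← Complex.ofReal_natCast,
    Complex.cpow_def_of_ne_zero (by exact_mod_cast hb0.ne'),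
    Complex.cpow_def_of_ne_zero (by exact_mod_cast hb0.ne'), ← Complex.exp_add,
    ← Complex.ofReal_log hb0.le]
  congr 1
  push_cast
  ring

/-- The Dirichlet coefficients, twisted by `n ^ (-(σ + iτ))`, of `1 / ζ` with the Euler factors at
the primes up to `N` removed. -/
noncomputable def roughTerm (N : ℕ) (σ τ : ℝ) (b : ℕ) : ℂ :=
  if b.Coprime N ! then ((ArithmeticFunction.moebius b : ℝ) * (b : ℝ) ^ (-σ) : ℝ) * osc b τ else 0

lemma norm_roughTerm_le (N : ℕ) (σ τ : ℝ) (b : ℕ) : ‖roughTerm N σ τ b‖ ≤ (b : ℝ) ^ (-σ) := by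
  have h0 : 0 ≤ (b : ℝ) ^ (-σ) := by positivity
  unfold roughTerm
  split_ifs
  · rw [norm_mul, norm_osc, mul_one, Complex.norm_real, norm_mul, Real.norm_eq_abs,
      Real.norm_eq_abs, abs_of_nonneg h0]
    refine mul_le_of_le_one_left h0 ?_
    exact_mod_cast ArithmeticFunction.abs_moebius_le_one
  · simpa using h0

lemma roughTerm_one (N : ℕ) (σ τ : ℝ) : roughTerm N σ τ 1 = 1 := by
  simp [roughTerm, osc_one]

lemma roughTerm_zero (N : ℕ) (σ τ : ℝ) : roughTerm N σ τ 0 = 0 := by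
  simp [roughTerm]

lemma roughTerm_mul (N : ℕ) (σ τ : ℝ) {m n : ℕ} (h : m.Coprime n) :
    roughTerm N σ τ (m * n) = roughTerm N σ τ m * roughTerm N σ τ n := by
  rcases eq_or_ne m 0 with rfl | hm
  · simp [roughTerm_zero]
  rcases eq_or_ne n 0 with rfl | hn
  · simp [roughTerm_zero]
  unfold roughTerm
  simp only [Nat.coprime_mul_iff_left]
  by_cases h1 : m.Coprime N !
  · by_cases h2 : n.Coprime N !
    · rw [if_pos ⟨h1, h2⟩, if_pos h1, if_pos h2, osc_mul hm hn,
        ArithmeticFunction.isMultiplicative_moebius.map_mul_of_coprime h]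
      push_cast
      rw [mul_rpow (Nat.cast_nonneg _) (Nat.cast_nonneg _)]
      push_cast
      ring
    · simp [h2]
  · simp [h1]

lemma tsum_roughTerm_pow (N : ℕ) (σ τ : ℝ) {p : ℕ} (hp : p.Prime) :
    ∑' e : ℕ, roughTerm N σ τ (p ^ e) =
      if p ≤ N then 1 else 1 - ((p : ℝ) ^ (-σ) : ℝ) * osc p τ := by
  have h2 : ∀ e, e ∉ ({0, 1} : Finset ℕ) → roughTerm N σ τ (p ^ e) = 0 := by
    intro e he
    simp only [Finset.mem_insert, Finset.mem_singleton, not_or] at he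
    unfold roughTerm
    rw [ArithmeticFunction.moebius_apply_prime_pow hp he.1, if_neg he.2]
    simp
  rw [tsum_eq_sum h2, Finset.sum_pair (by norm_num), pow_zero, roughTerm_one, pow_one]
  unfold roughTerm
  simp only [hp.coprime_iff_not_dvd, hp.dvd_factorial, ArithmeticFunction.moebius_apply_prime hp]
  by_cases h : p ≤ N
  · simp [h]
  · simp only [h, not_false_eq_true, if_true, if_false]
    push_cast
    ring

/-- The Euler factors of `1 / ζ` at the primes up to `N`. -/
noncomputable def eulerFactor (N : ℕ) (σ τ : ℝ) : ℂ :=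
  ∏ p ∈ (N + 1).primesBelow, (1 - ((p : ℝ) ^ (-σ) : ℝ) * osc p τ)

lemma summable_norm_roughTerm (N : ℕ) {σ : ℝ} (hσ : 1 < σ) (τ : ℝ) :
    Summable fun b ↦ ‖roughTerm N σ τ b‖ :=
  Summable.of_nonneg_of_le (fun _ ↦ norm_nonneg _) (fun b ↦ norm_roughTerm_le N σ τ b)
    (Real.summable_nat_rpow.2 (by linarith))

lemma inv_riemannZeta_eq (N : ℕ) {σ : ℝ} (hσ : 1 < σ) (τ : ℝ) :
    (riemannZeta (σ + τ * Complex.I))⁻¹ = eulerFactor N σ τ * ∑' b, roughTerm N σ τ b := by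
  have hre : 1 < ((σ : ℂ) + τ * Complex.I).re := by simpa using hσ
  have h1 := (riemannZeta_eulerProduct hre).inv₀ (riemannZeta_ne_zero_of_one_lt_re hre)
  have h2 := (EulerProduct.eulerProduct (roughTerm_one N σ τ) (fun h ↦ roughTerm_mul N σ τ h)
    (summable_norm_roughTerm N hσ τ) (roughTerm_zero N σ τ)).const_mul (eulerFactor N σ τ)
  refine tendsto_nhds_unique h1 (h2.congr' ?_)
  filter_upwards [eventually_ge_atTop (N + 1)] with n hn
  rw [← Finset.prod_inv_distrib]
  simp_rw [inv_inv]
  have h3 : ∏ p ∈ n.primesBelow, (1 - (p : ℂ) ^ (-(σ + τ * Complex.I))) =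
      ∏ p ∈ n.primesBelow, (1 - ((p : ℝ) ^ (-σ) : ℝ) * osc p τ) :=
    Finset.prod_congr rfl fun p hp ↦ by
      rw [natCast_cpow_eq (Nat.mem_primesBelow.1 hp).2.ne_zero]
  rw [h3, Finset.prod_congr rfl fun p hp ↦ tsum_roughTerm_pow N σ τ (Nat.mem_primesBelow.1 hp).2,
    Finset.prod_ite, Finset.prod_const_one, one_mul,
    ← Finset.prod_filter_mul_prod_filter_not n.primesBelow (fun p ↦ p ≤ N), eulerFactor]
  congr 2
  ext p
  simp only [Finset.mem_filter, Nat.mem_primesBelow]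
  constructor
  · rintro ⟨h, hp⟩
    exact ⟨⟨by omega, hp⟩, by omega⟩
  · rintro ⟨⟨_, hp⟩, h⟩
    exact ⟨by omega, hp⟩

lemma norm_prod_sub_prod_le {ι : Type*} (s : Finset ι) (a b : ι → ℂ) (ha : ∀ i ∈ s, ‖a i‖ ≤ 2)
    (hb : ∀ i ∈ s, ‖b i‖ ≤ 2) :
    ‖∏ i ∈ s, a i - ∏ i ∈ s, b i‖ ≤ 2 ^ s.card * ∑ i ∈ s, ‖a i - b i‖ := by
  classical
  induction s using Finset.induction_on with
  | empty => simp
  | insert i s hi ih =>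
    rw [Finset.prod_insert hi, Finset.prod_insert hi, Finset.sum_insert hi,
      Finset.card_insert_of_notMem hi]
    have hih := ih (fun j hj ↦ ha j (Finset.mem_insert_of_mem hj))
      fun j hj ↦ hb j (Finset.mem_insert_of_mem hj)
    have hp : ‖∏ j ∈ s, b j‖ ≤ 2 ^ s.card := by
      rw [norm_prod, ← Finset.prod_const]
      exact Finset.prod_le_prod (fun _ _ ↦ norm_nonneg _) fun j hj ↦
        hb j (Finset.mem_insert_of_mem hj)
    have hai := ha i (Finset.mem_insert_self i s)
    calc ‖a i * ∏ j ∈ s, a j - b i * ∏ j ∈ s, b j‖ =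
          ‖a i * (∏ j ∈ s, a j - ∏ j ∈ s, b j) + (a i - b i) * ∏ j ∈ s, b j‖ := by
          congr 1
          ring
      _ ≤ ‖a i‖ * ‖∏ j ∈ s, a j - ∏ j ∈ s, b j‖ + ‖a i - b i‖ * ‖∏ j ∈ s, b j‖ :=
          (norm_add_le _ _).trans (by rw [norm_mul, norm_mul])
      _ ≤ 2 * (2 ^ s.card * ∑ j ∈ s, ‖a j - b j‖) + ‖a i - b i‖ * 2 ^ s.card := by gcongr
      _ ≤ _ := by
          rw [pow_succ]
          have : 0 ≤ ‖a i - b i‖ * 2 ^ s.card := by positivity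
          linarith

lemma exists_sum_log_sq_div_sq_le {κ : ℝ} (hκ : 0 < κ) : ∃ N₀ : ℕ, ∀ B : Finset ℕ,
    (∀ b ∈ B, N₀ < b) → ∑ b ∈ B, (1 + Real.log b ^ 2) / (b : ℝ) ^ 2 ≤ κ := by
  have hs : Summable fun b : ℕ ↦ 17 * (b : ℝ) ^ (-(3 / 2) : ℝ) :=
    (Real.summable_nat_rpow.2 (by norm_num)).mul_left _
  obtain ⟨s, hs⟩ := summable_iff_vanishing_norm.1 hs κ hκ
  refine ⟨s.sup id, fun B hB ↦ ?_⟩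
  have h := hs B (Finset.disjoint_left.2 fun b hb hbs ↦
    (hB b hb).not_ge (Finset.le_sup (f := id) hbs))
  refine le_trans (Finset.sum_le_sum fun b hb ↦ ?_) ((le_abs_self _).trans h.le)
  have hb1 : (1 : ℝ) ≤ b := by
    have := hB b hb
    exact_mod_cast (by omega : 1 ≤ b)
  have hb0 : (0 : ℝ) < b := by linarith
  have hl0 := Real.log_nonneg hb1
  have hl := Real.log_le_rpow_div hb0.le (ε := 1 / 4) (by norm_num)
  have h2 : Real.log b ^ 2 ≤ 16 * (b : ℝ) ^ (1 / 2 : ℝ) := by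
    calc Real.log b ^ 2 ≤ ((b : ℝ) ^ (1 / 4 : ℝ) / (1 / 4)) ^ 2 := by gcongr
      _ = 16 * ((b : ℝ) ^ (1 / 4 : ℝ) * (b : ℝ) ^ (1 / 4 : ℝ)) := by ring
      _ = _ := by rw [← rpow_add hb0]; norm_num
  have h3 : (1 : ℝ) ≤ (b : ℝ) ^ (1 / 2 : ℝ) := one_le_rpow hb1 (by norm_num)
  rw [div_le_iff₀ (by positivity), mul_assoc, ← rpow_two (b : ℝ), ← rpow_add hb0]
  norm_num
  norm_num at h2 h3
  linarith

lemma norm_tsum_roughTerm_sub_le (N : ℕ) {σ : ℝ} (hσ : 1 < σ) (τ : ℝ) {Y : ℕ} (hY : 2 ≤ Y) :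
    ‖∑' b, roughTerm N σ τ b - (1 + ∑ b ∈ Finset.range Y with 1 < b ∧ b.Coprime N !,
      (((ArithmeticFunction.moebius b : ℝ) * (b : ℝ) ^ (-σ) : ℝ) : ℂ) * osc b τ)‖ ≤
      ∑' b : ℕ, ((b + Y : ℕ) : ℝ) ^ (-σ) := by
  have hs := summable_norm_roughTerm N hσ τ
  have hu : Summable fun b : ℕ ↦ (b : ℝ) ^ (-σ) := Real.summable_nat_rpow.2 (by linarith)
  have hsum : ∑ b ∈ Finset.range Y, roughTerm N σ τ b =
      1 + ∑ b ∈ Finset.range Y with 1 < b ∧ b.Coprime N !,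
        (((ArithmeticFunction.moebius b : ℝ) * (b : ℝ) ^ (-σ) : ℝ) : ℂ) * osc b τ := by
    have h1 : (1 : ℂ) = ∑ b ∈ Finset.range Y, if b = 1 then 1 else 0 := by
      rw [Finset.sum_ite_eq', if_pos (Finset.mem_range.2 (by omega))]
    rw [h1, Finset.sum_filter, ← Finset.sum_add_distrib]
    refine Finset.sum_congr rfl fun b _ ↦ ?_
    rcases lt_trichotomy b 1 with hb | rfl | hb
    · rw [Nat.lt_one_iff.1 hb, roughTerm_zero]
      simp
    · rw [roughTerm_one]
      simp
    · simp [hb, hb.ne', roughTerm]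
  rw [← hsum, ← hs.of_norm.sum_add_tsum_nat_add Y, add_sub_cancel_left]
  exact tsum_of_norm_bounded ((summable_nat_add_iff Y).2 hu).hasSum
    fun b ↦ norm_roughTerm_le N σ τ _

theorem exists_invNorm_le {κ δ : ℝ} (hκ : 0 < κ) (hδ : 0 < δ) (hδ1 : δ ≤ 1) :
    ∃ N₀ : ℕ, ∀ N ≥ N₀, ∀ θ : ℕ → ℝ, (∀ p, |θ p| = 1) → ∃ T : ℝ, ∀ t : ℝ, |t| ≤ δ / 2 →
      invNorm (1 + (T + t : ℝ) * Complex.I) ≤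
        (‖∏ p ∈ (N + 1).primesBelow, (1 - ((θ p / p : ℝ) : ℂ) * osc p t)‖ + κ) * (1 + 2 * κ) + κ := by
  obtain ⟨N₀, hN₀⟩ := exists_sum_log_sq_div_sq_le (κ := κ ^ 2 / 16) (by positivity)
  obtain ⟨C, hC, hline⟩ := exists_abs_invNorm_sub_le
  refine ⟨N₀, fun N hN θ hθ ↦ ?_⟩
  set S := (N + 1).primesBelow with hS
  set m : ℕ := S.card with hm
  set ε : ℝ := κ / (2 * 2 ^ m * (m + 1)) with hε
  have hε0 : 0 < ε := by positivity
  have happrox := exists_simultaneous_approx (ι := S) (q := fun p ↦ (p : ℕ))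
    (fun i ↦ (Nat.mem_primesBelow.1 i.2).2) Subtype.val_injective (fun i ↦ (θ i : ℂ))
    (fun i ↦ by rw [Complex.norm_real, Real.norm_eq_abs, hθ]) hε0 hκ hδ hδ1 (N := N₀) hN₀
  have hsq : ∀ᶠ η in 𝓝[>] (0 : ℝ), 3 * C * √η ≤ κ := by
    have : Tendsto (fun η : ℝ ↦ 3 * C * √η) (𝓝[>] 0) (𝓝 (3 * C * √0)) :=
      ((continuous_const.mul Real.continuous_sqrt).tendsto 0).mono_left nhdsWithin_le_nhds
    exact this.eventually_le_const (by simpa using hκ)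
  have hlin : ∀ᶠ η in 𝓝[>] (0 : ℝ), 2 ^ m * (m * (η * N)) ≤ κ / 2 := by
    have : Tendsto (fun η : ℝ ↦ 2 ^ m * (m * (η * (N : ℝ)))) (𝓝[>] 0)
        (𝓝 (2 ^ m * (m * (0 * (N : ℝ))))) :=
      ((by fun_prop : Continuous fun η : ℝ ↦ 2 ^ m * (m * (η * (N : ℝ)))).tendsto 0).mono_left
        nhdsWithin_le_nhds
    exact this.eventually_le_const (by simpa using hκ)
  obtain ⟨η, ⟨⟨hη, hηsq⟩, hηlin⟩, hη0, hη1⟩ :=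
    (((happrox.and hsq).and hlin).and (Ioc_mem_nhdsGT one_pos)).exists
  set u : ℕ → ℝ := fun b ↦ (b : ℝ) ^ (-(1 + η)) with hu
  obtain ⟨Y, hY2, hY⟩ : ∃ Y : ℕ, 2 ≤ Y ∧ ∑' b : ℕ, u (b + Y) ≤ κ :=
    ((eventually_ge_atTop 2).and ((tendsto_sum_nat_add u).eventually_le_const hκ)).exists
  set B := (Finset.range Y).filter fun b ↦ 1 < b ∧ b.Coprime N ! with hB
  obtain ⟨T, hT, hT1, hT2⟩ := hη B
    (fun b ↦ (((ArithmeticFunction.moebius b : ℝ) * (b : ℝ) ^ (-(1 + η)) : ℝ) : ℂ))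
    (fun b hb ↦ by
      obtain ⟨_, hb1, hbc⟩ := Finset.mem_filter.1 hb
      have h := (Nat.coprime_factorial_iff hb1.ne').1 hbc
      refine ⟨(hN.trans_lt h).trans_le (Nat.minFac_le (by omega)), fun i hi ↦ ?_⟩
      have hi' := Nat.mem_primesBelow.1 i.2
      have := Nat.minFac_le_of_dvd hi'.2.two_le hi
      omega)
    (fun b _ ↦ by
      have h0 : 0 ≤ (b : ℝ) ^ (-(1 + η)) := by positivity
      rw [Complex.norm_real, norm_mul, Real.norm_eq_abs, Real.norm_eq_abs, abs_of_nonneg h0]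
      refine mul_le_of_le_one_left h0 ?_
      exact_mod_cast ArithmeticFunction.abs_moebius_le_one)
  refine ⟨T, fun t ht ↦ ?_⟩
  set τ := T + t with hτ
  have h1 : invNorm (1 + τ * Complex.I) ≤ invNorm (1 + η + τ * Complex.I) + κ := by
    have h := hline η τ hη0.le hη1
    have hsη : 0 < √η := Real.sqrt_pos.2 hη0
    have hτb : 1 + |τ| ≤ (3 / √η) ^ 16 := by
      have e1 : √η ^ 16 = η ^ 8 := by
        rw [show 16 = 2 * 8 by norm_num, pow_mul, Real.sq_sqrt hη0.le]
      have e2 : |τ| ≤ 1 / η ^ 8 + 1 := by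
        rw [hτ]
        refine (abs_add_le _ _).trans (add_le_add ?_ (by linarith))
        rw [abs_of_nonneg hT.1]
        exact hT.2
      have e3 : 1 ≤ 1 / η ^ 8 := by
        rw [le_div_iff₀ (by positivity), one_mul]
        exact pow_le_one₀ hη0.le hη1
      rw [div_pow, e1]
      calc 1 + |τ| ≤ 3 * (1 / η ^ 8) := by linarith
        _ ≤ 3 ^ 16 * (1 / η ^ 8) := by gcongr; norm_num
        _ = _ := by ring
    have hroot : (1 + |τ|) ^ (1 / 16 : ℝ) ≤ 3 / √η := by
      calc (1 + |τ|) ^ (1 / 16 : ℝ) ≤ ((3 / √η) ^ 16) ^ (1 / 16 : ℝ) := by gcongr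
        _ = _ := by
          have := Real.pow_rpow_inv_natCast (show 0 ≤ 3 / √η by positivity)
            (show (16 : ℕ) ≠ 0 by norm_num)
          rw [one_div]
          exact_mod_cast this
    have hbd : C * (1 + |τ|) ^ (1 / 16 : ℝ) * η ≤ κ := by
      calc C * (1 + |τ|) ^ (1 / 16 : ℝ) * η ≤ C * (3 / √η) * (√η * √η) := by
            rw [Real.mul_self_sqrt hη0.le]
            gcongr
        _ = 3 * C * √η := by field_simp
        _ ≤ κ := hηsq
    linarith [(abs_le.1 (h.trans hbd)).2]
  have hσ : 1 < 1 + η := by linarith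
  have h2 : invNorm (1 + η + τ * Complex.I) =
      ‖eulerFactor N (1 + η) τ‖ * ‖∑' b, roughTerm N (1 + η) τ b‖ := by
    rw [← norm_mul, ← inv_riemannZeta_eq N hσ τ, norm_inv, invNorm_of_ne]
    · push_cast
      rfl
    · intro h
      have := congrArg Complex.re h
      simp at this
      linarith
  have h3 : ‖∑' b, roughTerm N (1 + η) τ b‖ ≤ 1 + 2 * κ := by
    have e1 := norm_tsum_roughTerm_sub_le N hσ τ hY2
    have e2 := hT2 t ht
    set H := ∑ b ∈ B, (((ArithmeticFunction.moebius b : ℝ) * (b : ℝ) ^ (-(1 + η)) : ℝ) : ℂ) *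
      osc b (T + t)
    calc ‖∑' b, roughTerm N (1 + η) τ b‖ = ‖(∑' b, roughTerm N (1 + η) τ b - (1 + H)) + 1 + H‖ := by
          congr 1
          ring
      _ ≤ κ + 1 + κ := by
          refine (norm_add_le _ _).trans (add_le_add ((norm_add_le _ _).trans
            (add_le_add (e1.trans hY) ?_)) e2)
          rw [norm_one]
      _ = _ := by ring
  have h4 : ‖eulerFactor N (1 + η) τ‖ ≤ ‖∏ p ∈ S, (1 - ((θ p / p : ℝ) : ℂ) * osc p t)‖ + κ := by
    have hle2 : ∀ (x : ℝ) (p : ℕ) (s : ℝ), |x| ≤ 1 → ‖1 - (x : ℂ) * osc p s‖ ≤ 2 := by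
      intro x p s hx
      refine (norm_sub_le _ _).trans ?_
      rw [norm_one, norm_mul, norm_osc, mul_one, Complex.norm_real, Real.norm_eq_abs]
      linarith
    have hp2 : ∀ p ∈ S, (1 : ℝ) ≤ p := fun p hp ↦ by
      exact_mod_cast (Nat.mem_primesBelow.1 hp).2.one_le
    have e := norm_prod_sub_prod_le S (fun p ↦ 1 - (((p : ℝ) ^ (-(1 + η)) : ℝ) : ℂ) * osc p τ)
      (fun p ↦ 1 - ((θ p / p : ℝ) : ℂ) * osc p t)
      (fun p hp ↦ hle2 _ _ _ (by
        rw [abs_of_nonneg (by positivity)]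
        exact rpow_le_one_of_one_le_of_nonpos (hp2 p hp) (by linarith)))
      (fun p hp ↦ hle2 _ _ _ (by
        rw [abs_div, hθ, Nat.abs_cast]
        exact div_le_one_of_le₀ (hp2 p hp) (Nat.cast_nonneg _)))
    have hterm : ∀ p ∈ S, ‖(1 - (((p : ℝ) ^ (-(1 + η)) : ℝ) : ℂ) * osc p τ) -
        (1 - ((θ p / p : ℝ) : ℂ) * osc p t)‖ ≤ η * N + ε := by
      intro p hp
      have hp1 := hp2 p hp
      have hp0 : (0 : ℝ) < p := by linarith
      have hpN : (p : ℝ) ≤ N := by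
        have := (Nat.mem_primesBelow.1 hp).1
        exact_mod_cast (by omega : p ≤ N)
      have hθT := hT1 ⟨p, hp⟩
      dsimp only at hθT
      have hθ2 : (θ p : ℂ) * θ p = 1 := by
        have : θ p * θ p = 1 := by rw [← abs_mul_abs_self, hθ, one_mul]
        exact_mod_cast this
      have hpη : 1 - η * N ≤ (p : ℝ) ^ (-η) := by
        rw [rpow_def_of_pos hp0]
        have h1 := Real.add_one_le_exp (Real.log p * -η)
        have h2 : Real.log p ≤ N := (Real.log_le_self hp0.le).trans hpN
        nlinarith
      have hpη1 : (p : ℝ) ^ (-η) ≤ 1 := rpow_le_one_of_one_le_of_nonpos hp1 (by linarith)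
      have hsplit : (p : ℝ) ^ (-(1 + η)) = (p : ℝ)⁻¹ * (p : ℝ) ^ (-η) := by
        rw [neg_add, rpow_add hp0, rpow_neg_one]
      have hident : (1 - (((p : ℝ) ^ (-(1 + η)) : ℝ) : ℂ) * osc p τ) -
          (1 - ((θ p / p : ℝ) : ℂ) * osc p t) = ((p : ℝ)⁻¹ : ℝ) * osc p t *
            (θ p * (1 - θ p * osc p T) + ((1 - (p : ℝ) ^ (-η) : ℝ) : ℂ) * osc p T) := by
        rw [hτ, osc_add, hsplit, mul_sub, ← mul_assoc (θ p : ℂ), hθ2]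
        push_cast
        ring
      rw [hident, norm_mul, norm_mul, norm_osc, mul_one, Complex.norm_real, Real.norm_eq_abs,
        abs_of_nonneg (by positivity)]
      refine (mul_le_of_le_one_left (norm_nonneg _) (inv_le_one_of_one_le₀ hp1)).trans ?_
      refine (norm_add_le _ _).trans ?_
      rw [norm_mul, norm_mul, Complex.norm_real, Complex.norm_real, Real.norm_eq_abs, hθ, one_mul,
        norm_osc, mul_one, Real.norm_eq_abs, abs_of_nonneg (by linarith)]
      linarith
    have hsum := Finset.sum_le_sum hterm
    rw [Finset.sum_const, nsmul_eq_mul] at hsum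
    have hε' : 2 ^ m * (m * ε) ≤ κ / 2 := by
      rw [hε, show (2 : ℝ) ^ m * (m * (κ / (2 * 2 ^ m * (m + 1)))) = κ / 2 * (m / (m + 1)) by
        field_simp]
      refine mul_le_of_le_one_right (by positivity) (div_le_one_of_le₀ ?_ (by positivity))
      linarith
    have hdiff : ‖eulerFactor N (1 + η) τ - ∏ p ∈ S, (1 - ((θ p / p : ℝ) : ℂ) * osc p t)‖ ≤ κ := by
      refine e.trans ?_
      calc _ ≤ 2 ^ m * (m * (η * N + ε)) := by gcongr
        _ = 2 ^ m * (m * (η * N)) + 2 ^ m * (m * ε) := by ring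
        _ ≤ κ := by linarith
    have := norm_sub_norm_le (eulerFactor N (1 + η) τ)
      (∏ p ∈ S, (1 - ((θ p / p : ℝ) : ℂ) * osc p t))
    linarith
  calc _ ≤ _ := h1
    _ ≤ _ := by
      rw [h2]
      gcongr

end Rough

section UpperBound
open Filter Topology MeasureTheory Real
open scoped ArithmeticFunction.vonMangoldt

lemma sum_Icc_eq_sum_primesBelow {f : ℕ → ℝ} {N : ℕ}
    (hf : Function.support f ⊆ {n | IsPrimePow n}) (hN : ∀ n, N < n → f n = 0) :
    ∑ n ∈ Finset.Icc 1 N, f n = ∑ p ∈ (N + 1).primesBelow, ∑' j : ℕ, f (p ^ (j + 1)) := by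
  have hz : ∀ n ∉ Finset.Icc 1 N, f n = 0 := by
    intro n hn
    rw [Finset.mem_Icc, not_and_or, not_le, not_le] at hn
    rcases hn with hn | hn
    · by_contra h
      have : n = 0 := by omega
      subst this
      exact not_isPrimePow_zero (hf h)
    · exact hN n hn
  rw [← tsum_eq_sum (L := .unconditional ℕ) hz,
    tsum_eq_tsum_primes_of_support_subset_prime_powers
      (summable_of_ne_finset_zero (s := Finset.Icc 1 N) hz) hf]
  have h1 := tsum_subtype {p : ℕ | p.Prime} (fun p ↦ ∑' j : ℕ, f (p ^ (j + 1)))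
  refine Eq.trans h1 ?_
  rw [tsum_eq_sum (s := (N + 1).primesBelow)]
  · refine Finset.sum_congr rfl fun p hp ↦ ?_
    exact Set.indicator_of_mem (s := {p : ℕ | p.Prime}) (Nat.mem_primesBelow.mp hp).2 _
  · intro p hp
    by_cases hpp : p.Prime
    · rw [Set.indicator_of_mem (by exact hpp)]
      have hpN : N < p := by
        by_contra h
        exact hp (Nat.mem_primesBelow.mpr ⟨by omega, hpp⟩)
      refine (tsum_congr fun j ↦ hN _ (hpN.trans_le ?_)).trans tsum_zero
      exact Nat.le_self_pow (by omega) p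
    · rw [Set.indicator_of_notMem (by exact hpp)]

lemma osc_re (n : ℕ) (t : ℝ) : (osc n t).re = cos (t * log n) := by
  rw [osc, ← Complex.ofReal_neg, Complex.exp_ofReal_mul_I_re, cos_neg]

lemma hasSum_neg_log_norm_one_sub {p : ℕ} (hp : 2 ≤ p) {a : ℝ} (ha : |a| = 1) (t : ℝ) :
    HasSum (fun j : ℕ ↦ a ^ (j + 1) * cos (t * log (p ^ (j + 1) : ℕ)) / ((j + 1) * p ^ (j + 1)))
      (-log ‖1 - ((a / p : ℝ) : ℂ) * osc p t‖) := by
  have hp2 : (2 : ℝ) ≤ p := by exact_mod_cast hp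
  set z : ℂ := ((a / p : ℝ) : ℂ) * osc p t with hz
  have hn : ‖z‖ < 1 := by
    rw [hz, norm_mul, norm_osc, mul_one, Complex.norm_real, norm_eq_abs, abs_div, ha,
      Nat.abs_cast, div_lt_one (by linarith)]
    linarith
  have h := (hasSum_nat_add_iff' 1).mpr (Complex.hasSum_taylorSeries_neg_log hn)
  have h2 := Complex.hasSum_re h
  rw [Finset.sum_range_one, pow_zero, Nat.cast_zero, div_zero, sub_zero, Complex.neg_re,
    Complex.log_re] at h2
  convert h2 using 2 with j
  have h3 : z ^ (j + 1) / (j + 1 : ℕ) =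
      ((a ^ (j + 1) / p ^ (j + 1) / (j + 1 : ℕ) : ℝ) : ℂ) * osc (p ^ (j + 1)) t := by
    rw [hz, mul_pow, osc_pow (by omega)]
    push_cast
    rw [div_pow]
    ring
  rw [h3, Complex.re_ofReal_mul, osc_re]
  push_cast
  field_simp

/-- The contribution of the powers of `p` to the sum `altSum`. -/
lemma abs_neg_log_norm_sub_le {w : ℝ} (hw : 2 ≤ w) (t : ℝ) {K : ℕ} (hK : 1 ≤ K) {p N : ℕ}
    (hN : N = ⌊exp (w * (π * K))⌋₊) (hp : p.Prime) (hpN : p ≤ N) :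
    |-log ‖1 - ((altSign w (log p) / p : ℝ) : ℂ) * osc p t‖ - ∑' j : ℕ,
      if p ^ (j + 1) ≤ N then logCoeff (p ^ (j + 1)) / (p ^ (j + 1) : ℕ) *
        (altSign w (log (p ^ (j + 1) : ℕ)) * cos (t * log (p ^ (j + 1) : ℕ))) else 0| ≤
      6 * exp (-(w * π / 4)) * (p : ℝ) ^ (-(3 / 2) : ℝ) := by
  have hw0 : 0 < w := by linarith
  have hp2 : (2 : ℝ) ≤ p := by exact_mod_cast hp.two_le
  have hp0 : (0 : ℝ) < p := by linarith
  have hl : 0 < log p := log_pos (by linarith)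
  have hE := hasSum_neg_log_norm_one_sub hp.two_le (abs_altSign w (log p)) t
  set e : ℕ → ℝ := fun j ↦ altSign w (log p) ^ (j + 1) * cos (t * log (p ^ (j + 1) : ℕ)) /
    ((j + 1) * p ^ (j + 1)) with he
  set g : ℕ → ℝ := fun j ↦ if p ^ (j + 1) ≤ N then logCoeff (p ^ (j + 1)) / (p ^ (j + 1) : ℕ) *
    (altSign w (log (p ^ (j + 1) : ℕ)) * cos (t * log (p ^ (j + 1) : ℕ))) else 0 with hg
  have hlc : ∀ j : ℕ, logCoeff (p ^ (j + 1)) = 1 / (j + 1) := by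
    intro j
    rw [logCoeff, ArithmeticFunction.vonMangoldt_apply_pow (by omega),
      ArithmeticFunction.vonMangoldt_apply_prime hp]
    push_cast
    rw [log_pow]
    push_cast
    field_simp
  have hlog : ∀ j : ℕ, log (p ^ (j + 1) : ℕ) = (j + 1) * log p := by
    intro j
    push_cast
    rw [log_pow]
    push_cast
    rfl
  have hexp : ∀ j : ℕ, (p : ℝ) ^ (j + 1) = exp ((j + 1) * log p) := by
    intro j
    rw [← hlog, exp_log (by exact_mod_cast pow_pos hp.pos _)]
    push_cast
    rfl
  set q : ℝ := exp (-(3 / 4 * log p)) with hq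
  have hq2 : q ^ 2 = (p : ℝ) ^ (-(3 / 2) : ℝ) := by
    rw [hq, ← exp_nat_mul, rpow_def_of_pos hp0]
    congr 1
    push_cast
    ring
  have hq1 : q ≤ 2 / 3 := by
    have h1 : q ^ 4 ≤ 1 / 8 := by
      rw [hq, ← exp_nat_mul, show ((4 : ℕ) : ℝ) * -(3 / 4 * log p) = -(3 * log p) by
        push_cast; ring, exp_neg, show 3 * log p = ((3 : ℕ) : ℝ) * log p by norm_num,
        exp_nat_mul, exp_log hp0, one_div]
      apply inv_anti₀ (by norm_num)
      calc (8 : ℝ) = 2 ^ 3 := by norm_num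
        _ ≤ (p : ℝ) ^ 3 := by gcongr
    by_contra h
    have : (2 / 3 : ℝ) ^ 4 < q ^ 4 := by gcongr; exact not_le.mp h
    norm_num at this
    linarith
  have hq0 : 0 < q := exp_pos _
  have hterm : ∀ j : ℕ, |e j - g j| ≤ 2 * exp (-(w * π / 4)) * q ^ (j + 1) := by
    intro j
    have hj : (0 : ℝ) < j + 1 := by positivity
    have hpj : (0 : ℝ) < p ^ (j + 1) := by positivity
    by_cases hle : log (p ^ (j + 1) : ℕ) ≤ w * π
    · have h1 : altSign w (log (p ^ (j + 1) : ℕ)) = 1 := by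
        have := altSign_of_mem hw0 (m := 0) (v := log (p ^ (j + 1) : ℕ))
          (by rw [hlog]; simp; positivity) (by simpa using hle)
        simpa using this
      have h2 : log p ≤ w * π := by
        refine le_trans ?_ hle
        rw [hlog]
        nlinarith [show (0 : ℝ) ≤ j * log p by positivity]
      have h3 : altSign w (log p) = 1 := by
        have := altSign_of_mem hw0 (m := 0) (v := log p) (by simpa using hl) (by simpa using h2)
        simpa using this
      have h4 : p ^ (j + 1) ≤ N := by
        rw [hN]
        refine (Finset.mem_Icc.mp (mem_Icc_floor_exp.mpr
          ⟨Nat.one_le_pow _ _ hp.pos, hle.trans ?_⟩)).2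
        have : (1 : ℝ) ≤ K := by exact_mod_cast hK
        gcongr
        nlinarith [pi_pos]
      have h5 : e j = g j := by
        simp only [he, hg, if_pos h4, h1, h3, hlc, one_pow, one_mul]
        push_cast
        field_simp
      rw [h5, sub_self, abs_zero]
      positivity
    · have hb : (1 : ℝ) / p ^ (j + 1) ≤ exp (-(w * π / 4)) * q ^ (j + 1) := by
        rw [hexp, one_div, ← exp_neg, hq, ← exp_nat_mul, ← exp_add, exp_le_exp]
        rw [hlog, not_le] at hle
        push_cast
        linarith
      have h1 : |e j| ≤ 1 / p ^ (j + 1) := by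
        rw [he, abs_div, abs_mul, abs_pow, abs_altSign, one_pow, one_mul,
          abs_of_pos (by positivity : (0 : ℝ) < (j + 1) * p ^ (j + 1))]
        gcongr
        · exact abs_cos_le_one _
        · nlinarith [show (0 : ℝ) ≤ j * p ^ (j + 1) by positivity]
      have h2 : |g j| ≤ 1 / p ^ (j + 1) := by
        simp only [hg]
        split_ifs
        · rw [abs_mul, abs_mul, abs_altSign, one_mul, hlc, abs_div, abs_of_pos (by positivity :
            (0 : ℝ) < 1 / (j + 1)), Nat.abs_cast]
          push_cast
          calc _ ≤ (1 / (j + 1) / p ^ (j + 1) : ℝ) * 1 := by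
                gcongr
                exact abs_cos_le_one _
            _ ≤ 1 / p ^ (j + 1) := by
              rw [mul_one]
              gcongr
              rw [div_le_one hj]
              linarith [(j.cast_nonneg : (0 : ℝ) ≤ j)]
        · rw [abs_zero]
          positivity
      linarith [abs_sub (e j) (g j)]
  have hzero : e 0 - g 0 = 0 := by
    have h1 := hlc 0
    rw [zero_add, pow_one, Nat.cast_zero, zero_add, div_one] at h1
    simp only [he, hg, zero_add, pow_one, if_pos hpN, h1, Nat.cast_zero, one_mul]
    ring
  have hgeo : HasSum (fun j : ℕ ↦ 2 * exp (-(w * π / 4)) * q ^ (j + 1))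
      (2 * exp (-(w * π / 4)) * (q * (1 - q)⁻¹)) := by
    simp_rw [pow_succ']
    exact ((hasSum_geometric_of_lt_one hq0.le (by linarith)).mul_left q).mul_left _
  have hgeo' := (hasSum_nat_add_iff' 1).mpr hgeo
  have hd : Summable fun j ↦ e j - g j := .of_norm_bounded hgeo.summable hterm
  have hgs : Summable g := (hE.summable.sub hd).congr fun j ↦ by simp
  rw [← hE.tsum_eq, ← hE.summable.tsum_sub hgs]
  have hd' := (hasSum_nat_add_iff' 1).mpr hd.hasSum
  rw [Finset.sum_range_one, hzero, sub_zero] at hd'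
  rw [← hd'.tsum_eq]
  calc _ ≤ _ := tsum_of_norm_bounded (f := fun j ↦ e (j + 1) - g (j + 1)) hgeo'
        fun j ↦ hterm (j + 1)
    _ = 2 * exp (-(w * π / 4)) * (q ^ 2 * (1 - q)⁻¹) := by
      have : 1 - q ≠ 0 := by linarith
      rw [Finset.sum_range_one]
      field_simp
      ring
    _ ≤ 2 * exp (-(w * π / 4)) * (q ^ 2 * 3) := by
      gcongr
      rw [inv_le_comm₀ (by linarith) (by norm_num)]
      linarith
    _ = _ := by rw [hq2]; ring

lemma exists_norm_prod_le : ∃ C > 0, ∀ w t : ℝ, ∀ K : ℕ, 2 ≤ w → 1 ≤ K →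
    ‖∏ p ∈ (⌊exp (w * (π * K))⌋₊ + 1).primesBelow,
      (1 - ((altSign w (log p) / p : ℝ) : ℂ) * osc p t)‖ ≤ exp (-altSum w t K + C / w ^ 2) := by
  have hs : Summable fun n : ℕ ↦ (n : ℝ) ^ (-(3 / 2) : ℝ) :=
    Real.summable_nat_rpow.mpr (by norm_num)
  set Z := ∑' n : ℕ, (n : ℝ) ^ (-(3 / 2) : ℝ) with hZ
  have hZ0 : 0 ≤ Z := tsum_nonneg fun n ↦ by positivity
  refine ⟨192 * Z + 1, by positivity, fun w t K hw hK ↦ ?_⟩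
  have hw0 : 0 < w := by linarith
  set N := ⌊exp (w * (π * K))⌋₊ with hN
  have hpos : ∀ p ∈ (N + 1).primesBelow,
      0 < ‖1 - ((altSign w (log p) / p : ℝ) : ℂ) * osc p t‖ := by
    intro p hp
    have hp2 : (2 : ℝ) ≤ p := by exact_mod_cast (Nat.mem_primesBelow.mp hp).2.two_le
    refine norm_pos_iff.mpr fun h ↦ ?_
    have h1 := congrArg norm (sub_eq_zero.mp h)
    rw [norm_one, norm_mul, norm_osc, mul_one, Complex.norm_real, norm_eq_abs, abs_div,
      abs_altSign, Nat.abs_cast, eq_div_iff (by linarith)] at h1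
    linarith
  have halt : altSum w t K = ∑ p ∈ (N + 1).primesBelow, ∑' j : ℕ,
      if p ^ (j + 1) ≤ N then logCoeff (p ^ (j + 1)) / (p ^ (j + 1) : ℕ) *
        (altSign w (log (p ^ (j + 1) : ℕ)) * cos (t * log (p ^ (j + 1) : ℕ))) else 0 := by
    rw [altSum_eq_logSum hw0, logSum, ← hN]
    have := sum_Icc_eq_sum_primesBelow (N := N) (f := fun n ↦ if n ≤ N then logCoeff n / n *
      (altSign w (log n) * cos (t * log n)) else 0) ?_ ?_
    · rw [← this]
      refine Finset.sum_congr rfl fun n hn ↦ ?_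
      rw [if_pos (Finset.mem_Icc.mp hn).2]
    · intro n hn
      rw [Function.mem_support] at hn
      rw [Set.mem_ofPred_eq, ← ArithmeticFunction.vonMangoldt_ne_zero_iff]
      intro h
      simp [logCoeff, h] at hn
    · intro n hn
      exact if_neg (by omega)
  have hE : exp (-(w * π / 4)) ≤ 32 / w ^ 2 := by
    have h1 : w / 4 ≤ w * π / 4 := by nlinarith [pi_gt_three]
    have h2 := quadratic_le_exp_of_nonneg (show 0 ≤ w / 4 by positivity)
    calc exp (-(w * π / 4)) ≤ exp (-(w / 4)) := exp_le_exp.mpr (by linarith)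
      _ = (exp (w / 4))⁻¹ := exp_neg _
      _ ≤ ((w / 4) ^ 2 / 2)⁻¹ := by
        apply inv_anti₀ (by positivity)
        linarith
      _ = 32 / w ^ 2 := by field_simp; norm_num
  rw [norm_prod, ← exp_log (Finset.prod_pos hpos), exp_le_exp,
    log_prod (fun p hp ↦ (hpos p hp).ne')]
  have hsum : |∑ p ∈ (N + 1).primesBelow,
      -log ‖1 - ((altSign w (log p) / p : ℝ) : ℂ) * osc p t‖ - altSum w t K| ≤
      192 * Z / w ^ 2 := by
    rw [halt, ← Finset.sum_sub_distrib]
    refine (Finset.abs_sum_le_sum_abs _ _).trans ?_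
    calc _ ≤ ∑ p ∈ (N + 1).primesBelow, 6 * exp (-(w * π / 4)) * (p : ℝ) ^ (-(3 / 2) : ℝ) := by
          refine Finset.sum_le_sum fun p hp ↦ ?_
          obtain ⟨h1, h2⟩ := Nat.mem_primesBelow.mp hp
          exact abs_neg_log_norm_sub_le hw t hK hN h2 (by omega)
      _ = 6 * exp (-(w * π / 4)) * ∑ p ∈ (N + 1).primesBelow, (p : ℝ) ^ (-(3 / 2) : ℝ) := by
          rw [Finset.mul_sum]
      _ ≤ 6 * (32 / w ^ 2) * Z := by
          gcongr
          exact hs.sum_le_tsum _ fun n _ ↦ by positivity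
      _ = _ := by ring
  rw [Finset.sum_neg_distrib] at hsum
  have h3 : 192 * Z / w ^ 2 ≤ (192 * Z + 1) / w ^ 2 := by gcongr; linarith
  linarith [(abs_le.mp hsum).1]

lemma exists_invNorm_le_add_cube : ∃ C > 0, ∃ δ₀ > 0, ∀ δ : ℝ, 0 < δ → δ < δ₀ → ∃ T : ℝ,
    ∀ t : ℝ, |t| ≤ δ / 2 →
      invNorm (1 + (T + t : ℝ) * Complex.I) ≤
        exp (-eulerMascheroniConstant) / 4 * δ + C * δ ^ 3 := by
  obtain ⟨C₁, hC₁, halt⟩ := exists_abs_altSum_sub_le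
  obtain ⟨C₂, hC₂, hprod⟩ := exists_norm_prod_le
  set D := C₁ + 1 + C₂ with hD
  have hD0 : 0 < D := by positivity
  set a := exp (-eulerMascheroniConstant) / 4 with ha
  have ha0 : 0 < a := by positivity
  have ha1 : a ≤ 1 / 4 := by
    have : exp (-eulerMascheroniConstant) ≤ 1 :=
      exp_le_one_iff.mpr (by linarith [one_half_lt_eulerMascheroniConstant])
    linarith
  refine ⟨a * (1 + 4 * D) + 6, by positivity, 1 / (2 * (1 + D)), by positivity,
    fun δ hδ hδ' ↦ ?_⟩
  rw [lt_div_iff₀ (by positivity)] at hδ'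
  have hδ2 : δ < 1 / 2 := by nlinarith [mul_pos hδ hD0]
  have hDδ : D * δ ^ 2 ≤ 1 := by nlinarith [mul_pos hδ hD0]
  have hsq : δ ^ 2 < 1 / 4 := by nlinarith
  have hcube : δ ^ 3 ≤ 1 / 8 := by nlinarith
  have hκ : 0 < δ ^ 3 := by positivity
  set w := 2 / (δ * (1 + δ ^ 2)) with hw
  have hw2 : 2 ≤ w := by
    rw [hw, le_div_iff₀ (by positivity)]
    nlinarith
  have hw0 : 0 < w := by linarith
  have hwδ : w * (δ / 2) = 1 / (1 + δ ^ 2) := by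
    rw [hw]
    field_simp
  have hwinv : 1 / w = δ * (1 + δ ^ 2) / 2 := by
    rw [hw, one_div_div]
  have hwsq : 1 / w ^ 2 ≤ δ ^ 2 := by
    rw [← one_div_pow, hwinv, div_pow, mul_pow]
    have : (1 + δ ^ 2) ^ 2 ≤ 4 := by nlinarith [sq_nonneg δ]
    nlinarith [sq_nonneg δ]
  obtain ⟨j₀, hj₀⟩ := exists_abs_mainTerm_sub_le (τ₀ := 1 / (1 + δ ^ 2)) (κ := 1 / w ^ 2)
    (by positivity) (by rw [div_lt_one (by positivity)]; linarith [sq_pos_of_pos hδ])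
    (by positivity)
  obtain ⟨N₀, hN₀⟩ := exists_invNorm_le (κ := δ ^ 3) hκ hδ (by linarith)
  set K := 2 * max j₀ N₀ + 1 with hK
  set N := ⌊exp (w * (π * K))⌋₊ with hN
  have hNN : N₀ ≤ N := by
    apply Nat.le_floor
    have h1 : (N₀ : ℝ) ≤ K := by
      have : N₀ ≤ K := by have := le_max_right j₀ N₀; omega
      exact_mod_cast this
    have h2 : (K : ℝ) ≤ w * (π * K) := by
      have h3 : 1 ≤ w * π := by nlinarith [pi_gt_three]
      nlinarith [(K.cast_nonneg : (0 : ℝ) ≤ K)]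
    linarith [add_one_le_exp (w * (π * K))]
  obtain ⟨T, hT⟩ := hN₀ N hNN (fun p ↦ altSign w (log p)) fun p ↦ abs_altSign _ _
  refine ⟨T, fun t ht ↦ (hT t ht).trans ?_⟩
  set P := ‖∏ p ∈ (N + 1).primesBelow, (1 - ((altSign w (log p) / p : ℝ) : ℂ) * osc p t)‖
    with hP
  have hP0 : 0 ≤ P := norm_nonneg _
  have hPle : P ≤ a * (δ * (1 + δ ^ 2)) * exp (D * δ ^ 2) := by
    have h1 := (abs_le.mp (halt w t K hw2 (ht.trans (by rw [hwinv]; nlinarith)) (by omega))).1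
    have h2 := (abs_le.mp (hj₀ (max j₀ N₀) (le_max_left _ _) (w * t) (by
      rw [abs_mul, abs_of_pos hw0, ← hwδ]
      gcongr))).1
    rw [← hK] at h2
    have h3 : log (w * π) + log (2 / π) = -log (δ * (1 + δ ^ 2) / 4) := by
      rw [← log_mul (by positivity) (by positivity), ← log_inv, hw]
      congr 1
      field_simp
      norm_num
    have h4 : C₁ / w ^ 2 + 1 / w ^ 2 + C₂ / w ^ 2 ≤ D * δ ^ 2 := by
      calc _ = D * (1 / w ^ 2) := by rw [hD]; ring
        _ ≤ _ := by gcongr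
    calc P ≤ exp (-altSum w t K + C₂ / w ^ 2) := hprod w t K hw2 (by omega)
      _ ≤ exp (-eulerMascheroniConstant + log (δ * (1 + δ ^ 2) / 4) + D * δ ^ 2) :=
        exp_le_exp.mpr (by linarith)
      _ = a * (δ * (1 + δ ^ 2)) * exp (D * δ ^ 2) := by
        rw [exp_add, exp_add, exp_log (by positivity), ha]
        ring
  have hexp : exp (D * δ ^ 2) ≤ 1 + 2 * (D * δ ^ 2) := by
    have h0 : 0 ≤ D * δ ^ 2 := by positivity
    have := abs_exp_sub_one_le (x := D * δ ^ 2) (by rwa [abs_of_nonneg h0])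
    rw [abs_of_nonneg h0] at this
    linarith [(abs_le.mp this).2]
  have hPle' : P ≤ a * δ + a * (1 + 4 * D) * δ ^ 3 := by
    calc P ≤ a * (δ * (1 + δ ^ 2)) * (1 + 2 * (D * δ ^ 2)) := hPle.trans (by gcongr)
      _ = a * δ + a * (1 + 2 * D + 2 * D * δ ^ 2) * δ ^ 3 := by ring
      _ ≤ _ := by
        have : 1 + 2 * D + 2 * D * δ ^ 2 ≤ 1 + 4 * D := by nlinarith
        linarith [mul_le_mul_of_nonneg_right (mul_le_mul_of_nonneg_left this ha0.le) hκ.le]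
  have hP1 : P ≤ 1 := by
    calc P ≤ a * (δ * (1 + δ ^ 2)) * (1 + 2 * (D * δ ^ 2)) := hPle.trans (by gcongr)
      _ ≤ 1 / 4 * (1 / 2 * (1 + 1 / 4)) * (1 + 2 * 1) := by gcongr
      _ ≤ 1 := by norm_num
  nlinarith [mul_nonneg hκ.le (sub_nonneg.mpr hP1), mul_nonneg hκ.le hκ.le]

lemma exists_mean_invNorm_le : ∃ C > 0, ∃ δ₀ > 0, ∀ δ : ℝ, 0 < δ → δ < δ₀ → ∃ T : ℝ,
    ∀ p : ℝ, 0 < p → ((1 / δ) * ∫ t in T..(T + δ), invNorm (1 + (t : ℝ) * Complex.I) ^ p) ^ (1 / p)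
      ≤ exp (-eulerMascheroniConstant) / 4 * δ + C * δ ^ 3 := by
  obtain ⟨C, hC, δ₀, hδ₀, h⟩ := exists_invNorm_le_add_cube
  refine ⟨C, hC, δ₀, hδ₀, fun δ hδ hδ' ↦ ?_⟩
  obtain ⟨T, hT⟩ := h δ hδ hδ'
  refine ⟨T - δ / 2, fun p hp ↦ ?_⟩
  set U := exp (-eulerMascheroniConstant) / 4 * δ + C * δ ^ 3 with hU
  have hU0 : 0 ≤ U := by positivity
  have hcont : Continuous fun t : ℝ ↦ invNorm (1 + (t : ℝ) * Complex.I) ^ p := by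
    refine Continuous.rpow_const ?_ fun _ ↦ Or.inr hp.le
    exact continuousOn_invNorm.comp_continuous (by fun_prop) fun t ↦ by simp
  have hle : T - δ / 2 ≤ T - δ / 2 + δ := by linarith
  have h1 : ∫ t in (T - δ / 2)..(T - δ / 2 + δ), invNorm (1 + (t : ℝ) * Complex.I) ^ p ≤
      δ * U ^ p := by
    calc _ ≤ ∫ _ in (T - δ / 2)..(T - δ / 2 + δ), U ^ p := by
          refine intervalIntegral.integral_mono_on (μ := volume) hle
            (hcont.intervalIntegrable _ _) (by simp) fun t ht ↦ ?_
          refine rpow_le_rpow (invNorm_nonneg _) ?_ hp.le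
          have := hT (t - T) (abs_le.mpr ⟨by linarith [ht.1], by linarith [ht.2]⟩)
          rwa [add_sub_cancel] at this
      _ = _ := by simp
  have h0 : 0 ≤ ∫ t in (T - δ / 2)..(T - δ / 2 + δ), invNorm (1 + (t : ℝ) * Complex.I) ^ p :=
    intervalIntegral.integral_nonneg hle fun t _ ↦ rpow_nonneg (invNorm_nonneg _) _
  calc _ ≤ (U ^ p) ^ (1 / p) := by
        refine rpow_le_rpow (by positivity) ?_ (by positivity)
        rw [one_div, inv_mul_le_iff₀ hδ]
        exact h1
    _ = U := by rw [← rpow_mul hU0, mul_one_div_cancel hp.ne', rpow_one]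

lemma integral_norm_riemannZeta_rpow_neg (p a b : ℝ) :
    ∫ t in a..b, ‖riemannZeta (1 + t * Complex.I)‖ ^ (-p) =
      ∫ t in a..b, invNorm (1 + (t : ℝ) * Complex.I) ^ p := by
  refine intervalIntegral.integral_congr_ae ?_
  filter_upwards [Measure.ae_ne volume 0] with t ht _
  rw [invNorm_of_ne, inv_rpow (norm_nonneg _), rpow_neg (norm_nonneg _)]
  simpa using ht

end UpperBound

end ZetaLine

open Complex Real Filter MeasureTheory intervalIntegral

theorem stmt_1 (p : ℝ) (hp : 0 < p) :
    ∃ C > (0 : ℝ), ∃ δ₀ > (0 : ℝ), ∀ δ : ℝ, 0 < δ → δ < δ₀ →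
      |(⨅ T : ℝ, ((1 / δ) * ∫ t in T..(T + δ),
          ‖riemannZeta (1 + t * Complex.I)‖ ^ (-p)) ^ (1 / p)) -
        (Real.exp (-Real.eulerMascheroniConstant) / 4) * δ| ≤ C * δ ^ 3 := by
  obtain ⟨C₁, hC₁, hlow⟩ := ZetaLine.exists_le_mean_invNorm
  obtain ⟨C₂, hC₂, δ₀, hδ₀, hup⟩ := ZetaLine.exists_mean_invNorm_le
  set a := Real.exp (-Real.eulerMascheroniConstant) / 4 with ha
  have ha0 : 0 < a := by positivity
  refine ⟨a * C₁ + C₂, by positivity, min δ₀ 1, by positivity, fun δ hδ hδ' ↦ ?_⟩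
  simp_rw [ZetaLine.integral_norm_riemannZeta_rpow_neg]
  have hlow' := hlow δ hδ (hδ'.le.trans (min_le_right _ _)) p hp
  obtain ⟨T, hT⟩ := hup δ hδ (hδ'.trans_le (min_le_left _ _))
  have hbdd : BddBelow (Set.range fun T : ℝ ↦ ((1 / δ) *
      ∫ t in T..(T + δ), ZetaLine.invNorm (1 + t * Complex.I) ^ p) ^ (1 / p)) :=
    ⟨_, Set.forall_mem_range.mpr hlow'⟩
  have h1 := (ciInf_le hbdd T).trans (hT p hp)
  have h2 := le_ciInf hlow'
  have h3 : a * δ * (1 - C₁ * δ ^ 2) ≤ a * δ * Real.exp (-(C₁ * δ ^ 2)) := by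
    gcongr
    linarith [Real.add_one_le_exp (-(C₁ * δ ^ 2))]
  rw [abs_le]
  constructor
  · nlinarith [mul_pos hC₂ (pow_pos hδ 3)]
  · nlinarith [mul_pos (mul_pos ha0 hC₁) (pow_pos hδ 3)]
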